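/- For any real number ξ>0, for Lebesgue-almost all x>1 one has limsup_{N→∞} √N · D_N({ξ x^{n}}) / √(log log N) = limsup_{N→∞} √N · D_N^*({ξ x^{n}}) / √(log log N) = 1/√2, where the sequence is the geometric progression (ξ x^n)_{n≥1} reduced modulo 1. -/

import Mathlib

open MeasureTheory Filter

/-- The (extremal) discrepancy of the first `N` terms (indexed `1,…,N`) of `z`. -/
noncomputable def discrepancy (N : ℕ) (z : ℕ → ℝ) : ℝ :=
  sSup { d : ℝ | ∃ a b : ℝ, 0 ≤ a ∧ a < b ∧ b ≤ 1 ∧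
    d = |(∑ n ∈ Finset.Icc 1 N,
        Set.indicator (Set.Ico a b) (fun _ => (1 : ℝ)) (z n)) / N - (b - a)| }

/-- The star discrepancy of the first `N` terms (indexed `1,…,N`) of `z`. -/
noncomputable def starDiscrepancy (N : ℕ) (z : ℕ → ℝ) : ℝ :=
  sSup { d : ℝ | ∃ a : ℝ, 0 < a ∧ a ≤ 1 ∧
    d = |(∑ n ∈ Finset.Icc 1 N,
        Set.indicator (Set.Ico 0 a) (fun _ => (1 : ℝ)) (z n)) / N - a| }

theorem ibp {A B K α β γ Γ : ℝ} (hAB : A ≤ B) {φ φ1 φ2 h H G : ℝ → ℝ}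
    (h1 : ∀ x, HasDerivAt φ (φ1 x) x) (h2 : ∀ x, HasDerivAt φ1 (φ2 x) x) (c2 : Continuous φ2)
    (hH : ∀ y, HasDerivAt H (h y) y) (ch : Continuous h) (hK : ∀ y, |H y| ≤ K)
    (hG : ContDiff ℝ 1 G) (G0 : ∀ x ∈ Set.Icc A B, 0 ≤ G x ∧ G x ≤ Γ)
    (hne : ∀ x ∈ Set.Icc A B, φ1 x ≠ 0)
    (hα : ∀ x ∈ Set.Icc A B, |deriv G x| ≤ α * |φ1 x| * G x)
    (hβ : ∀ x ∈ Set.Icc A B, |φ2 x| ≤ β * (φ1 x) ^ 2)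
    (hγ : ∀ x ∈ Set.Icc A B, 1 ≤ γ * |φ1 x|) :
    |∫ x in A..B, G x * h (φ x)| ≤ K * ((α + β) * (∫ x in A..B, G x) + 2 * γ * Γ) := by
  have hK0 : 0 ≤ K := (abs_nonneg _).trans (hK 0)
  have c1 : Continuous φ1 := continuous_iff_continuousAt.2 fun x => (h2 x).continuousAt
  have c0 : Continuous φ := continuous_iff_continuousAt.2 fun x => (h1 x).continuousAt
  have cH : Continuous H := continuous_iff_continuousAt.2 fun x => (hH x).continuousAt
  have cG : Continuous G := hG.continuous
  have cG' : Continuous (deriv G) := hG.continuous_deriv le_rfl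
  have dG : ∀ x, HasDerivAt G (deriv G x) x := fun x =>
    (hG.differentiable one_ne_zero x).hasDerivAt
  have uI : Set.uIcc A B = Set.Icc A B := Set.uIcc_of_le hAB
  set u : ℝ → ℝ := fun x => G x / φ1 x with hu
  set u' : ℝ → ℝ := fun x => (deriv G x * φ1 x - G x * φ2 x) / (φ1 x) ^ 2 with hu'
  have cu' : ContinuousOn u' (Set.uIcc A B) := by
    rw [uI]
    apply ContinuousOn.div
    · fun_prop
    · fun_prop
    · intro x hx; exact pow_ne_zero _ (hne x hx)
  have key := intervalIntegral.integral_mul_deriv_eq_deriv_mul (a := A) (b := B)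
    (u := u) (u' := u') (v := fun x => H (φ x)) (v' := fun x => h (φ x) * φ1 x)
    (by intro x hx; rw [uI] at hx; exact (dG x).div (h2 x) (hne x hx))
    (by intro x hx; exact (hH (φ x)).comp x (h1 x))
    cu'.intervalIntegrable
    ((by fun_prop : Continuous fun x => h (φ x) * φ1 x).intervalIntegrable _ _)
  have e1 : ∫ x in A..B, G x * h (φ x) = ∫ x in A..B, u x * (h (φ x) * φ1 x) := by
    apply intervalIntegral.integral_congr
    intro x hx; rw [uI] at hx
    have := hne x hx
    simp only [hu]; field_simp
  rw [e1, key]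
  have bu : ∀ x ∈ Set.Icc A B, |u x * H (φ x)| ≤ K * (γ * Γ) := by
    intro x hx
    rw [abs_mul, mul_comm]
    apply mul_le_mul (hK _) _ (abs_nonneg _) hK0
    have p : 0 < |φ1 x| := abs_pos.2 (hne x hx)
    simp only [hu]
    rw [abs_div, div_le_iff₀ p, abs_of_nonneg (G0 x hx).1]
    nlinarith [hγ x hx, (G0 x hx).1, (G0 x hx).2]
  have bi : |∫ x in A..B, u' x * H (φ x)| ≤ ∫ x in A..B, K * (α + β) * G x := by
    rw [← Real.norm_eq_abs]
    apply intervalIntegral.norm_integral_le_of_norm_le hAB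
    · refine Filter.Eventually.of_forall fun x hx => ?_
      have hx : x ∈ Set.Icc A B := ⟨hx.1.le, hx.2⟩
      rw [Real.norm_eq_abs, abs_mul, mul_comm, mul_assoc]
      apply mul_le_mul (hK _) _ (abs_nonneg _) hK0
      have p : 0 < |φ1 x| := abs_pos.2 (hne x hx)
      simp only [hu']
      rw [abs_div, abs_of_nonneg (sq_nonneg (φ1 x)), div_le_iff₀ (by rw [← sq_abs]; positivity)]
      refine (abs_sub _ _).trans ?_
      rw [abs_mul, abs_mul, abs_of_nonneg (G0 x hx).1]
      have a1 := mul_le_mul_of_nonneg_right (hα x hx) p.le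
      have a2 := mul_le_mul_of_nonneg_left (hβ x hx) (G0 x hx).1
      have a3 : |φ1 x| * |φ1 x| = φ1 x ^ 2 := by rw [← sq, sq_abs]
      have a4 : α * |φ1 x| * G x * |φ1 x| = α * G x * φ1 x ^ 2 := by rw [← a3]; ring
      linarith
    · exact (by fun_prop : Continuous fun x => K * (α + β) * G x).intervalIntegrable _ _
  rw [intervalIntegral.integral_const_mul] at bi
  have b1 := bu A ⟨le_rfl, hAB⟩
  have b2 := bu B ⟨hAB, le_rfl⟩
  rw [abs_le] at *
  constructor <;> nlinarith

/-- admissible weights -/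
def Adm (A B κ Γ : ℝ) (n : ℕ) (G : ℝ → ℝ) : Prop :=
  ContDiff ℝ 1 G ∧ ∀ x ∈ Set.Icc A B, 0 ≤ G x ∧ G x ≤ Γ ∧
    |x * deriv G x| ≤ κ * (n * x ^ n) * G x

theorem Adm.mono {A B κ κ' Γ : ℝ} {n : ℕ} {G : ℝ → ℝ} (h : Adm A B κ Γ n G) (hA : 0 ≤ A)
    (hk : κ ≤ κ') : Adm A B κ' Γ n G :=
  ⟨h.1, fun x hx => ⟨(h.2 x hx).1, (h.2 x hx).2.1, (h.2 x hx).2.2.trans (by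
    have := (h.2 x hx).1
    have : 0 ≤ x := hA.trans hx.1
    gcongr)⟩⟩

def UU (m : ℕ) (x : ℝ) : ℝ := ∑ n ∈ Finset.Icc 1 m, (n : ℝ) * x ^ n

theorem UU_succ (m : ℕ) (x : ℝ) : UU (m + 1) x = UU m x + ((m + 1 : ℕ) : ℝ) * x ^ (m + 1) := by
  unfold UU
  rw [Finset.sum_Icc_succ_top (by omega)]

theorem UU_nonneg (m : ℕ) {x : ℝ} (hx : 0 ≤ x) : 0 ≤ UU m x :=
  Finset.sum_nonneg fun _ _ => by positivity

theorem UU_mono {m n : ℕ} (h : m ≤ n) {x : ℝ} (hx : 0 ≤ x) : UU m x ≤ UU n x := by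
  unfold UU
  apply Finset.sum_le_sum_of_subset_of_nonneg
  · exact Finset.Icc_subset_Icc le_rfl h
  · intros; positivity

theorem pow_step {A x : ℝ} (hA : 1 < A) (hx : A ≤ x) {m n : ℕ} (h : m ≤ n) :
    (m : ℝ) * x ^ m ≤ (A⁻¹) ^ (n - m) * (n * x ^ n) := by
  obtain ⟨d, rfl⟩ := Nat.exists_eq_add_of_le h
  have hx0 : 0 < x := by linarith
  simp only [Nat.add_sub_cancel_left]
  have e : (A⁻¹) ^ d * (((m + d : ℕ) : ℝ) * x ^ (m + d))
      = ((m + d : ℕ) : ℝ) * x ^ m * (x / A) ^ d := by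
    rw [pow_add, div_eq_mul_inv, mul_pow]; ring
  rw [e]
  have : 1 ≤ (x / A) ^ d := one_le_pow₀ (by rw [le_div_iff₀ (by linarith)]; linarith)
  have h2 : (m : ℝ) ≤ ((m + d : ℕ) : ℝ) := by exact_mod_cast Nat.le_add_right _ _
  calc (m : ℝ) * x ^ m ≤ ((m + d : ℕ) : ℝ) * x ^ m := by gcongr
    _ ≤ _ := le_mul_of_one_le_right (by positivity) this

theorem UU_le_self {A x : ℝ} (hA : 1 < A) (hx : A ≤ x) (n : ℕ) :
    UU n x ≤ A / (A - 1) * (n * x ^ n) := by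
  induction n with
  | zero => simp [UU]
  | succ n ih =>
    rw [UU_succ]
    have h := pow_step hA hx (Nat.le_succ n)
    have h1 : 0 < A - 1 := by linarith
    simp only [Nat.succ_eq_add_one, Nat.add_sub_cancel_left, pow_one] at h
    set T := ((n + 1 : ℕ) : ℝ) * x ^ (n + 1)
    have : A / (A - 1) * (n * x ^ n) ≤ A / (A - 1) * (A⁻¹ * T) := by gcongr
    have e : A / (A - 1) * (A⁻¹ * T) + T = A / (A - 1) * T := by
      field_simp; ring
    linarith

theorem UU_le {A x : ℝ} (hA : 1 < A) (hx : A ≤ x) {m n : ℕ} (h : m ≤ n) :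
    UU m x ≤ A / (A - 1) * (A⁻¹) ^ (n - m) * (n * x ^ n) := by
  refine (UU_le_self hA hx m).trans ?_
  rw [mul_assoc]
  have := pow_step hA hx h
  have h1 : 0 < A - 1 := by linarith
  gcongr

/-- first moment -/
theorem first_moment {ξ A0 B0 A B K κ Γ : ℝ} (hξ : 0 < ξ) (hA0 : 1 < A0) (hA : A0 ≤ A)
    (hAB : A ≤ B) (hB : B ≤ B0) {h H G : ℝ → ℝ} {n : ℕ} (hn : 1 ≤ n)
    (hH : ∀ y, HasDerivAt H (h y) y) (ch : Continuous h) (hK : ∀ y, |H y| ≤ K)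
    (hG : Adm A B κ Γ n G) :
    |∫ x in A..B, G x * h (ξ * x ^ n)| ≤
      K / ξ * ((κ + (A0⁻¹) ^ n) * (∫ x in A..B, G x) + 2 * B0 * (A0⁻¹) ^ n * Γ) := by
  have key := ibp (K := K) (α := κ / ξ) (β := (A0⁻¹) ^ n / ξ) (γ := B0 * (A0⁻¹) ^ n / ξ)
    (Γ := Γ) hAB
    (φ := fun x => ξ * x ^ n) (φ1 := fun x => ξ * (n * x ^ (n - 1)))
    (φ2 := fun x => ξ * (n * (((n - 1 : ℕ) : ℝ) * x ^ (n - 1 - 1)))) (G := G) (H := H) (h := h)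
    (fun x => (hasDerivAt_pow n x).const_mul ξ)
    (fun x => ((hasDerivAt_pow (n - 1) x).const_mul (n : ℝ)).const_mul ξ)
    (by fun_prop) hH ch hK hG.1 (fun x hx => ⟨(hG.2 x hx).1, (hG.2 x hx).2.1⟩) ?_ ?_ ?_ ?_
  · refine key.trans (le_of_eq ?_)
    field_simp
  all_goals
    intro x hx
    have hx1 : A0 ≤ x := hA.trans hx.1
    have hx0 : 0 < x := by linarith
    have hn0 : (0 : ℝ) < n := by exact_mod_cast hn
    have hn1 : (1 : ℝ) ≤ n := by exact_mod_cast hn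
    have pw : x ^ n = x ^ (n - 1) * x := by rw [← pow_succ, Nat.sub_add_cancel hn]
    have pos : 0 < ξ * (n * x ^ (n - 1)) := by positivity
    have ps := pow_le_pow_left₀ (by linarith) hx1 n
    have p0 : 0 < A0 ^ n := by positivity
  · exact pos.ne'
  · have := (hG.2 x hx).2.2
    rw [abs_mul, abs_of_pos hx0] at this
    simp only [abs_of_pos pos]
    rw [pw] at this
    refine le_of_mul_le_mul_left (this.trans (le_of_eq ?_)) hx0
    field_simp
  · rw [abs_of_nonneg (by positivity)]
    have q : x ^ (n - 1 - 1) * ((n - 1 : ℕ) : ℝ) * x ^ 2 = x ^ n * ((n - 1 : ℕ) : ℝ) := by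
      rcases Nat.eq_or_lt_of_le hn with h1 | h1
      · subst h1; simp
      · have : x ^ n = x ^ (n - 1 - 1) * x ^ 2 := by
          rw [← pow_add]; congr 1; omega
        rw [this]; ring
    have hle : ((n - 1 : ℕ) : ℝ) ≤ n := by exact_mod_cast Nat.sub_le _ _
    have x2 : 0 < x ^ 2 := by positivity
    refine le_of_mul_le_mul_right ?_ x2
    have l1 : ξ * (n * (((n - 1 : ℕ) : ℝ) * x ^ (n - 1 - 1))) * x ^ 2
        = ξ * n * (x ^ n * ((n - 1 : ℕ) : ℝ)) := by rw [← q]; ring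
    have l2 : A0⁻¹ ^ n / ξ * (ξ * (n * x ^ (n - 1))) ^ 2 * x ^ 2
        = ξ * n * x ^ n * (n * (x ^ n / A0 ^ n)) := by
      rw [pw, inv_pow]; field_simp
    rw [l1, l2]
    have : 1 ≤ x ^ n / A0 ^ n := by rwa [one_le_div p0]
    have : (n : ℝ) ≤ n * (x ^ n / A0 ^ n) := le_mul_of_one_le_right hn0.le this
    have : ((n - 1 : ℕ) : ℝ) ≤ n * (x ^ n / A0 ^ n) := hle.trans this
    calc _ = ξ * n * x ^ n * ((n - 1 : ℕ) : ℝ) := by ring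
      _ ≤ _ := by gcongr
  · simp only [abs_of_pos pos]
    have e : B0 * A0⁻¹ ^ n / ξ * (ξ * (n * x ^ (n - 1))) = B0 / x * n * (x ^ n / A0 ^ n) := by
      rw [pw, inv_pow]; field_simp
    rw [e]
    have a1 : 1 ≤ x ^ n / A0 ^ n := by rwa [one_le_div p0]
    have a2 : 1 ≤ B0 / x := by rw [one_le_div hx0]; exact hx.2.trans hB
    have := one_le_mul_of_one_le_of_one_le a2 hn1
    exact one_le_mul_of_one_le_of_one_le this a1

theorem poly_osc {ξ A0 B0 x0 : ℝ} (hξ : 0 < ξ) (hA0 : 1 < A0) (hB0 : A0 ≤ B0)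
    (p : Polynomial ℝ) (hp : p.eval x0 ≠ 0)
    {ε : ℝ} (hε : 0 < ε) :
    ∃ r > 0, ∃ κ0 > 0, ∃ n0 : ℕ, ∃ C ≥ 0, ∀ A B : ℝ, A0 ≤ A → A ≤ B → B ≤ B0 →
      x0 - r ≤ A → B ≤ x0 + r → ∀ n ≥ n0, ∀ Γ : ℝ, ∀ G : ℝ → ℝ, Adm A B κ0 Γ n G →
      ∀ h H : ℝ → ℝ, (∀ y, HasDerivAt H (h y) y) → Continuous h → (∀ y, |H y| ≤ 1) →
      |∫ x in A..B, G x * h (ξ * (x ^ n * p.eval x))| ≤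
        ε * (∫ x in A..B, G x) + C * Γ * (A0⁻¹) ^ n := by
  set c := |p.eval x0| / 2 with hc
  have c0 : 0 < c := by have := abs_pos.2 hp; positivity
  obtain ⟨r, r0, hr⟩ : ∃ r > 0, ∀ x, |x - x0| ≤ r → c ≤ |p.eval x| := by
    have : Tendsto (fun x => |p.eval x|) (nhds x0) (nhds |p.eval x0|) :=
      (p.continuous.abs).tendsto x0
    have h2 := this.eventually (lt_mem_nhds (show c < |p.eval x0| by
      have := abs_pos.2 hp; rw [hc]; linarith))
    obtain ⟨r, r0, hr⟩ := Metric.eventually_nhds_iff.1 h2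
    exact ⟨r / 2, by positivity, fun x hx => (hr (by rw [Real.dist_eq]; linarith)).le⟩
  have bd : ∀ f : ℝ → ℝ, Continuous f → ∃ P ≥ 0, ∀ x ∈ Set.Icc A0 B0, |f x| ≤ P := by
    intro f hf
    obtain ⟨P, hP⟩ := isCompact_Icc.exists_bound_of_continuousOn hf.continuousOn (s := Set.Icc A0 B0)
    exact ⟨P, (norm_nonneg _).trans (hP A0 ⟨le_rfl, hB0⟩), fun x hx => hP x hx⟩
  obtain ⟨Q0, Q00, hQ0⟩ := bd (fun x => p.eval x) p.continuous
  obtain ⟨Q1, Q10, hQ1⟩ := bd (fun x => x * p.derivative.eval x)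
    (continuous_id.mul p.derivative.continuous)
  obtain ⟨Q2, Q20, hQ2⟩ := bd (fun x => x ^ 2 * p.derivative.derivative.eval x)
    ((continuous_id.pow 2).mul p.derivative.derivative.continuous)
  set Q := Q0 + 2 * Q1 + Q2 with hQ
  have i1 : A0⁻¹ < 1 := inv_lt_one_of_one_lt₀ hA0
  have i0 : 0 < A0⁻¹ := by positivity
  have t1 : Tendsto (fun n : ℕ => 4 * Q / (ξ * c ^ 2) * (A0⁻¹) ^ n) atTop (nhds 0) := by
    have := (tendsto_pow_atTop_nhds_zero_of_lt_one i0.le i1).const_mul (4 * Q / (ξ * c ^ 2))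
    simpa using this
  obtain ⟨n1, hn1⟩ := eventually_atTop.1 (t1.eventually (gt_mem_nhds (show 0 < ε / 2 by positivity)))
  obtain ⟨n2, hn2⟩ := exists_nat_ge (2 * Q1 / c)
  refine ⟨r, r0, ε * ξ * c / 4, by positivity, n1 + n2 + 2, 2 * (2 * B0 / (ξ * c)),
    by have : 0 < B0 := by linarith
       positivity, ?_⟩
  intro A B hA hAB hB hAr hBr n hn Γ G hG h H hH ch hK
  set q : Polynomial ℝ := Polynomial.C ξ * (Polynomial.X ^ n * p) with hq
  have d1 : ∀ x, x * q.derivative.eval x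
      = ξ * x ^ n * (n * p.eval x + x * p.derivative.eval x) := by
    intro x
    obtain ⟨m, rfl⟩ : ∃ m, n = m + 2 := ⟨n - 2, by omega⟩
    simp [hq, Polynomial.derivative_mul, Polynomial.derivative_X_pow]
    ring
  have d2 : ∀ x, x ^ 2 * q.derivative.derivative.eval x
      = ξ * x ^ n * (n * (n - 1) * p.eval x + 2 * n * (x * p.derivative.eval x)
        + x ^ 2 * p.derivative.derivative.eval x) := by
    intro x
    obtain ⟨m, rfl⟩ : ∃ m, n = m + 2 := ⟨n - 2, by omega⟩
    simp [hq, Polynomial.derivative_mul, Polynomial.derivative_X_pow]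
    ring
  have hn2' : (2 : ℝ) ≤ n := by exact_mod_cast (by omega : 2 ≤ n)
  have hnQ : 2 * Q1 ≤ n * c := by
    have : (n2 : ℝ) ≤ n := by exact_mod_cast (by omega : n2 ≤ n)
    have := hn2.trans this
    rwa [div_le_iff₀ c0] at this
  have main : ∀ x ∈ Set.Icc A B, 0 < x ∧ ξ * (n * x ^ n) * (c / 2) ≤ x * |q.derivative.eval x| ∧
      x ^ 2 * |q.derivative.derivative.eval x| ≤ ξ * x ^ n * n ^ 2 * Q ∧ A0 ^ n ≤ x ^ n := by
    intro x hx
    have hx1 : A0 ≤ x := hA.trans hx.1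
    have hx0 : 0 < x := by linarith
    have hxI : x ∈ Set.Icc A0 B0 := ⟨hx1, hx.2.trans hB⟩
    refine ⟨hx0, ?_, ?_, pow_le_pow_left₀ (by linarith) hx1 n⟩
    · have e : x * |q.derivative.eval x| = |x * q.derivative.eval x| := by
        rw [abs_mul, abs_of_pos hx0]
      rw [e, d1, abs_mul, abs_of_pos (by positivity : 0 < ξ * x ^ n)]
      have b1 := hr x (by rw [abs_le]; constructor <;> linarith [hx.1, hx.2])
      have b2 := hQ1 x hxI
      have b3 : n * c / 2 ≤ |n * p.eval x + x * p.derivative.eval x| := by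
        have := abs_sub_abs_le_abs_add (n * p.eval x) (x * p.derivative.eval x)
        rw [abs_mul, abs_of_nonneg (by positivity : (0 : ℝ) ≤ n)] at this
        have : (n : ℝ) * c ≤ n * |p.eval x| := by gcongr
        linarith
      calc _ = ξ * x ^ n * (n * c / 2) := by ring
        _ ≤ _ := by gcongr
    · have e : x ^ 2 * |q.derivative.derivative.eval x|
          = |x ^ 2 * q.derivative.derivative.eval x| := by
        rw [abs_mul, abs_of_pos (by positivity : 0 < x ^ 2)]
      rw [e, d2, abs_mul, abs_of_pos (by positivity : 0 < ξ * x ^ n), mul_assoc (ξ * x ^ n)]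
      gcongr
      refine (abs_add_three _ _ _).trans ?_
      rw [abs_mul, abs_mul (2 * (n : ℝ)), abs_of_nonneg (by nlinarith : (0 : ℝ) ≤ n * (n - 1)),
        abs_of_nonneg (by positivity : (0 : ℝ) ≤ 2 * n)]
      have b0 := hQ0 x hxI
      have b1 := hQ1 x hxI
      have b2 := hQ2 x hxI
      have s1 : (n : ℝ) * (n - 1) * |p.eval x| ≤ n ^ 2 * Q0 := by
        apply mul_le_mul _ b0 (abs_nonneg _) (by positivity); nlinarith
      have s2 : 2 * (n : ℝ) * |x * p.derivative.eval x| ≤ n ^ 2 * (2 * Q1) := by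
        have : 2 * (n : ℝ) * |x * p.derivative.eval x| ≤ 2 * n * Q1 := by gcongr
        have : 2 * (n : ℝ) * Q1 ≤ n ^ 2 * (2 * Q1) := by
          nlinarith [mul_nonneg (by nlinarith : (0 : ℝ) ≤ n ^ 2 - n) Q10]
        linarith
      have s3 : |x ^ 2 * p.derivative.derivative.eval x| ≤ n ^ 2 * Q2 := by
        refine b2.trans (le_mul_of_one_le_left Q20 (by nlinarith))
      rw [hQ]; linarith
  have key := ibp (K := 1) (α := ε / 2) (β := 4 * Q / (ξ * c ^ 2) * (A0⁻¹) ^ n)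
    (γ := 2 * B0 / (ξ * c) * (A0⁻¹) ^ n) (Γ := Γ) hAB
    (φ := fun x => q.eval x) (φ1 := fun x => q.derivative.eval x)
    (φ2 := fun x => q.derivative.derivative.eval x) (G := G) (H := H) (h := h)
    (fun x => q.hasDerivAt x) (fun x => q.derivative.hasDerivAt x)
    q.derivative.derivative.continuous hH ch hK hG.1
    (fun x hx => ⟨(hG.2 x hx).1, (hG.2 x hx).2.1⟩) ?_ ?_ ?_ ?_
  · have e : ∀ x, q.eval x = ξ * (x ^ n * p.eval x) := by intro x; simp [hq]
    simp only [e] at key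
    refine key.trans ?_
    have := hn1 n (by omega)
    have hI : 0 ≤ ∫ x in A..B, G x :=
      intervalIntegral.integral_nonneg hAB fun x hx => (hG.2 x hx).1
    rw [one_mul]
    have : (ε / 2 + 4 * Q / (ξ * c ^ 2) * A0⁻¹ ^ n) * (∫ x in A..B, G x)
        ≤ ε * ∫ x in A..B, G x := by
      apply mul_le_mul_of_nonneg_right _ hI; linarith
    nlinarith
  all_goals
    intro x hx
    obtain ⟨hx0, m1, m2, m3⟩ := main x hx
    have p0 : 0 < A0 ^ n := by positivity
    have px : 0 < x ^ n := by positivity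
  · intro h0
    rw [h0] at m1
    simp only [abs_zero, mul_zero] at m1
    have : 0 < ξ * (n * x ^ n) * (c / 2) := by positivity
    linarith
  · have := (hG.2 x hx).2.2
    have g0 := (hG.2 x hx).1
    rw [abs_mul, abs_of_pos hx0] at this
    refine le_of_mul_le_mul_left (this.trans ?_) hx0
    calc ε * ξ * c / 4 * (n * x ^ n) * G x = ε / 2 * (ξ * (n * x ^ n) * (c / 2)) * G x := by ring
      _ ≤ ε / 2 * (x * |q.derivative.eval x|) * G x := by gcongr
      _ = _ := by ring
  · refine le_of_mul_le_mul_left (m2.trans ?_) (by positivity : 0 < x ^ 2)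
    have s := mul_self_le_mul_self (by positivity) m1
    have e : x ^ 2 * (4 * Q / (ξ * c ^ 2) * A0⁻¹ ^ n * q.derivative.eval x ^ 2)
      = 4 * Q / (ξ * c ^ 2) * A0⁻¹ ^ n *
        ((x * |q.derivative.eval x|) * (x * |q.derivative.eval x|)) := by
      have : |q.derivative.eval x| * |q.derivative.eval x| = q.derivative.eval x ^ 2 := by
        rw [← sq, sq_abs]
      rw [← this]; ring
    rw [e]
    have hQ' : 0 ≤ Q := by positivity
    calc _ ≤ ξ * x ^ n * n ^ 2 * Q * (x ^ n / A0 ^ n) := by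
          apply le_mul_of_one_le_right (by positivity)
          rwa [one_le_div p0]
      _ = 4 * Q / (ξ * c ^ 2) * A0⁻¹ ^ n * (ξ * (n * x ^ n) * (c / 2) * (ξ * (n * x ^ n) * (c / 2))) := by
          rw [inv_pow]; field_simp; norm_num
      _ ≤ _ := by gcongr
  · refine le_of_mul_le_mul_left (a := x) ?_ hx0
    have hxB : x ≤ B0 := hx.2.trans hB
    have B00 : 0 < B0 := by linarith
    calc x * 1 ≤ B0 * (n * (x ^ n / A0 ^ n)) := by
          have : 1 ≤ x ^ n / A0 ^ n := by rwa [one_le_div p0]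
          have : 1 ≤ n * (x ^ n / A0 ^ n) :=
            one_le_mul_of_one_le_of_one_le (by linarith) this
          apply mul_le_mul hxB this (by norm_num) B00.le
      _ = 2 * B0 / (ξ * c) * A0⁻¹ ^ n * (ξ * (n * x ^ n) * (c / 2)) := by
          rw [inv_pow]; field_simp
      _ ≤ 2 * B0 / (ξ * c) * A0⁻¹ ^ n * (x * |q.derivative.eval x|) := by gcongr
      _ = _ := by ring

instance probCircle : IsProbabilityMeasure (volume : Measure UnitAddCircle) :=
  ⟨UnitAddCircle.measure_univ⟩

noncomputable def ptt (ξ : ℝ) (L n : ℕ) (x : ℝ) : UnitAddTorus (Fin L) :=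
  fun i => ((ξ * x ^ (n + (i : ℕ)) : ℝ) : UnitAddCircle)

theorem ptt_cont (ξ : ℝ) (L n : ℕ) : Continuous (ptt ξ L n) := by
  unfold ptt
  apply continuous_pi
  intro i
  exact (AddCircle.continuous_mk' (1:ℝ)).comp (by fun_prop)

def Good (ξ A0 B0 x0 : ℝ) (L : ℕ) (Φ : C(UnitAddTorus (Fin L), ℂ)) : Prop :=
  ∀ ε > 0, ∃ r > 0, ∃ κ0 > 0, ∃ n0 : ℕ, ∃ C ≥ 0, ∀ A B : ℝ, A0 ≤ A → A ≤ B → B ≤ B0 →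
      x0 - r ≤ A → B ≤ x0 + r → ∀ n ≥ n0, ∀ Γ : ℝ, ∀ G : ℝ → ℝ, Adm A B κ0 Γ n G →
      ‖(∫ x in A..B, (G x : ℂ) * Φ (ptt ξ L n x)) - (∫ z, Φ z) * ((∫ x in A..B, G x : ℝ) : ℂ)‖ ≤
        ε * (∫ x in A..B, G x) + C * Γ * (A0⁻¹) ^ n

theorem Adm.int_nonneg {A B κ Γ : ℝ} {n : ℕ} {G : ℝ → ℝ} (h : Adm A B κ Γ n G) (hAB : A ≤ B) :
    0 ≤ ∫ x in A..B, G x :=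
  intervalIntegral.integral_nonneg hAB fun x hx => (h.2 x hx).1

theorem Adm.Γ_nonneg {A B κ Γ : ℝ} {n : ℕ} {G : ℝ → ℝ} (h : Adm A B κ Γ n G) (hAB : A ≤ B) :
    0 ≤ Γ := (h.2 A ⟨le_rfl, hAB⟩).1.trans (h.2 A ⟨le_rfl, hAB⟩).2.1

theorem torus_int {L : ℕ} (Φ : C(UnitAddTorus (Fin L), ℂ)) : Integrable (fun z => Φ z) :=
  Φ.continuous.integrable_of_hasCompactSupport (HasCompactSupport.of_compactSpace _)

theorem Good.add {ξ A0 B0 x0 : ℝ} {L : ℕ} (hA0 : 1 < A0) {Φ Ψ : C(UnitAddTorus (Fin L), ℂ)}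
    (h1 : Good ξ A0 B0 x0 L Φ) (h2 : Good ξ A0 B0 x0 L Ψ) : Good ξ A0 B0 x0 L (Φ + Ψ) := by
  intro ε hε
  obtain ⟨r, r0, κ, κp, n0, C, C0, H⟩ := h1 (ε/2) (by positivity)
  obtain ⟨r', r0', κ', κp', n0', C', C0', H'⟩ := h2 (ε/2) (by positivity)
  refine ⟨min r r', lt_min r0 r0', min κ κ', lt_min κp κp', max n0 n0', C + C', by positivity, ?_⟩
  intro A B a1 a2 a3 a4 a5 n hn Γ G hG
  have l1 := min_le_left r r'
  have l2 := min_le_right r r'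
  have e1 := H A B a1 a2 a3 (by linarith) (by linarith) n ((le_max_left _ _).trans hn) Γ G
    (hG.mono (by linarith) (min_le_left _ _))
  have e2 := H' A B a1 a2 a3 (by linarith) (by linarith) n ((le_max_right _ _).trans hn) Γ G
    (hG.mono (by linarith) (min_le_right _ _))
  have cG := hG.1.continuous
  have i1 : (∫ x in A..B, (G x : ℂ) * (Φ + Ψ) (ptt ξ L n x)) =
      (∫ x in A..B, (G x : ℂ) * Φ (ptt ξ L n x)) + ∫ x in A..B, (G x : ℂ) * Ψ (ptt ξ L n x) := by
    rw [← intervalIntegral.integral_add]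
    · simp [mul_add]
    · exact Continuous.intervalIntegrable
        (by have := ptt_cont ξ L n; fun_prop) _ _
    · exact Continuous.intervalIntegrable
        (by have := ptt_cont ξ L n; fun_prop) _ _
  have i2 : ∫ z, (Φ + Ψ) z = (∫ z, Φ z) + ∫ z, Ψ z := by
    simp only [ContinuousMap.add_apply]
    exact integral_add (torus_int Φ) (torus_int Ψ)
  rw [i1, i2]
  refine le_trans (le_of_eq ?_) ((norm_add_le _ _).trans ((add_le_add e1 e2).trans (le_of_eq ?_)))
  · congr 1; ring
  · ring

theorem Good.smul {ξ A0 B0 x0 : ℝ} {L : ℕ} (c : ℂ) {Φ : C(UnitAddTorus (Fin L), ℂ)}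
    (h1 : Good ξ A0 B0 x0 L Φ) : Good ξ A0 B0 x0 L (c • Φ) := by
  intro ε hε
  obtain ⟨r, r0, κ, κp, n0, C, C0, H⟩ := h1 (ε/(‖c‖+1)) (by positivity)
  refine ⟨r, r0, κ, κp, n0, ‖c‖ * C, by positivity, ?_⟩
  intro A B a1 a2 a3 a4 a5 n hn Γ G hG
  have e1 := H A B a1 a2 a3 a4 a5 n hn Γ G hG
  have hi := hG.int_nonneg a2
  have i1 : (∫ x in A..B, (G x : ℂ) * (c • Φ) (ptt ξ L n x)) =
      c * (∫ x in A..B, (G x : ℂ) * Φ (ptt ξ L n x)) := by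
    rw [← intervalIntegral.integral_const_mul]
    congr 1; ext x; simp; ring
  have i2 : ∫ z, (c • Φ) z = c * (∫ z, Φ z) := by
    simp [integral_const_mul]
  rw [i1, i2, mul_assoc, ← mul_sub, norm_mul]
  refine (mul_le_mul_of_nonneg_left e1 (norm_nonneg c)).trans ?_
  have : ‖c‖ * (ε / (‖c‖+1)) ≤ ε := by
    rw [← mul_div_assoc, div_le_iff₀ (by positivity)]; nlinarith [norm_nonneg c]
  nlinarith

theorem Good.lim {ξ A0 B0 x0 : ℝ} {L : ℕ} {Φ : C(UnitAddTorus (Fin L), ℂ)}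
    (h1 : ∀ δ > 0, ∃ Ψ, Good ξ A0 B0 x0 L Ψ ∧ ‖Φ - Ψ‖ ≤ δ) : Good ξ A0 B0 x0 L Φ := by
  intro ε hε
  obtain ⟨Ψ, hΨ, hd⟩ := h1 (ε/4) (by positivity)
  obtain ⟨r, r0, κ, κp, n0, C, C0, H⟩ := hΨ (ε/2) (by positivity)
  refine ⟨r, r0, κ, κp, n0, C, C0, ?_⟩
  intro A B a1 a2 a3 a4 a5 n hn Γ G hG
  have e1 := H A B a1 a2 a3 a4 a5 n hn Γ G hG
  have hi := hG.int_nonneg a2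
  have cG := hG.1.continuous
  have j1 := ptt_cont ξ L n
  have pw : ∀ z, ‖Φ z - Ψ z‖ ≤ ε / 4 := fun z =>
    ((Φ - Ψ).norm_coe_le_norm z).trans hd
  have b1 : ‖(∫ x in A..B, (G x : ℂ) * Φ (ptt ξ L n x)) -
      (∫ x in A..B, (G x : ℂ) * Ψ (ptt ξ L n x))‖ ≤ ε/4 * ∫ x in A..B, G x := by
    rw [← intervalIntegral.integral_sub, ← intervalIntegral.integral_const_mul]
    · apply intervalIntegral.norm_integral_le_of_norm_le a2
      · refine Filter.Eventually.of_forall fun x hx => ?_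
        have hx : x ∈ Set.Icc A B := ⟨hx.1.le, hx.2⟩
        rw [← mul_sub, norm_mul, mul_comm]
        have := (hG.2 x hx).1
        rw [Complex.norm_real, Real.norm_eq_abs, abs_of_nonneg this]
        exact mul_le_mul_of_nonneg_right (pw _) this
      · exact Continuous.intervalIntegrable (by fun_prop) _ _
    · exact Continuous.intervalIntegrable (by fun_prop) _ _
    · exact Continuous.intervalIntegrable (by fun_prop) _ _
  have b2 : ‖(∫ z, Φ z) - ∫ z, Ψ z‖ ≤ ε/4 := by
    rw [← integral_sub (torus_int Φ) (torus_int Ψ)]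
    refine (norm_integral_le_of_norm_le_const (Filter.Eventually.of_forall pw)).trans ?_
    simp
  set I := ∫ x in A..B, G x
  have b3 : ‖((∫ z, Φ z) - ∫ z, Ψ z) * (I : ℂ)‖ ≤ ε/4 * I := by
    rw [norm_mul, Complex.norm_real, Real.norm_eq_abs, abs_of_nonneg hi]
    exact mul_le_mul_of_nonneg_right b2 hi
  set a := (∫ x in A..B, (G x : ℂ) * Φ (ptt ξ L n x))
  set b := (∫ x in A..B, (G x : ℂ) * Ψ (ptt ξ L n x))
  have : a - (∫ z, Φ z) * (I : ℂ) = (a - b) - ((∫ z, Φ z) - ∫ z, Ψ z) * (I : ℂ)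
    + (b - (∫ z, Ψ z) * (I : ℂ)) := by ring
  rw [this]
  refine (norm_add_le _ _).trans ?_
  have := norm_sub_le (a - b) (((∫ z, Φ z) - ∫ z, Ψ z) * (I : ℂ))
  linarith

theorem int_mFourier {L : ℕ} {k : Fin L → ℤ} (hk : k ≠ 0) :
    ∫ z, UnitAddTorus.mFourier k z = 0 := by
  rw [UnitAddTorus.mFourier, ContinuousMap.coe_mk, MeasureTheory.integral_fintype_prod_volume_eq_prod]
  obtain ⟨i, hi⟩ := Function.ne_iff.mp hk
  apply Finset.prod_eq_zero (Finset.mem_univ i)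
  have := (orthonormal_iff_ite.mp <| orthonormal_fourier (T := (1:ℝ))) 0 (k i)
  have h0 : ¬ (0 = k i) := fun h => hi h.symm
  rw [if_neg h0, ContinuousMap.inner_toLp] at this
  have hv : (volume : Measure UnitAddCircle) = AddCircle.haarAddCircle := by
    have := AddCircle.volume_eq_smul_haarAddCircle (T := (1:ℝ))
    simpa using this
  rw [hv]
  simpa using! this

theorem Good.mono {ξ A0 B0 x0 : ℝ} (hξ : 0 < ξ) (hA0 : 1 < A0) (hB0 : A0 ≤ B0)
    (hx : Transcendental ℤ x0) {L : ℕ} (k : Fin L → ℤ) :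
    Good ξ A0 B0 x0 L (UnitAddTorus.mFourier k) := by
  intro ε hε
  by_cases hk : k = 0
  · subst hk
    refine ⟨1, one_pos, 1, one_pos, 0, 0, le_rfl, ?_⟩
    intro A B a1 a2 a3 a4 a5 n hn Γ G hG
    rw [UnitAddTorus.mFourier_zero]
    have := mul_nonneg hε.le (hG.int_nonneg a2)
    simp only [ContinuousMap.one_apply, mul_one, intervalIntegral.integral_ofReal,
      integral_const, probReal_univ, one_smul, one_mul, sub_self, norm_zero]
    simpa using this
  set pZ : Polynomial ℤ := ∑ i : Fin L, Polynomial.monomial (i : ℕ) (k i) with hpZ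
  have hne : pZ ≠ 0 := by
    intro h0
    apply hk
    ext i
    have := congrArg (fun p => Polynomial.coeff p (i : ℕ)) h0
    simp only [hpZ, Polynomial.finsetSum_coeff, Polynomial.coeff_monomial, Polynomial.coeff_zero] at this
    rw [Finset.sum_eq_single i] at this
    · simpa using this
    · intro b _ hb; rw [if_neg]; exact fun h => hb (Fin.ext h)
    · simp
  set p : Polynomial ℝ := pZ.map (Int.castRingHom ℝ) with hp
  have ev : ∀ x, p.eval x = ∑ i : Fin L, (k i : ℝ) * x ^ (i : ℕ) := by
    intro x
    simp [hp, hpZ, Polynomial.eval_finsetSum, Polynomial.map_sum, Polynomial.eval_map]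
  have hp0 : p.eval x0 ≠ 0 := by
    rw [transcendental_iff] at hx
    intro h0
    apply hne (hx pZ ?_)
    rw [hp, Polynomial.eval_map] at h0
    exact h0
  obtain ⟨r, r0, κ, κp, n0, C, C0, H⟩ := poly_osc hξ hA0 hB0 p hp0 (ε := ε/2) (by positivity)
  refine ⟨r, r0, κ, κp, n0, 2 * C, by positivity, ?_⟩
  intro A B a1 a2 a3 a4 a5 n hn Γ G hG
  rw [int_mFourier hk, zero_mul, sub_zero]
  have pi2 : (0:ℝ) < 2 * Real.pi := by positivity
  have pi1 : (1:ℝ) ≤ 2 * Real.pi := by linarith [Real.pi_gt_three]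
  have ec := H A B a1 a2 a3 a4 a5 n hn Γ G hG (fun y => Real.cos (2 * Real.pi * y))
    (fun y => Real.sin (2 * Real.pi * y) / (2 * Real.pi)) (by
      intro y
      have := ((Real.hasDerivAt_sin (2 * Real.pi * y)).comp y ((hasDerivAt_id y).const_mul (2 * Real.pi))).div_const (2*Real.pi)
      convert! this using 1
      field_simp) (by fun_prop) (by
      intro y; rw [abs_div, abs_of_pos pi2, div_le_one pi2]; exact (Real.abs_sin_le_one _).trans pi1)
  have es := H A B a1 a2 a3 a4 a5 n hn Γ G hG (fun y => Real.sin (2 * Real.pi * y))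
    (fun y => -Real.cos (2 * Real.pi * y) / (2 * Real.pi)) (by
      intro y
      have := (((Real.hasDerivAt_cos (2 * Real.pi * y)).comp y ((hasDerivAt_id y).const_mul (2 * Real.pi))).neg).div_const (2*Real.pi)
      convert! this using 1
      field_simp) (by fun_prop) (by
      intro y; rw [abs_div, abs_neg, abs_of_pos pi2, div_le_one pi2]; exact (Real.abs_cos_le_one _).trans pi1)
  have cG := hG.1.continuous
  have key : (∫ x in A..B, (G x : ℂ) * UnitAddTorus.mFourier k (ptt ξ L n x)) =
      ((∫ x in A..B, G x * Real.cos (2 * Real.pi * (ξ * (x ^ n * p.eval x))) : ℝ) : ℂ) +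
      ((∫ x in A..B, G x * Real.sin (2 * Real.pi * (ξ * (x ^ n * p.eval x))) : ℝ) : ℂ) * Complex.I := by
    rw [← intervalIntegral.integral_ofReal, ← intervalIntegral.integral_ofReal,
      ← intervalIntegral.integral_mul_const, ← intervalIntegral.integral_add]
    · congr 1; ext x
      have : UnitAddTorus.mFourier k (ptt ξ L n x) =
          Complex.exp ((2 * Real.pi * (ξ * (x ^ n * p.eval x)) : ℝ) * Complex.I) := by
        simp only [UnitAddTorus.mFourier, ContinuousMap.coe_mk, ptt]
        simp only [UnitAddCircle, fourier_coe_apply]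
        rw [← Complex.exp_sum]
        congr 1
        rw [ev]
        push_cast
        simp only [Finset.mul_sum, Finset.sum_mul]
        apply Finset.sum_congr rfl
        intro i _
        rw [pow_add]; ring
      rw [this, Complex.exp_mul_I]
      push_cast; ring
    · exact Continuous.intervalIntegrable (by fun_prop) _ _
    · exact Continuous.intervalIntegrable (by fun_prop) _ _
  rw [key]
  refine (norm_add_le _ _).trans ?_
  rw [norm_mul, Complex.norm_I, mul_one, Complex.norm_real, Complex.norm_real, Real.norm_eq_abs, Real.norm_eq_abs]
  linarith

theorem Good.all {ξ A0 B0 x0 : ℝ} (hξ : 0 < ξ) (hA0 : 1 < A0) (hB0 : A0 ≤ B0)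
    (hx : Transcendental ℤ x0) {L : ℕ} (Φ : C(UnitAddTorus (Fin L), ℂ)) :
    Good ξ A0 B0 x0 L Φ := by
  apply Good.lim
  intro δ hδ
  have h : Φ ∈ (Submodule.span ℂ (Set.range <| UnitAddTorus.mFourier (d := Fin L))).topologicalClosure := by
    rw [UnitAddTorus.span_mFourier_closure_eq_top]; trivial
  obtain ⟨Ψ, hΨ, hd⟩ := Metric.mem_closure_iff.1 h δ hδ
  refine ⟨Ψ, ?_, by rw [← dist_eq_norm]; exact hd.le⟩
  clear hd h
  replace hΨ : Ψ ∈ Submodule.span ℂ (Set.range <| UnitAddTorus.mFourier (d := Fin L)) := hΨ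
  induction hΨ using Submodule.span_induction with
  | mem y hy => obtain ⟨k, rfl⟩ := hy; exact Good.mono hξ hA0 hB0 hx k
  | zero =>
    have := (Good.mono (L := L) hξ hA0 hB0 hx 0).smul 0
    have e : ((0:ℂ) • UnitAddTorus.mFourier (0 : Fin L → ℤ) : C(UnitAddTorus (Fin L), ℂ)) = 0 := by
      ext; simp
    rwa [e] at this
  | add _ _ _ _ h1 h2 => exact h1.add hA0 h2
  | smul c _ _ h => exact h.smul c

/-- second moment -/
theorem second_moment {ξ A0 B0 x0 : ℝ} (hξ : 0 < ξ) (hA0 : 1 < A0) (hB0 : A0 ≤ B0)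
    (hx : Transcendental ℤ x0) (L : ℕ) {f : ℝ → ℝ} (cf : Continuous f)
    (pf : Function.Periodic f 1) (m0 : ∫ y in (0:ℝ)..1, f y = 0) {ε : ℝ} (hε : 0 < ε) :
    ∃ r > 0, ∃ κ0 > 0, ∃ n0 : ℕ, ∃ C ≥ 0, ∀ A B : ℝ, A0 ≤ A → A ≤ B → B ≤ B0 →
      x0 - r ≤ A → B ≤ x0 + r → ∀ n ≥ n0, ∀ Γ : ℝ, ∀ G : ℝ → ℝ, Adm A B κ0 Γ n G →
      |(∫ x in A..B, G x * (∑ i ∈ Finset.range L, f (ξ * x ^ (n + i))) ^ 2) -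
        L * (∫ y in (0:ℝ)..1, f y ^ 2) * (∫ x in A..B, G x)| ≤
        ε * (∫ x in A..B, G x) + C * Γ * (A0⁻¹) ^ n := by
  set F : UnitAddCircle → ℝ := pf.lift with hF
  have Fc : ∀ y : ℝ, F (y : UnitAddCircle) = f y := fun y => pf.lift_coe y
  have cF : Continuous F := continuous_coinduced_dom.mpr cf
  set Φ : C(UnitAddTorus (Fin L), ℂ) := ⟨fun z => (((∑ i, F (z i)) ^ 2 : ℝ) : ℂ), by fun_prop⟩ with hΦ
  obtain ⟨r, r0, κ, κp, n0, C, C0, H⟩ := Good.all hξ hA0 hB0 hx Φ ε hε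
  refine ⟨r, r0, κ, κp, n0, C, C0, ?_⟩
  intro A B a1 a2 a3 a4 a5 n hn Γ G hG
  have e := H A B a1 a2 a3 a4 a5 n hn Γ G hG
  have i1 : (∫ x in A..B, (G x : ℂ) * Φ (ptt ξ L n x)) =
    ((∫ x in A..B, G x * (∑ i ∈ Finset.range L, f (ξ * x ^ (n + i))) ^ 2 : ℝ) : ℂ) := by
    rw [← intervalIntegral.integral_ofReal]
    congr 1; ext x
    simp only [hΦ, ContinuousMap.coe_mk, ptt, Fc]
    rw [Finset.sum_range]
    push_cast; rfl
  have i2 : ∫ z, Φ z = ((L * (∫ y in (0:ℝ)..1, f y ^ 2) : ℝ) : ℂ) := by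
    have c1 : ∫ b, F b = 0 := by
      rw [← UnitAddCircle.intervalIntegral_preimage 0 F]
      simp only [Fc, zero_add, m0]
    have c2 : ∫ b, F b ^ 2 = ∫ y in (0:ℝ)..1, f y ^ 2 := by
      rw [← UnitAddCircle.intervalIntegral_preimage 0 (fun b => F b ^ 2)]
      simp only [Fc, zero_add]
    rw [← c2]
    have ii : ∀ i : Fin L, ∀ j : Fin L, Integrable (fun z : UnitAddTorus (Fin L) => F (z i) * F (z j)) :=
      fun i j => Continuous.integrable_of_hasCompactSupport (by fun_prop) (HasCompactSupport.of_compactSpace _)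
    have key : ∫ z : UnitAddTorus (Fin L), (∑ i, F (z i)) ^ 2 = L * ∫ b, F b ^ 2 := by
      simp only [sq, Finset.sum_mul_sum]
      rw [integral_finsetSum _ (fun i _ => integrable_finsetSum _ fun j _ => ii i j)]
      have : ∀ i : Fin L, ∫ z : UnitAddTorus (Fin L), ∑ j, F (z i) * F (z j) = ∫ b, F b * F b := by
        intro i
        rw [integral_finsetSum _ (fun j _ => ii i j), Finset.sum_eq_single i]
        · have mp := (measurePreserving_eval (fun _ : Fin L => (volume : Measure UnitAddCircle)) i)
          have := integral_map (μ := (volume : Measure (UnitAddTorus (Fin L))))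
            (mp.measurable.aemeasurable) (f := fun b => F b * F b)
            ((by fun_prop : Continuous fun b => F b * F b).aestronglyMeasurable)
          rw [show Measure.map (Function.eval i) (volume : Measure (UnitAddTorus (Fin L))) = volume from mp.map_eq] at this
          exact this.symm
        · intro j _ hj
          have := MeasureTheory.integral_fintype_prod_volume_eq_prod (ι := Fin L)
            (E := fun _ => UnitAddCircle) (𝕜 := ℝ)
            (fun l => if l = i then F else if l = j then F else fun _ => 1)
          rw [Finset.prod_eq_zero (Finset.mem_univ i) (by simpa using c1)] at this
          rw [← this]
          congr 1; ext z
          rw [Finset.prod_eq_mul i j hj.symm]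
          · simp [hj]
          · intro l _ hl; simp [hl.1, hl.2]
          · simp
          · simp
        · simp
      simp only [this]
      simp
    rw [← key]
    exact integral_ofReal (𝕜 := ℂ)
  rw [i1, i2, ← Complex.ofReal_mul, ← Complex.ofReal_sub, Complex.norm_real, Real.norm_eq_abs] at e
  exact e

theorem per_prim {f : ℝ → ℝ} (cf : Continuous f) (pf : Function.Periodic f 1)
    (m0 : ∫ y in (0:ℝ)..1, f y = 0) :
    ∃ H : ℝ → ℝ, (∀ y, HasDerivAt H (f y) y) ∧ ∀ y, |H y| ≤ ∫ y in (0:ℝ)..1, |f y| := by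
  have ii : ∀ a b, IntervalIntegrable f volume a b := fun a b => cf.intervalIntegrable a b
  refine ⟨fun y => ∫ t in (0:ℝ)..y, f t, fun y => ?_, fun y => ?_⟩
  · exact intervalIntegral.integral_hasDerivAt_right (ii _ _)
      cf.aestronglyMeasurable.stronglyMeasurableAtFilter cf.continuousAt
  · have e : ∫ t in (0:ℝ)..y, f t = ∫ t in (0:ℝ)..Int.fract y, f t := by
      have h1 := intervalIntegral.integral_add_adjacent_intervals (ii 0 (Int.fract y)) (ii (Int.fract y) y)
      have h2 := pf.intervalIntegral_add_zsmul_eq ⌊y⌋ (Int.fract y)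
      rw [← h1]
      have : Int.fract y + ⌊y⌋ • (1:ℝ) = y := by simp
      replace h2 := h2 ii
      rw [this] at h2
      have h3 := pf.intervalIntegral_add_eq (Int.fract y) 0
      simp only [zero_add, m0] at h3
      rw [h2, h3]
      simp
    simp only [e]
    have f0 := Int.fract_nonneg y
    have f1 := (Int.fract_lt_one y).le
    refine (intervalIntegral.abs_integral_le_integral_abs f0).trans ?_
    apply intervalIntegral.integral_mono_interval le_rfl f0 f1
    · exact Filter.Eventually.of_forall fun x => abs_nonneg _
    · exact cf.abs.intervalIntegrable _ _

theorem expSum {ξ F lam : ℝ} (hξ : 0 ≤ ξ) (hl : 0 ≤ lam) {f W : ℝ → ℝ} (hf : ContDiff ℝ 1 f)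
    (hF : ∀ y, |deriv f y| ≤ F) (hW : ContDiff ℝ 1 W) (s : Finset ℕ) :
    ContDiff ℝ 1 (fun x => W x * Real.exp (lam * ∑ n ∈ s, f (ξ * x ^ n))) ∧
    ∀ x κ, 0 ≤ x → 0 ≤ W x → |x * deriv W x| ≤ κ * W x →
      |x * deriv (fun x => W x * Real.exp (lam * ∑ n ∈ s, f (ξ * x ^ n))) x| ≤
        (κ + lam * (F * ξ) * ∑ n ∈ s, n * x ^ n) *
          (W x * Real.exp (lam * ∑ n ∈ s, f (ξ * x ^ n))) := by
  constructor
  · apply hW.mul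
    apply Real.contDiff_exp.comp
    apply contDiff_const.mul
    apply ContDiff.sum
    intro n _
    exact hf.comp (contDiff_const.mul (contDiff_id.pow n))
  · intro x κ hx hw hk
    have df : ∀ y, HasDerivAt f (deriv f y) y := fun y => (hf.differentiable one_ne_zero y).hasDerivAt
    have dW : HasDerivAt W (deriv W x) x := (hW.differentiable one_ne_zero x).hasDerivAt
    have dn : ∀ n : ℕ, HasDerivAt (fun x => f (ξ * x ^ n)) (deriv f (ξ * x ^ n) * (ξ * (n * x ^ (n-1)))) x :=
      fun n => (df (ξ * x ^ n)).comp x ((hasDerivAt_pow n x).const_mul ξ)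
    have dS := HasDerivAt.fun_sum (u := s) fun n _ => dn n
    have d := dW.mul ((dS.const_mul lam).exp)
    rw [HasDerivAt.deriv (f := fun x => W x * Real.exp (lam * ∑ n ∈ s, f (ξ * x ^ n))) d]
    set E := Real.exp (lam * ∑ n ∈ s, f (ξ * x ^ n))
    have E0 : 0 < E := Real.exp_pos _
    set D := ∑ n ∈ s, deriv f (ξ * x ^ n) * (ξ * (n * x ^ (n-1)))
    have hD : |x * D| ≤ F * ξ * ∑ n ∈ s, n * x ^ n := by
      rw [Finset.mul_sum, Finset.mul_sum]
      refine (Finset.abs_sum_le_sum_abs _ _).trans (Finset.sum_le_sum fun n _ => ?_)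
      have : x * (deriv f (ξ * x ^ n) * (ξ * (n * x ^ (n-1)))) = deriv f (ξ * x ^ n) * (ξ * (n * x ^ n)) := by
        rcases n with _ | n
        · simp
        · simp only [Nat.add_sub_cancel]; rw [pow_succ]; ring
      rw [this, abs_mul, abs_of_nonneg (by positivity : 0 ≤ ξ * (n * x ^ n)), mul_assoc]
      exact mul_le_mul_of_nonneg_right (hF _) (by positivity)
    have : x * (deriv W x * E + W x * (E * (lam * D))) = (x * deriv W x) * E + (W x * E * lam) * (x * D) := by ring
    rw [this]
    refine (abs_add_le _ _).trans ?_
    rw [abs_mul _ E, abs_mul _ (x * D), abs_of_pos E0, abs_of_nonneg (by positivity : 0 ≤ W x * E * lam)]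
    have h1 := mul_le_mul_of_nonneg_right hk E0.le
    have h2 := mul_le_mul_of_nonneg_left hD (by positivity : 0 ≤ W x * E * lam)
    calc _ ≤ _ := add_le_add h1 h2
      _ = _ := by ring

theorem sum_Ioc_UU {M N : ℕ} (h : M ≤ N) (x : ℝ) :
    UU M x + ∑ n ∈ Finset.Ioc M N, (n : ℝ) * x ^ n = UU N x := by
  unfold UU
  have : Finset.Icc 1 N = Finset.Icc 1 M ∪ Finset.Ioc M N := by
    ext i; simp only [Finset.mem_Icc, Finset.mem_union, Finset.mem_Ioc]; omega
  rw [this, Finset.sum_union]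
  rw [Finset.disjoint_left]; intro i; simp only [Finset.mem_Icc, Finset.mem_Ioc]; omega

theorem geo_Ioc {A0 : ℝ} (hA0 : 1 < A0) (N L : ℕ) :
    ∑ i ∈ Finset.range L, (A0⁻¹) ^ (N + (1 + i)) ≤ (A0⁻¹) ^ N / (A0 - 1) := by
  have h0 : 0 < A0⁻¹ := by positivity
  have h1 : A0⁻¹ < 1 := inv_lt_one_of_one_lt₀ hA0
  have e : ∑ i ∈ Finset.range L, (A0⁻¹) ^ (N + (1 + i)) = (A0⁻¹) ^ N * A0⁻¹ * ∑ i ∈ Finset.range L, (A0⁻¹) ^ i := by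
    rw [Finset.mul_sum]; congr 1; ext i; rw [pow_add, pow_add]; ring
  rw [e]
  have : ∑ i ∈ Finset.range L, (A0⁻¹) ^ i ≤ (1 - A0⁻¹)⁻¹ := by
    have := Summable.sum_le_tsum (Finset.range L) (fun i _ => by positivity) (summable_geometric_of_lt_one h0.le h1)
    rwa [tsum_geometric_of_lt_one h0.le h1] at this
  calc _ ≤ (A0⁻¹) ^ N * A0⁻¹ * (1 - A0⁻¹)⁻¹ := by gcongr
    _ = _ := by
      have : A0 - 1 ≠ 0 := by linarith
      have : 1 - A0⁻¹ = (A0 - 1) / A0 := by field_simp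
      rw [this]; field_simp

theorem exp_cubic {y : ℝ} (h : |y| ≤ 1) : |Real.exp y - (1 + y + y ^ 2 / 2)| ≤ |y| ^ 3 := by
  have := Real.exp_bound h (n := 3) (by norm_num)
  simp only [Finset.sum_range_succ, Finset.sum_range_zero, Nat.factorial] at this
  norm_num at this
  refine le_trans this ?_
  have := pow_nonneg (abs_nonneg y) 3
  linarith

theorem mgf_block {ξ A0 B0 A B κ0 C2 V ε F Γ lam : ℝ} {n0 L N : ℕ} (hξ : 0 < ξ) (hA0 : 1 < A0)
    (hA : A0 ≤ A) (hAB : A ≤ B) (hB : B ≤ B0) {f G : ℝ → ℝ} (cf : Continuous f)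
    (pf : Function.Periodic f 1) (m0 : ∫ y in (0:ℝ)..1, f y = 0) (f1 : ∀ y, |f y| ≤ 1)
    (hF : 0 ≤ F)
    (H2 : ∀ n ≥ n0, ∀ Γ : ℝ, ∀ G : ℝ → ℝ, Adm A B κ0 Γ n G →
      |(∫ x in A..B, G x * (∑ i ∈ Finset.range L, f (ξ * x ^ (n + i))) ^ 2) -
        L * V * (∫ x in A..B, G x)| ≤ ε * (∫ x in A..B, G x) + C2 * Γ * (A0⁻¹) ^ n)
    (hC2 : 0 ≤ C2) (hN : n0 ≤ N) (hl : 0 < lam) (hlL : lam * L ≤ 1)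
    (hlk : lam * (A0 / (A0 - 1) * (1 + F * ξ)) ≤ κ0) (hNl : (A0⁻¹) ^ N ≤ lam)
    (cG : ContDiff ℝ 1 G) (hG : ∀ x ∈ Set.Icc A B, 0 ≤ G x ∧ G x ≤ Γ ∧
      |x * deriv G x| ≤ lam * (1 + F * ξ) * UU N x * G x) :
    |(∫ x in A..B, G x * Real.exp (lam * ∑ i ∈ Finset.range L, f (ξ * x ^ (N + 1 + i)))) -
      (1 + lam ^ 2 * L * V / 2) * ∫ x in A..B, G x| ≤
      ((A0 / (A0 - 1) * (1 + F * ξ) + 1) / (ξ * (A0 - 1)) * lam ^ 2 + lam ^ 2 * ε / 2 + lam ^ 3 * L ^ 3)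
        * (∫ x in A..B, G x) +
      (lam * (2 * B0 / (ξ * (A0 - 1))) + lam ^ 2 * C2 / 2) * (A0⁻¹) ^ N * Γ := by
  set K := A0 / (A0 - 1) * (1 + F * ξ) with hK
  have A01 : 0 < A0 - 1 := by linarith
  have K0 : 0 ≤ K := by positivity
  have i0 : 0 < A0⁻¹ := by positivity
  have i1 : A0⁻¹ ≤ 1 := (inv_lt_one_of_one_lt₀ hA0).le
  have B00 : 0 ≤ B0 := by linarith
  have adm : ∀ i : ℕ, Adm A B (lam * K * (A0⁻¹) ^ (0 + (1 + i))) Γ (N + 1 + i) G := by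
    intro i
    refine ⟨cG, fun x hx => ⟨(hG x hx).1, (hG x hx).2.1, (hG x hx).2.2.trans ?_⟩⟩
    have h := UU_le hA0 (hA.trans hx.1) (m := N) (n := N + 1 + i) (by omega)
    rw [show N + 1 + i - N = 0 + (1 + i) by omega] at h
    apply mul_le_mul_of_nonneg_right _ (hG x hx).1
    calc lam * (1 + F * ξ) * UU N x ≤ lam * (1 + F * ξ) * (A0 / (A0 - 1) * A0⁻¹ ^ (0 + (1 + i)) * (((N + 1 + i : ℕ) : ℝ) * x ^ (N + 1 + i))) := by gcongr
      _ = _ := by rw [hK]; ring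
  have Γ0 : 0 ≤ Γ := (adm 0).Γ_nonneg hAB
  have I0 := (adm 0).int_nonneg hAB
  set I := ∫ x in A..B, G x with hI
  have cGc := cG.continuous
  obtain ⟨H, hH, Hb⟩ := per_prim cf pf m0
  have Hb1 : ∀ y, |H y| ≤ 1 := fun y => (Hb y).trans (by
    have := intervalIntegral.integral_mono_on (a := (0:ℝ)) (b := 1) (μ := volume) zero_le_one (cf.abs.intervalIntegrable _ _)
      ((continuous_const (y := (1:ℝ))).intervalIntegrable _ _) (fun x _ => f1 x)
    simpa using this)
  set Y : ℝ → ℝ := fun x => ∑ i ∈ Finset.range L, f (ξ * x ^ (N + 1 + i)) with hY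
  have cY : Continuous Y := by
    rw [hY]; fun_prop
  -- first moment
  have F1 : |∫ x in A..B, G x * Y x| ≤ 1 / ξ * ((lam * K + lam) / (A0 - 1) * I + 2 * B0 * ((A0⁻¹) ^ N / (A0 - 1)) * Γ) := by
    have e : ∫ x in A..B, G x * Y x = ∑ i ∈ Finset.range L, ∫ x in A..B, G x * f (ξ * x ^ (N + 1 + i)) := by
      rw [← intervalIntegral.integral_finsetSum]
      · simp only [hY, Finset.mul_sum]
      · intro i _; exact Continuous.intervalIntegrable (by fun_prop) _ _
    rw [e]
    refine (Finset.abs_sum_le_sum_abs _ _).trans ?_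
    refine (Finset.sum_le_sum fun i _ => first_moment hξ hA0 hA hAB hB (by omega) hH cf Hb1 (adm i)).trans ?_
    rw [← Finset.mul_sum, Finset.sum_add_distrib, ← Finset.sum_mul, ← Finset.sum_mul, Finset.sum_add_distrib,
      ← Finset.mul_sum, ← Finset.mul_sum]
    have g0 := geo_Ioc hA0 0 L
    have g1 := geo_Ioc hA0 N L
    simp only [← add_assoc] at g0 g1 ⊢
    rw [pow_zero] at g0
    have g2 : ∑ i ∈ Finset.range L, A0⁻¹ ^ (N + 1 + i) ≤ lam / (A0 - 1) := g1.trans (by gcongr)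
    apply mul_le_mul_of_nonneg_left _ (by positivity)
    rw [← hI]
    apply add_le_add
    · apply mul_le_mul_of_nonneg_right _ I0
      calc _ ≤ lam * K * (1 / (A0 - 1)) + lam / (A0 - 1) := by gcongr
        _ = _ := by ring
    · gcongr
  have F2 := H2 (N + 1) (by omega) Γ G ((adm 0).mono (by linarith) (by
    refine le_trans ?_ hlk
    exact mul_le_of_le_one_right (by positivity) (pow_le_one₀ i0.le i1)))
  have F2' : C2 * Γ * A0⁻¹ ^ (N + 1) ≤ C2 * Γ * A0⁻¹ ^ N := by
    gcongr C2 * Γ * ?_; exact pow_le_pow_of_le_one i0.le i1 (by omega)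
  have Yb : ∀ x, |Y x| ≤ L := by
    intro x
    refine (Finset.abs_sum_le_sum_abs _ _).trans ((Finset.sum_le_sum fun i _ => f1 _).trans ?_)
    simp
  have F3 : |(∫ x in A..B, G x * Real.exp (lam * Y x)) - (I + lam * (∫ x in A..B, G x * Y x) + lam ^ 2 / 2 * ∫ x in A..B, G x * Y x ^ 2)|
      ≤ lam ^ 3 * L ^ 3 * I := by
    have e : I + lam * (∫ x in A..B, G x * Y x) + lam ^ 2 / 2 * (∫ x in A..B, G x * Y x ^ 2) =
       ∫ x in A..B, G x * (1 + lam * Y x + (lam * Y x) ^ 2 / 2) := by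
      rw [hI, ← intervalIntegral.integral_const_mul, ← intervalIntegral.integral_const_mul,
        ← intervalIntegral.integral_add, ← intervalIntegral.integral_add]
      · congr 1; ext x; ring
      all_goals exact Continuous.intervalIntegrable (by fun_prop) _ _
    rw [e, ← intervalIntegral.integral_sub, hI, ← intervalIntegral.integral_const_mul, ← Real.norm_eq_abs]
    · apply intervalIntegral.norm_integral_le_of_norm_le hAB
      · refine Filter.Eventually.of_forall fun x hx => ?_
        have hx : x ∈ Set.Icc A B := ⟨hx.1.le, hx.2⟩
        have g := (hG x hx).1
        rw [← mul_sub, Real.norm_eq_abs, abs_mul, abs_of_nonneg g, mul_comm]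
        apply mul_le_mul_of_nonneg_right _ g
        have ly : |lam * Y x| ≤ lam * L := by
          rw [abs_mul, abs_of_pos hl]; exact mul_le_mul_of_nonneg_left (Yb x) hl.le
        refine (exp_cubic (ly.trans hlL)).trans ?_
        rw [← mul_pow]
        exact pow_le_pow_left₀ (abs_nonneg _) ly 3
      · exact Continuous.intervalIntegrable (by fun_prop) _ _
    all_goals exact Continuous.intervalIntegrable (by fun_prop) _ _
  have F1' : lam * |∫ x in A..B, G x * Y x| ≤ ((K + 1) / (ξ * (A0 - 1)) * lam ^ 2) * I + lam * (2 * B0 / (ξ * (A0 - 1))) * A0⁻¹ ^ N * Γ := by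
    refine (mul_le_mul_of_nonneg_left F1 hl.le).trans (le_of_eq ?_)
    field_simp
  have F2'' := mul_le_mul_of_nonneg_left (F2.trans (add_le_add_right F2' _)) (by positivity : 0 ≤ lam ^ 2 / 2)
  have a1 : |lam * ∫ x in A..B, G x * Y x| = lam * |∫ x in A..B, G x * Y x| := by rw [abs_mul, abs_of_pos hl]
  have a2 := abs_mul (lam ^ 2 / 2) ((∫ x in A..B, G x * Y x ^ 2) - L * V * I)
  rw [abs_of_nonneg (by positivity : 0 ≤ lam ^ 2 / 2)] at a2
  set J1 := ∫ x in A..B, G x * Y x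
  set J2 := ∫ x in A..B, G x * Y x ^ 2
  set J3 := ∫ x in A..B, G x * Real.exp (lam * Y x)
  have : J3 - (1 + lam ^ 2 * L * V / 2) * I = (J3 - (I + lam * J1 + lam ^ 2 / 2 * J2)) + lam * J1 + lam ^ 2 / 2 * (J2 - L * V * I) := by ring
  rw [this]
  refine (abs_add_three _ _ _).trans ?_
  rw [a1, a2]
  linarith

theorem rec_up {Z : ℕ → ℝ} {a b θ : ℝ} (ha : 0 ≤ a) (hb : 0 ≤ b) (t0 : 0 ≤ θ) (t1 : θ < 1)
    (Z0 : ∀ j, 0 ≤ Z j) (h : ∀ j, Z (j+1) ≤ (1 + a) * Z j + b * θ ^ j) (q : ℕ) :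
    Z q ≤ Real.exp (a * q) * (Z 0 + b / (1 - θ)) := by
  have key : ∀ q : ℕ, Z q ≤ Real.exp (a * q) * (Z 0 + ∑ i ∈ Finset.range q, b * θ ^ i) := by
    intro q
    induction q with
    | zero => simp
    | succ q ih =>
      rw [Finset.sum_range_succ]
      have e : Real.exp (a * (q + 1 : ℕ)) = Real.exp a * Real.exp (a * q) := by
        rw [← Real.exp_add]; congr 1; push_cast; ring
      have h1 : 1 + a ≤ Real.exp a := by linarith [Real.add_one_le_exp a]
      have h2 := mul_le_mul_of_nonneg_right h1 (Z0 q)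
      have h3 := mul_le_mul_of_nonneg_left ih (Real.exp_pos a).le
      have h4 : 1 ≤ Real.exp (a * (q + 1 : ℕ)) := Real.one_le_exp (by positivity)
      have h5 : b * θ ^ q ≤ Real.exp (a * (q + 1 : ℕ)) * (b * θ ^ q) := le_mul_of_one_le_left (by positivity) h4
      rw [e] at *
      have := h q
      linarith
  refine (key q).trans ?_
  gcongr
  rw [← Finset.mul_sum, div_eq_mul_inv]
  gcongr
  have := Summable.sum_le_tsum (Finset.range q) (fun i _ => by positivity) (summable_geometric_of_lt_one t0 t1)
  rwa [tsum_geometric_of_lt_one t0 t1] at this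

theorem rec_lo {Z : ℕ → ℝ} {a a' b θ : ℝ} (ha : 0 ≤ a) (haa : Real.exp a ≤ 1 + a') (hb : 0 ≤ b) (t0 : 0 ≤ θ) (t1 : θ < 1)
    (Z0 : ∀ j, 0 ≤ Z j) (h : ∀ j, (1 + a') * Z j - b * θ ^ j ≤ Z (j+1)) (q : ℕ) :
    Real.exp (a * q) * (Z 0 - b / (1 - θ)) ≤ Z q := by
  have key : ∀ q : ℕ, Real.exp (a * q) * (Z 0 - ∑ i ∈ Finset.range q, b * θ ^ i) ≤ Z q := by
    intro q
    induction q with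
    | zero => simp
    | succ q ih =>
      rw [Finset.sum_range_succ]
      have e : Real.exp (a * (q + 1 : ℕ)) = Real.exp a * Real.exp (a * q) := by
        rw [← Real.exp_add]; congr 1; push_cast; ring
      have h2 := mul_le_mul_of_nonneg_right haa (Z0 q)
      have h3 := mul_le_mul_of_nonneg_left ih (Real.exp_pos a).le
      have h4 : 1 ≤ Real.exp (a * (q + 1 : ℕ)) := Real.one_le_exp (by positivity)
      have h5 : b * θ ^ q ≤ Real.exp (a * (q + 1 : ℕ)) * (b * θ ^ q) := le_mul_of_one_le_left (by positivity) h4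
      rw [e] at *
      have := h q
      linarith
  refine le_trans ?_ (key q)
  gcongr
  rw [← Finset.mul_sum, div_eq_mul_inv]
  gcongr
  have := Summable.sum_le_tsum (Finset.range q) (fun i _ => by positivity) (summable_geometric_of_lt_one t0 t1)
  rwa [tsum_geometric_of_lt_one t0 t1] at this

theorem Ioc_block (g : ℕ → ℝ) (M j L : ℕ) :
    ∑ n ∈ Finset.Ioc M (M + (j+1) * L), g n = ∑ n ∈ Finset.Ioc M (M + j * L), g n +
      ∑ i ∈ Finset.range L, g (M + j * L + 1 + i) := by
  have h : M + (j+1) * L = M + j * L + L := by ring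
  have u : Finset.Ioc M (M + (j+1) * L) = Finset.Ioc M (M + j * L) ∪ Finset.Ioc (M + j * L) (M + j * L + L) := by
    rw [Finset.Ioc_union_Ioc_eq_Ioc (by omega) (by omega), h]
  rw [u, Finset.sum_union (Finset.Ioc_disjoint_Ioc_of_le le_rfl)]
  congr 1
  have : Finset.Ioc (M + j * L) (M + j * L + L) = Finset.Ico (M + j * L + 1) (M + j * L + 1 + L) := by
    ext i; simp only [Finset.mem_Ioc, Finset.mem_Ico]; omega
  rw [this, Finset.sum_Ico_eq_sum_range]
  congr 2; omega

set_option maxHeartbeats 1000000 in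
theorem mgf {ξ A0 B0 x0 F η : ℝ} (hξ : 0 < ξ) (hA0 : 1 < A0) (hB0 : A0 ≤ B0)
    (hx : Transcendental ℤ x0) {f : ℝ → ℝ} (hf : ContDiff ℝ 1 f)
    (pf : Function.Periodic f 1) (m0 : ∫ y in (0:ℝ)..1, f y = 0) (f1 : ∀ y, |f y| ≤ 1)
    (hF : ∀ y, |deriv f y| ≤ F) (hη : 0 < η) (hη1 : η ≤ 1) {V : ℝ}
    (hV : V = ∫ y in (0:ℝ)..1, f y ^ 2) :
    ∃ r > 0, ∃ L : ℕ, 1 ≤ L ∧ ∃ lam0 > 0, ∃ n0 : ℕ, ∃ C ≥ 0, ∀ A B : ℝ, A0 ≤ A → A ≤ B → B ≤ B0 →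
      x0 - r ≤ A → B ≤ x0 + r → ∀ lam, 0 < lam → lam ≤ lam0 → ∀ M ≥ n0, (A0⁻¹) ^ M ≤ lam →
      ∀ W : ℝ → ℝ, ContDiff ℝ 1 W → (∀ x ∈ Set.Icc A B, 0 ≤ W x ∧ W x ≤ 1 ∧
        |x * deriv W x| ≤ lam * UU M x * W x) → ∀ q : ℕ,
      (∫ x in A..B, W x * Real.exp (lam * ∑ n ∈ Finset.Ioc M (M + q * L), f (ξ * x ^ n))) ≤
        Real.exp (lam ^ 2 * L * (V + η) / 2 * q) * ((∫ x in A..B, W x) + C * (A0⁻¹) ^ M) ∧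
      (η ≤ V → Real.exp (lam ^ 2 * L * (V - η) / 2 * q) * ((∫ x in A..B, W x) - C * (A0⁻¹) ^ M) ≤
        ∫ x in A..B, W x * Real.exp (lam * ∑ n ∈ Finset.Ioc M (M + q * L), f (ξ * x ^ n))) := by
  have F0 : 0 ≤ F := (abs_nonneg _).trans (hF 0)
  have cf := hf.continuous
  have V0 : 0 ≤ V := by
    rw [hV]; exact intervalIntegral.integral_nonneg zero_le_one fun x _ => sq_nonneg _
  have V1 : V ≤ 1 := by
    have := intervalIntegral.integral_mono_on (a := (0:ℝ)) (b := 1) (μ := volume) zero_le_one ((cf.pow 2).intervalIntegrable _ _)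
      ((continuous_const (y := (1:ℝ))).intervalIntegrable _ _) (fun x _ => by
        show f x ^ 2 ≤ 1
        rw [← sq_abs]; exact pow_le_one₀ (abs_nonneg _) (f1 x))
    rw [hV]; simpa using this
  have A01 : 0 < A0 - 1 := by linarith
  have i0 : 0 < A0⁻¹ := by positivity
  set K := A0 / (A0 - 1) * (1 + F * ξ) with hK
  have K0 : 0 ≤ K := by positivity
  set C0 := (K + 1) / (ξ * (A0 - 1)) with hC0
  obtain ⟨L, hL⟩ := exists_nat_ge (8 * C0 / η + 1)
  have C00 : 0 ≤ C0 := by positivity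
  have L1 : (1:ℝ) ≤ L := le_trans (by have : 0 ≤ 8 * C0 / η := by positivity
                                      linarith) hL
  have L1' : 1 ≤ L := by exact_mod_cast L1
  have L0 : (0:ℝ) < L := by linarith
  have hL8 : C0 ≤ η * L / 8 := by
    have : 8 * C0 / η ≤ L := by linarith
    rw [div_le_iff₀ hη] at this; linarith
  obtain ⟨r, r0, κ0, κp, n0, C2, C20, H⟩ := second_moment hξ hA0 hB0 hx L cf pf m0 (ε := η * L / 8) (by positivity)
  have lA : 0 < Real.log A0 := Real.log_pos hA0
  obtain ⟨lam0, hl0, hla, hlb, hlc⟩ : ∃ lam0 > 0, lam0 ≤ η / (8 * L ^ 2) ∧ lam0 * (K + 1) ≤ κ0 ∧ lam0 ≤ Real.log A0 / 2 := by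
    refine ⟨min (η / (8 * L ^ 2)) (min (κ0 / (K + 1)) (Real.log A0 / 2)), by positivity, min_le_left _ _, ?_, ?_⟩
    · rw [← le_div_iff₀ (by positivity)]
      exact (min_le_right _ _).trans (min_le_left _ _)
    · exact (min_le_right _ _).trans (min_le_right _ _)
  set θ := A0⁻¹ * Real.exp lam0 with hθ
  have t0 : 0 ≤ θ := by positivity
  have t1 : θ < 1 := by
    have : Real.exp lam0 < A0 := by
      rw [← Real.lt_log_iff_exp_lt (by linarith)]; linarith
    rw [hθ, inv_mul_lt_iff₀ (by linarith)]; linarith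
  set C1 := 2 * B0 / (ξ * (A0 - 1)) with hC1
  have B00 : 0 < B0 := by linarith
  have C10 : 0 ≤ C1 := by positivity
  refine ⟨r, r0, L, L1', lam0, hl0, n0, (C1 + C2) / (1 - θ), div_nonneg (by positivity) (by linarith), ?_⟩
  intro A B a1 a2 a3 a4 a5 lam l0 l1 M hM hMl W hW hWb q
  have la1 : lam * L ^ 2 ≤ η / 8 := by
    have := l1.trans hla
    rw [le_div_iff₀ (by positivity)] at this
    linarith
  have lL : lam * L ≤ η / 8 := le_trans (mul_le_mul_of_nonneg_left (le_self_pow₀ L1 two_ne_zero) l0.le) la1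
  have ll : lam ≤ η / 8 := le_trans (le_mul_of_one_le_right l0.le L1) lL
  have hlk : lam * K ≤ κ0 := le_trans (mul_le_mul l1 (by linarith) K0 hl0.le) hlb
  set Z : ℕ → ℝ := fun j => ∫ x in A..B, W x * Real.exp (lam * ∑ n ∈ Finset.Ioc M (M + j * L), f (ξ * x ^ n)) with hZ
  have Z00 : Z 0 = ∫ x in A..B, W x := by simp [hZ]
  have Zn : ∀ j, 0 ≤ Z j := fun j => intervalIntegral.integral_nonneg a2 fun x hx =>
    mul_nonneg (hWb x hx).1 (Real.exp_pos _).le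
  have step : ∀ j, |Z (j+1) - (1 + lam ^ 2 * L * V / 2) * Z j| ≤ lam ^ 2 * L * η * (3/8) * Z j +
      (C1 + C2) * (A0⁻¹) ^ M * θ ^ j := by
    intro j
    obtain ⟨g1, g2⟩ := expSum hξ.le l0.le hf hF hW (Finset.Ioc M (M + j * L))
    have i1 : A0⁻¹ ≤ 1 := (inv_lt_one_of_one_lt₀ hA0).le
    have := mgf_block (ξ := ξ) (A0 := A0) (B0 := B0) (A := A) (B := B) (κ0 := κ0) (C2 := C2) (V := V) (ε := η * L / 8)
      (F := F) (Γ := Real.exp (lam * (j * L))) (lam := lam) (n0 := n0) (L := L) (N := M + j * L) hξ hA0 a1 a2 a3 cf pf m0 f1 F0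
      (by rw [hV]; exact H A B a1 a2 a3 a4 a5) C20 (by omega) l0 (by linarith) hlk
      ((pow_le_pow_of_le_one i0.le i1 (by omega)).trans hMl) g1 (by
        intro x hx
        have hx0 : 0 ≤ x := by linarith [hx.1]
        obtain ⟨w0, w1, w2⟩ := hWb x hx
        refine ⟨mul_nonneg w0 (Real.exp_pos _).le, ?_, ?_⟩
        · refine (mul_le_of_le_one_left (Real.exp_pos _).le w1).trans ?_
          apply Real.exp_le_exp.2
          apply mul_le_mul_of_nonneg_left _ l0.le
          refine (le_abs_self _).trans ((Finset.abs_sum_le_sum_abs _ _).trans ((Finset.sum_le_sum fun i _ => f1 _).trans ?_))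
          simp
        · refine (g2 x (lam * UU M x) hx0 w0 w2).trans ?_
          apply mul_le_mul_of_nonneg_right _ (mul_nonneg w0 (Real.exp_pos _).le)
          rw [← sum_Ioc_UU (show M ≤ M + j * L by omega) x]
          have u0 := UU_nonneg M hx0
          have s0 : 0 ≤ ∑ n ∈ Finset.Ioc M (M + j * L), (n:ℝ) * x ^ n := Finset.sum_nonneg fun n _ => by positivity
          have : 0 ≤ lam * (F * ξ) * UU M x := by positivity
          have : 0 ≤ lam * ∑ n ∈ Finset.Ioc M (M + j * L), (n:ℝ) * x ^ n := by positivity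
          linarith)
    have eZ : Z (j+1) = ∫ x in A..B, (fun x => W x * Real.exp (lam * ∑ n ∈ Finset.Ioc M (M + j * L), f (ξ * x ^ n))) x *
        Real.exp (lam * ∑ i ∈ Finset.range L, f (ξ * x ^ (M + j * L + 1 + i))) := by
      simp only [hZ]
      congr 1; ext x
      rw [mul_assoc, ← Real.exp_add, ← mul_add]
      congr 3
      exact Ioc_block (fun n => f (ξ * x ^ n)) M j L
    rw [← eZ] at this
    refine this.trans (add_le_add ?_ ?_)
    · apply mul_le_mul_of_nonneg_right _ (Zn j)
      have t1 : C0 * lam ^ 2 ≤ η * L / 8 * lam ^ 2 := by gcongr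
      have t2 : lam ^ 3 * L ^ 3 ≤ lam ^ 2 * L * (η / 8) := by
        calc lam ^ 3 * (L:ℝ) ^ 3 = lam ^ 2 * L * (lam * L ^ 2) := by ring
          _ ≤ _ := by gcongr
      have : 0 ≤ lam ^ 2 * L * η := by positivity
      linarith
    · have c1 : lam * C1 + lam ^ 2 * C2 / 2 ≤ C1 + C2 := by
        have t1 : lam * C1 ≤ 1 * C1 := by gcongr; linarith
        have t2 : lam ^ 2 * C2 ≤ 1 * C2 := by gcongr; exact pow_le_one₀ l0.le (by linarith)
        linarith
      have c2 : A0⁻¹ ^ (M + j * L) * Real.exp (lam * (j * L)) ≤ A0⁻¹ ^ M * θ ^ j := by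
        have : Real.exp (lam * (j * L)) ≤ Real.exp lam0 ^ (j * L) := by
          rw [← Real.exp_nat_mul]
          apply Real.exp_le_exp.2
          push_cast; rw [mul_comm]; gcongr
        calc _ ≤ A0⁻¹ ^ (M + j * L) * Real.exp lam0 ^ (j * L) := by gcongr
          _ = A0⁻¹ ^ M * θ ^ (j * L) := by rw [hθ, mul_pow, pow_add]; ring
          _ ≤ _ := by
            gcongr A0⁻¹ ^ M * ?_
            exact pow_le_pow_of_le_one t0 t1.le (Nat.le_mul_of_pos_right _ L1')
      calc (lam * C1 + lam ^ 2 * C2 / 2) * A0⁻¹ ^ (M + j * L) * Real.exp (lam * (j * L))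
          = (lam * C1 + lam ^ 2 * C2 / 2) * (A0⁻¹ ^ (M + j * L) * Real.exp (lam * (j * L))) := by ring
        _ ≤ (C1 + C2) * (A0⁻¹ ^ M * θ ^ j) := by gcongr
        _ = _ := by ring
  have ebt : (C1 + C2) / (1 - θ) * A0⁻¹ ^ M = (C1 + C2) * A0⁻¹ ^ M / (1 - θ) := by ring
  rw [ebt, ← Z00]
  have p1 : 0 ≤ lam ^ 2 * L := by positivity
  constructor
  · refine rec_up (by positivity) (by positivity) t0 t1 Zn (fun j => ?_) q
    have := (abs_le.1 (step j)).2
    have : 0 ≤ lam ^ 2 * L * η * Z j := mul_nonneg (by positivity) (Zn j)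
    linarith
  · intro hVη
    refine rec_lo (a' := lam ^ 2 * L * (V - 3 * η / 4) / 2) (div_nonneg (mul_nonneg p1 (sub_nonneg.2 hVη)) two_pos.le) ?_ (by positivity) t0 t1 Zn (fun j => ?_) q
    · set a := lam ^ 2 * L * (V - η) / 2 with ha
      have p2 : lam ^ 2 * L ≤ η / 8 := by rw [sq, mul_assoc]; exact (mul_le_of_le_one_left (by positivity) (by linarith)).trans lL
      have a0 : 0 ≤ a := by have : 0 ≤ V - η := by linarith
                            positivity
      have a1 : a ≤ lam ^ 2 * L / 2 := by
        rw [ha]; have := mul_le_of_le_one_right p1 (show V - η ≤ 1 by linarith); linarith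
      have := Real.abs_exp_sub_one_sub_id_le (x := a) (by rw [abs_of_nonneg a0]; linarith)
      have := (abs_le.1 this).2
      have : a ^ 2 ≤ (lam ^ 2 * L / 2) * (η / 16) := by rw [sq]; gcongr; linarith
      have : lam ^ 2 * L * (V - 3 * η / 4) / 2 = a + lam ^ 2 * L * η / 8 := by rw [ha]; ring
      have : 0 ≤ lam ^ 2 * L * η := by positivity
      linarith
    · have := (abs_le.1 (step j)).1
      linarith

theorem rec_up2 {Z : ℕ → ℝ} {a b θ : ℝ} (ha : 0 ≤ a) (hb : 0 ≤ b) (t0 : 0 ≤ θ) (t1 : θ < 1)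
    (Z0 : ∀ j, 0 ≤ Z j) (h : ∀ j, Z (j+1) ≤ (1 + a + b * θ ^ j) * Z j + b * θ ^ j) (q : ℕ) :
    Z q ≤ Real.exp (a * q + b / (1 - θ)) * (Z 0 + b / (1 - θ)) := by
  have key : ∀ q : ℕ, Z q ≤ Real.exp (a * q + ∑ i ∈ Finset.range q, b * θ ^ i) * (Z 0 + ∑ i ∈ Finset.range q, b * θ ^ i) := by
    intro q
    induction q with
    | zero => simp
    | succ q ih =>
      rw [Finset.sum_range_succ]
      set T := ∑ i ∈ Finset.range q, b * θ ^ i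
      have T0 : 0 ≤ T := Finset.sum_nonneg fun i _ => by positivity
      set u := b * θ ^ q
      have u0 : 0 ≤ u := by positivity
      have e : Real.exp (a * (q + 1 : ℕ) + (T + u)) = Real.exp (a + u) * Real.exp (a * q + T) := by
        rw [← Real.exp_add]; congr 1; push_cast; ring
      have h1 : 1 + a + u ≤ Real.exp (a + u) := by linarith [Real.add_one_le_exp (a + u)]
      have h2 := mul_le_mul_of_nonneg_right h1 (Z0 q)
      have h3 := mul_le_mul_of_nonneg_left ih (Real.exp_pos (a + u)).le
      have h4 : 1 ≤ Real.exp (a * (q + 1 : ℕ) + (T + u)) := Real.one_le_exp (by positivity)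
      have h5 : u ≤ Real.exp (a * (q + 1 : ℕ) + (T + u)) * u := le_mul_of_one_le_left (by positivity) h4
      rw [e] at *
      have := h q
      linarith
  have hs : ∑ i ∈ Finset.range q, b * θ ^ i ≤ b / (1 - θ) := by
    rw [← Finset.mul_sum, div_eq_mul_inv]
    gcongr
    have := Summable.sum_le_tsum (Finset.range q) (fun i _ => by positivity) (summable_geometric_of_lt_one t0 t1)
    rwa [tsum_geometric_of_lt_one t0 t1] at this
  refine (key q).trans ?_
  have := Z0 0
  have : 0 ≤ ∑ i ∈ Finset.range q, b * θ ^ i := Finset.sum_nonneg fun i _ => by positivity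
  gcongr

theorem exp_le_quad {y : ℝ} (h : |y| ≤ 1) : Real.exp y ≤ 1 + y + y ^ 2 := by
  have := (abs_le.1 (Real.abs_exp_sub_one_sub_id_le h)).2
  linarith

set_option maxHeartbeats 1000000 in
theorem crude_prog {ξ A0 B0 D : ℝ} (hξ : 0 < ξ) (hA0 : 1 < A0) (hB0 : A0 ≤ B0) (hD : 0 ≤ D) :
    ∃ lam1 > (0:ℝ), lam1 ≤ 1 / 2 ∧ ∃ C ≥ (1:ℝ), ∀ A B : ℝ, A0 ≤ A → A ≤ B → B ≤ B0 → ∀ h : ℝ → ℝ, ContDiff ℝ 1 h →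
      Function.Periodic h 1 → (∫ y in (0:ℝ)..1, h y = 0) → (∀ y, |h y| ≤ 2) → ∀ F δ : ℝ,
      (∀ y, |deriv h y| ≤ F) → (∫ y in (0:ℝ)..1, |h y|) ≤ δ → δ ≤ D → ∀ g : ℕ, 1 ≤ g →
      F * (A0⁻¹) ^ g ≤ D → ∀ lam : ℝ, 0 < lam → lam ≤ lam1 → ∀ n0 : ℕ, 1 ≤ n0 → ∀ q : ℕ,
      (∫ x in A..B, Real.exp (lam * ∑ i ∈ Finset.range q, h (ξ * x ^ (n0 + i * g)))) ≤
        C * Real.exp (C * lam ^ 2 * δ * q) := by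
  have A01 : 0 < A0 - 1 := by linarith
  have B00 : 0 < B0 := by linarith
  have i0 : 0 < A0⁻¹ := by positivity
  have i1 : A0⁻¹ < 1 := inv_lt_one_of_one_lt₀ hA0
  have lA : 0 < Real.log A0 := Real.log_pos hA0
  obtain ⟨lam1, hl0, hla, hlc⟩ : ∃ lam1 > 0, lam1 ≤ 1 / 2 ∧ lam1 ≤ Real.log A0 / 4 :=
    ⟨min (1/2) (Real.log A0 / 4), by positivity, min_le_left _ _, min_le_right _ _⟩
  set θ := A0⁻¹ * Real.exp (2 * lam1) with hθ
  have t0 : 0 ≤ θ := by positivity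
  have t1 : θ < 1 := by
    have : Real.exp (2 * lam1) < A0 := by
      rw [← Real.lt_log_iff_exp_lt (by linarith)]; linarith
    rw [hθ, inv_mul_lt_iff₀ (by linarith)]; linarith
  set cA := A0 / (A0 - 1) * D * ξ with hcA
  have cA0 : 0 ≤ cA := by positivity
  set a0 := cA / ξ + 2 + 4 / ξ * (cA + 1) with ha0
  have a00 : 0 ≤ a0 := by positivity
  set b := (D / ξ + 4 * D / ξ) * (1 + 2 * B0) with hb
  have b0 : 0 ≤ b := by positivity
  set E := b / (1 - θ) with hE
  have E0 : 0 ≤ E := div_nonneg b0 (by linarith)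
  refine ⟨lam1, hl0, hla, max 1 (max a0 (Real.exp E * (B0 + E))), le_max_left _ _, ?_⟩
  intro A B hA hAB hB h hh ph m0 h2 F δ hF hδ hδD g hg hFg lam l0 l1 n0 hn0 q
  have ch := hh.continuous
  have F0 : 0 ≤ F := (abs_nonneg _).trans (hF 0)
  have δ0 : 0 ≤ δ := le_trans (intervalIntegral.integral_nonneg zero_le_one fun x _ => abs_nonneg _) hδ
  set Q := ∫ y in (0:ℝ)..1, h y ^ 2 with hQ
  have Q0 : 0 ≤ Q := intervalIntegral.integral_nonneg zero_le_one fun x _ => sq_nonneg _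
  have Q1 : Q ≤ 2 * δ := by
    have := intervalIntegral.integral_mono_on (a := (0:ℝ)) (b := 1) (μ := volume) zero_le_one
      ((by fun_prop : Continuous fun y => h y ^ 2).intervalIntegrable _ _) ((ch.abs.const_mul 2).intervalIntegrable _ _) (fun x _ => by
        show h x ^ 2 ≤ 2 * |h x|
        rw [← sq_abs, sq]; exact mul_le_mul_of_nonneg_right (h2 x) (abs_nonneg _))
    rw [intervalIntegral.integral_const_mul] at this
    linarith
  obtain ⟨H1, hH1, Hb1⟩ := per_prim ch ph m0
  obtain ⟨H2, hH2, Hb2⟩ := per_prim (f := fun y => h y ^ 2 - Q) (by fun_prop)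
    (fun y => by simp only [ph y]) (by
      rw [intervalIntegral.integral_sub ((by fun_prop : Continuous fun y => h y ^ 2).intervalIntegrable _ _) (continuous_const.intervalIntegrable _ _)]
      simp [hQ])
  have Hb2' : ∀ y, |H2 y| ≤ 4 * δ := fun y => (Hb2 y).trans (by
    have := intervalIntegral.integral_mono_on (a := (0:ℝ)) (b := 1) (μ := volume) zero_le_one
      ((by fun_prop : Continuous fun y => |h y ^ 2 - Q|).intervalIntegrable _ _)
      ((by fun_prop : Continuous fun y => h y ^ 2 + Q).intervalIntegrable _ _) (fun x _ => by
        rw [abs_le]; constructor <;> linarith [sq_nonneg (h x)])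
    rw [intervalIntegral.integral_add ((by fun_prop : Continuous fun y => h y ^ 2).intervalIntegrable _ _) (continuous_const.intervalIntegrable _ _)] at this
    simp only [intervalIntegral.integral_const, sub_zero, one_smul, ← hQ] at this
    linarith)
  set Z : ℕ → ℝ := fun j => ∫ x in A..B, Real.exp (lam * ∑ i ∈ Finset.range j, h (ξ * x ^ (n0 + i * g))) with hZ
  have Zn : ∀ j, 0 ≤ Z j := fun j => intervalIntegral.integral_nonneg hAB fun x hx => (Real.exp_pos _).le
  have Z00 : Z 0 ≤ B0 := by
    simp only [hZ, Finset.range_zero, Finset.sum_empty, mul_zero, Real.exp_zero]; simp; linarith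
  have step : ∀ j, Z (j+1) ≤ (1 + a0 * lam ^ 2 * δ + b * θ ^ j) * Z j + b * θ ^ j := by
    intro j
    set s := (Finset.range j).image (fun i => n0 + i * g) with hs
    have es : ∀ φ : ℕ → ℝ, ∑ n ∈ s, φ n = ∑ i ∈ Finset.range j, φ (n0 + i * g) := by
      intro φ
      rw [hs, Finset.sum_image]
      intro i _ i' _ hii
      have : i * g = i' * g := by simpa using hii
      exact Nat.eq_of_mul_eq_mul_right hg this
    obtain ⟨g1, g2⟩ := expSum (W := fun _ => 1) hξ.le l0.le hh hF contDiff_const s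
    simp only [one_mul] at g1 g2
    set G : ℝ → ℝ := fun x => Real.exp (lam * ∑ n ∈ s, h (ξ * x ^ n)) with hG
    set n := n0 + j * g with hn
    have hnj : j + 1 ≤ n := by
      have : j ≤ j * g := Nat.le_mul_of_pos_right _ hg
      omega
    have GZ : Z j = ∫ x in A..B, G x := by
      simp only [hZ, hG, es]
    set Γ := Real.exp (lam * (2 * j)) with hΓ
    have adm : Adm A B (lam * cA) Γ n G := by
      refine ⟨g1, fun x hx => ⟨(Real.exp_pos _).le, ?_, ?_⟩⟩
      · apply Real.exp_le_exp.2
        apply mul_le_mul_of_nonneg_left _ l0.le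
        rw [es]
        refine (le_abs_self _).trans ((Finset.abs_sum_le_sum_abs _ _).trans ((Finset.sum_le_sum fun i _ => h2 _).trans ?_))
        simp [mul_comm]
      · have hx0 : 0 ≤ x := by linarith [hx.1]
        refine (g2 x 0 hx0 zero_le_one (by simp)).trans ?_
        apply mul_le_mul_of_nonneg_right _ (Real.exp_pos _).le
        rw [zero_add]
        rcases Nat.eq_zero_or_pos j with hj | hj
        · subst hj
          simp only [hs, Finset.range_zero, Finset.image_empty, Finset.sum_empty, mul_zero]
          positivity
        have u1 : ∑ n ∈ s, (n:ℝ) * x ^ n ≤ UU (n0 + (j-1) * g) x := by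
          unfold UU
          apply Finset.sum_le_sum_of_subset_of_nonneg
          · intro i hi
            simp only [hs, Finset.mem_image, Finset.mem_range] at hi
            obtain ⟨k, hk, rfl⟩ := hi
            rw [Finset.mem_Icc]
            refine ⟨by omega, ?_⟩
            have : k ≤ j - 1 := by omega
            gcongr
          · intros; positivity
        have u2 := UU_le hA0 (hA.trans hx.1) (m := n0 + (j-1) * g) (n := n) (by rw [hn]; gcongr; omega)
        have e3 : n - (n0 + (j-1) * g) = g := by
          obtain ⟨j', rfl⟩ := Nat.exists_eq_add_of_le' hj
          rw [hn, Nat.add_sub_cancel, Nat.add_mul]; omega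
        rw [e3] at u2
        calc lam * (F * ξ) * ∑ n ∈ s, (n:ℝ) * x ^ n ≤ lam * (F * ξ) * (A0 / (A0 - 1) * A0⁻¹ ^ g * (n * x ^ n)) := by
              gcongr; exact u1.trans u2
          _ = lam * (A0 / (A0 - 1) * (F * A0⁻¹ ^ g) * ξ) * (n * x ^ n) := by ring
          _ ≤ _ := by rw [hcA]; gcongr
    have m1 := first_moment hξ hA0 hA hAB hB (by omega) hH1 ch (fun y => (Hb1 y).trans hδ) adm
    have m2 := first_moment hξ hA0 hA hAB hB (by omega) hH2 (by fun_prop) Hb2' adm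
    rw [← GZ] at m1 m2
    have cG := g1.continuous
    have e1 : ∫ x in A..B, G x * (h (ξ * x ^ n) ^ 2 - Q) = (∫ x in A..B, G x * h (ξ * x ^ n) ^ 2) - Q * Z j := by
      rw [GZ, ← intervalIntegral.integral_const_mul, ← intervalIntegral.integral_sub]
      · congr 1; ext x; ring
      all_goals exact Continuous.intervalIntegrable (by fun_prop) _ _
    rw [e1] at m2
    have up : Z (j+1) ≤ Z j + lam * (∫ x in A..B, G x * h (ξ * x ^ n)) + lam ^ 2 * ∫ x in A..B, G x * h (ξ * x ^ n) ^ 2 := by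
      have e : Z j + lam * (∫ x in A..B, G x * h (ξ * x ^ n)) + lam ^ 2 * (∫ x in A..B, G x * h (ξ * x ^ n) ^ 2) =
          ∫ x in A..B, G x * (1 + lam * h (ξ * x ^ n) + (lam * h (ξ * x ^ n)) ^ 2) := by
        rw [GZ, ← intervalIntegral.integral_const_mul, ← intervalIntegral.integral_const_mul,
          ← intervalIntegral.integral_add, ← intervalIntegral.integral_add]
        · congr 1; ext x; ring
        all_goals exact Continuous.intervalIntegrable (by fun_prop) _ _
      rw [e]
      apply intervalIntegral.integral_mono_on hAB
      · exact Continuous.intervalIntegrable (by fun_prop) _ _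
      · exact Continuous.intervalIntegrable (by fun_prop) _ _
      · intro x hx
        have : Real.exp (lam * ∑ i ∈ Finset.range (j+1), h (ξ * x ^ (n0 + i * g))) = G x * Real.exp (lam * h (ξ * x ^ n)) := by
          simp only [hG, es]
          rw [← Real.exp_add, ← mul_add, Finset.sum_range_succ]
        rw [this]
        apply mul_le_mul_of_nonneg_left _ (Real.exp_pos _).le
        apply exp_le_quad
        rw [abs_mul, abs_of_pos l0]
        calc lam * |h (ξ * x ^ n)| ≤ 1 / 2 * 2 := mul_le_mul (l1.trans hla) (h2 _) (abs_nonneg _) (by norm_num)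
          _ = 1 := by norm_num
    have p1 : A0⁻¹ ^ n ≤ θ ^ j := by
      calc A0⁻¹ ^ n ≤ A0⁻¹ ^ j := pow_le_pow_of_le_one i0.le i1.le (by omega)
        _ ≤ _ := by
          apply pow_le_pow_left₀ i0.le
          exact le_mul_of_one_le_right i0.le (Real.one_le_exp (by positivity))
    have p2 : A0⁻¹ ^ n * Γ ≤ θ ^ j := by
      have : Γ ≤ Real.exp (2 * lam1) ^ j := by
        rw [← Real.exp_nat_mul]
        apply Real.exp_le_exp.2
        have := mul_le_mul_of_nonneg_right l1 (by positivity : (0:ℝ) ≤ 2 * j)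
        linarith
      calc A0⁻¹ ^ n * Γ ≤ A0⁻¹ ^ j * Real.exp (2 * lam1) ^ j := by
            gcongr ?_ * ?_
            exact pow_le_pow_of_le_one i0.le i1.le (by omega)
        _ = _ := by rw [hθ, mul_pow]
    have pn : A0⁻¹ ^ n ≤ 1 := pow_le_one₀ i0.le i1.le
    have pn0 : 0 ≤ A0⁻¹ ^ n := by positivity
    have Γ0 : 0 ≤ Γ := (Real.exp_pos _).le
    have q1 := mul_le_mul_of_nonneg_left ((le_abs_self _).trans m1) l0.le
    have q2 := mul_le_mul_of_nonneg_left (sub_le_iff_le_add.1 ((le_abs_self _).trans m2)) (sq_nonneg lam)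
    have zj := Zn j
    have ll : lam ≤ 1 := by linarith
    have ll2 : lam ^ 2 ≤ 1 := pow_le_one₀ l0.le ll
    have r1 : lam * (δ / ξ * ((lam * cA + A0⁻¹ ^ n) * Z j + 2 * B0 * A0⁻¹ ^ n * Γ)) ≤
        lam ^ 2 * δ * (cA / ξ) * Z j + D / ξ * θ ^ j * Z j + D / ξ * (2 * B0) * θ ^ j := by
      have t1 : lam * (δ / ξ * (A0⁻¹ ^ n * Z j)) ≤ 1 * (D / ξ * (θ ^ j * Z j)) := by gcongr
      have t2 : lam * (δ / ξ * (2 * B0 * (A0⁻¹ ^ n * Γ))) ≤ 1 * (D / ξ * (2 * B0 * θ ^ j)) := by gcongr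
      calc _ = lam ^ 2 * δ * (cA / ξ) * Z j + lam * (δ / ξ * (A0⁻¹ ^ n * Z j)) + lam * (δ / ξ * (2 * B0 * (A0⁻¹ ^ n * Γ))) := by ring
        _ ≤ _ := by linarith
    have r2 : lam ^ 2 * (4 * δ / ξ * ((lam * cA + A0⁻¹ ^ n) * Z j + 2 * B0 * A0⁻¹ ^ n * Γ) + Q * Z j) ≤
        lam ^ 2 * δ * (2 + 4 / ξ * (cA + 1)) * Z j + 4 * D / ξ * (2 * B0) * θ ^ j := by
      have t1 : lam ^ 2 * (4 * δ / ξ * ((lam * cA + A0⁻¹ ^ n) * Z j)) ≤ lam ^ 2 * (4 * δ / ξ * ((1 * cA + 1) * Z j)) := by gcongr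
      have t2 : lam ^ 2 * (4 * δ / ξ * (2 * B0 * (A0⁻¹ ^ n * Γ))) ≤ 1 * (4 * D / ξ * (2 * B0 * θ ^ j)) := by gcongr
      have t3 : lam ^ 2 * (Q * Z j) ≤ lam ^ 2 * (2 * δ * Z j) := by gcongr
      calc _ = lam ^ 2 * (4 * δ / ξ * ((lam * cA + A0⁻¹ ^ n) * Z j)) + lam ^ 2 * (4 * δ / ξ * (2 * B0 * (A0⁻¹ ^ n * Γ))) + lam ^ 2 * (Q * Z j) := by ring
        _ ≤ lam ^ 2 * (4 * δ / ξ * ((1 * cA + 1) * Z j)) + 1 * (4 * D / ξ * (2 * B0 * θ ^ j)) + lam ^ 2 * (2 * δ * Z j) := by linarith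
        _ = _ := by ring
    have x1 : 0 ≤ 4 * D / ξ * θ ^ j * Z j := by positivity
    have x2 : 0 ≤ (D / ξ + 4 * D / ξ) * (2 * B0) * θ ^ j * Z j := by positivity
    have x3 : 0 ≤ (D / ξ + 4 * D / ξ) * θ ^ j := by positivity
    calc Z (j+1) ≤ _ := up
      _ ≤ Z j + (lam ^ 2 * δ * (cA / ξ) * Z j + D / ξ * θ ^ j * Z j + D / ξ * (2 * B0) * θ ^ j) +
        (lam ^ 2 * δ * (2 + 4 / ξ * (cA + 1)) * Z j + 4 * D / ξ * (2 * B0) * θ ^ j) := by linarith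
      _ ≤ _ := by rw [ha0, hb]; linarith
  have fin := rec_up2 (by positivity) b0 t0 t1 Zn step q
  refine fin.trans ?_
  rw [← hE, add_comm, Real.exp_add]
  have c1 : a0 ≤ max 1 (max a0 (Real.exp E * (B0 + E))) := (le_max_left _ _).trans (le_max_right _ _)
  have c2 : Real.exp E * (B0 + E) ≤ max 1 (max a0 (Real.exp E * (B0 + E))) := (le_max_right _ _).trans (le_max_right _ _)
  have c0 : (1:ℝ) ≤ max 1 (max a0 (Real.exp E * (B0 + E))) := le_max_left _ _
  set C := max 1 (max a0 (Real.exp E * (B0 + E)))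
  calc Real.exp E * Real.exp (a0 * lam ^ 2 * δ * q) * (Z 0 + E) = Real.exp E * (Z 0 + E) * Real.exp (a0 * lam ^ 2 * δ * q) := by ring
    _ ≤ Real.exp E * (B0 + E) * Real.exp (C * lam ^ 2 * δ * q) := by gcongr
    _ ≤ _ := by gcongr

theorem sum_prog (φ : ℕ → ℝ) (g q : ℕ) :
    ∑ i ∈ Finset.range (q * g), φ i = ∑ c ∈ Finset.range g, ∑ i ∈ Finset.range q, φ (c + i * g) := by
  induction q with
  | zero => simp
  | succ q ih =>
    rw [Nat.succ_mul, Finset.sum_range_add, ih]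
    simp only [Finset.sum_range_succ, Finset.sum_add_distrib]
    congr 1
    apply Finset.sum_congr rfl
    intro c _; rw [add_comm]

theorem Ioc_range (φ : ℕ → ℝ) (M H : ℕ) :
    ∑ n ∈ Finset.Ioc M (M+H), φ n = ∑ i ∈ Finset.range H, φ (M + 1 + i) := by
  induction H with
  | zero => simp
  | succ H ih =>
    rw [Finset.sum_range_succ, ← ih, ← add_assoc, Finset.sum_Ioc_succ_top (by omega)]
    congr 2; ring

theorem exp_jensen (g : ℕ) (hg : 1 ≤ g) (s : ℕ → ℝ) (lam : ℝ) :
    Real.exp (lam * ∑ c ∈ Finset.range g, s c) ≤ ∑ c ∈ Finset.range g, (g:ℝ)⁻¹ * Real.exp (lam * g * s c) := by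
  have g0 : (g:ℝ) ≠ 0 := by positivity
  have := convexOn_exp.map_sum_le (t := Finset.range g) (w := fun _ => (g:ℝ)⁻¹) (p := fun c => lam * g * s c)
    (fun i _ => by positivity) (by simp [g0]) (fun i _ => Set.mem_univ _)
  simp only [smul_eq_mul] at this
  refine le_trans (le_of_eq ?_) this
  congr 1
  rw [Finset.mul_sum]
  apply Finset.sum_congr rfl
  intro i _
  field_simp

theorem crude_mgf {ξ A0 B0 D : ℝ} (hξ : 0 < ξ) (hA0 : 1 < A0) (hB0 : A0 ≤ B0) (hD : 0 ≤ D) :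
    ∃ lam1 > (0:ℝ), lam1 ≤ 1 / 2 ∧ ∃ C ≥ (1:ℝ), ∀ A B : ℝ, A0 ≤ A → A ≤ B → B ≤ B0 → ∀ h : ℝ → ℝ, ContDiff ℝ 1 h →
      Function.Periodic h 1 → (∫ y in (0:ℝ)..1, h y = 0) → (∀ y, |h y| ≤ 2) → ∀ F δ : ℝ,
      (∀ y, |deriv h y| ≤ F) → (∫ y in (0:ℝ)..1, |h y|) ≤ δ → δ ≤ D → ∀ g : ℕ, 1 ≤ g →
      F * (A0⁻¹) ^ g ≤ D → ∀ lam : ℝ, 0 < lam → lam * g ≤ lam1 → ∀ M H : ℕ,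
      (∫ x in A..B, Real.exp (lam * ∑ n ∈ Finset.Ioc M (M + H), h (ξ * x ^ n))) ≤
        C * Real.exp (C * lam ^ 2 * g * δ * H) := by
  obtain ⟨lam1, hl0, hl1, C, hC, key⟩ := crude_prog hξ hA0 hB0 hD
  refine ⟨lam1, hl0, hl1, 3 * C, by linarith, ?_⟩
  intro A B hA hAB hB h hh ph m0 h2 F δ hF hδ hδD g hg hFg lam l0 lg M H
  have ch := hh.continuous
  have δ0 : 0 ≤ δ := le_trans (intervalIntegral.integral_nonneg zero_le_one fun x _ => abs_nonneg _) hδ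
  set q := H / g with hq
  have g0 : (0:ℝ) < g := by positivity
  have hqg : q * g ≤ H := Nat.div_mul_le_self H g
  have hqg' : H - q * g ≤ g := by
    have h1 := Nat.div_add_mod' H g
    have h2 := Nat.mod_lt H hg
    rw [← hq] at h1
    omega
  have pt : ∀ x, Real.exp (lam * ∑ n ∈ Finset.Ioc M (M + H), h (ξ * x ^ n)) ≤
      3 * ∑ c ∈ Finset.range g, (g:ℝ)⁻¹ * Real.exp (lam * g * ∑ i ∈ Finset.range q, h (ξ * x ^ (M + 1 + c + i * g))) := by
    intro x
    obtain ⟨t, ht⟩ := Nat.exists_eq_add_of_le hqg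
    rw [Ioc_range (fun n => h (ξ * x ^ n)), ht, Finset.sum_range_add, mul_add, Real.exp_add, mul_comm, sum_prog]
    have r1 : ∑ i ∈ Finset.range t, h (ξ * x ^ (M + 1 + (q * g + i))) ≤ 2 * g := by
      refine (Finset.sum_le_sum fun i _ => (le_abs_self _).trans (h2 _)).trans ?_
      have : (t:ℝ) ≤ g := by exact_mod_cast (by omega : t ≤ g)
      simp; linarith
    have r2 : Real.exp (lam * ∑ i ∈ Finset.range t, h (ξ * x ^ (M + 1 + (q * g + i)))) ≤ 3 := by
      have := Real.exp_one_lt_d9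
      refine le_trans (Real.exp_le_exp.2 (?_ : _ ≤ (1:ℝ))) (by linarith)
      have := mul_le_mul_of_nonneg_left r1 l0.le
      linarith
    have r3 := exp_jensen g hg (fun c => ∑ i ∈ Finset.range q, h (ξ * x ^ (M + 1 + (c + i * g)))) lam
    refine mul_le_mul r2 (r3.trans (le_of_eq ?_)) (Real.exp_pos _).le (by norm_num)
    simp only [add_assoc]
  calc _ ≤ ∫ x in A..B, 3 * ∑ c ∈ Finset.range g, (g:ℝ)⁻¹ * Real.exp (lam * g * ∑ i ∈ Finset.range q, h (ξ * x ^ (M + 1 + c + i * g))) := by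
        apply intervalIntegral.integral_mono_on hAB
        · exact Continuous.intervalIntegrable (by fun_prop) _ _
        · exact Continuous.intervalIntegrable (by fun_prop) _ _
        · exact fun x _ => pt x
    _ = 3 * ∑ c ∈ Finset.range g, (g:ℝ)⁻¹ * ∫ x in A..B, Real.exp (lam * g * ∑ i ∈ Finset.range q, h (ξ * x ^ (M + 1 + c + i * g))) := by
        rw [intervalIntegral.integral_const_mul, intervalIntegral.integral_finsetSum]
        · simp only [intervalIntegral.integral_const_mul]
        · intro i _; exact Continuous.intervalIntegrable (by fun_prop) _ _
    _ ≤ 3 * ∑ c ∈ Finset.range g, (g:ℝ)⁻¹ * (C * Real.exp (C * lam ^ 2 * g * δ * H)) := by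
        gcongr with c hc
        refine (key A B hA hAB hB h hh ph m0 h2 F δ hF hδ hδD g hg hFg (lam * g) (by positivity) lg (M+1+c) (by omega) q).trans ?_
        apply mul_le_mul_of_nonneg_left _ (by linarith)
        apply Real.exp_le_exp.2
        have : (q:ℝ) * g ≤ H := by exact_mod_cast hqg
        calc C * (lam * g) ^ 2 * δ * q = C * lam ^ 2 * g * δ * (q * g) := by ring
          _ ≤ _ := by gcongr
    _ = 3 * C * Real.exp (C * lam ^ 2 * g * δ * H) := by
        simp; field_simp
    _ ≤ _ := by
        gcongr; linarith

theorem markov1 {A B lam t K : ℝ} (hAB : A ≤ B) (hl : 0 ≤ lam) {S : ℝ → ℝ} (cS : Continuous S)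
    (hK : ∫ x in A..B, Real.exp (lam * S x) ≤ K) :
    volume.restrict (Set.Ioc A B) {x | t ≤ S x} ≤ ENNReal.ofReal (K * Real.exp (-(lam * t))) := by
  rw [intervalIntegral.integral_of_le hAB] at hK
  have c : Continuous fun x => Real.exp (lam * S x) := by fun_prop
  have hi : Integrable (fun x => Real.exp (lam * S x)) (volume.restrict (Set.Ioc A B)) :=
    (c.integrableOn_Icc (a := A) (b := B)).mono_set Set.Ioc_subset_Icc_self
  have := mul_meas_ge_le_integral_of_nonneg (μ := volume.restrict (Set.Ioc A B))
    (Filter.Eventually.of_forall fun x => (Real.exp_pos (lam * S x)).le) hi (Real.exp (lam * t))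
  have sub : volume.restrict (Set.Ioc A B) {x | t ≤ S x} ≤ volume.restrict (Set.Ioc A B) {x | Real.exp (lam * t) ≤ Real.exp (lam * S x)} := by
    apply measure_mono
    intro x hx
    exact Real.exp_le_exp.2 (mul_le_mul_of_nonneg_left hx hl)
  refine sub.trans ?_
  rw [← ENNReal.ofReal_toReal (measure_ne_top (volume.restrict (Set.Ioc A B)) {x | Real.exp (lam * t) ≤ Real.exp (lam * S x)})]
  apply ENNReal.ofReal_le_ofReal
  rw [Real.exp_neg, ← div_eq_mul_inv, le_div_iff₀ (Real.exp_pos _), mul_comm]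
  exact this.trans hK

theorem markov2 {A B lam t K : ℝ} (hAB : A ≤ B) (hl : 0 ≤ lam) (hK0 : 0 ≤ K) {S : ℝ → ℝ} (cS : Continuous S)
    (hK : ∫ x in A..B, Real.exp (lam * S x) ≤ K) (hK' : ∫ x in A..B, Real.exp (lam * (- S x)) ≤ K) :
    volume.restrict (Set.Ioc A B) {x | t < |S x|} ≤ ENNReal.ofReal (2 * K * Real.exp (-(lam * t))) := by
  have h1 := markov1 (t := t) hAB hl cS hK
  have h2 := markov1 (t := t) hAB hl cS.neg hK'
  have : {x | t < |S x|} ⊆ {x | t ≤ S x} ∪ {x | t ≤ - S x} := by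
    intro x hx
    rcases lt_abs.1 (show t < |S x| from hx) with h | h
    · exact Or.inl h.le
    · exact Or.inr h.le
  refine (measure_mono this).trans ((measure_union_le _ _).trans ((add_le_add h1 h2).trans ?_))
  rw [← ENNReal.ofReal_add (by positivity) (by positivity)]
  apply le_of_eq; congr 1; ring

theorem meas_bU {ι : Type*} (μ : Measure ℝ) (t : Finset ι) (E : ι → Set ℝ) (b : ℝ)
    (h : ∀ i ∈ t, μ (E i) ≤ ENNReal.ofReal b) : μ (⋃ i ∈ t, E i) ≤ ENNReal.ofReal (t.card * b) := by
  refine (measure_biUnion_finset_le t E).trans ((Finset.sum_le_sum h).trans ?_)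
  simp [ENNReal.ofReal_mul (Nat.cast_nonneg _)]

theorem bc_sum {μ : Measure ℝ} {E : ℕ → Set ℝ} {c : ℝ} {k0 : ℕ}
    (h : ∀ k ≥ k0, μ (E k) ≤ ENNReal.ofReal (c * ((k:ℝ) ^ (2:ℝ))⁻¹)) : ∀ᵐ x ∂μ, ∀ᶠ k in atTop, x ∉ E k := by
  have s1 : Summable fun k : ℕ => c * ((k:ℝ) ^ (2:ℝ))⁻¹ :=
    (Real.summable_nat_rpow_inv.2 (by norm_num)).mul_left c
  have : ∑' k, μ (if k0 ≤ k then E k else ∅) ≠ ⊤ := by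
    refine ne_top_of_le_ne_top s1.tsum_ofReal_ne_top (ENNReal.tsum_le_tsum fun k => ?_)
    split_ifs with hk
    · exact h k hk
    · simp
  filter_upwards [ae_eventually_notMem this] with x hx
  filter_upwards [hx, eventually_ge_atTop k0] with k hk hk0
  simpa [hk0] using hk

noncomputable def cen (f : ℝ → ℝ) : ℝ → ℝ := fun y => f y - ∫ u in (0:ℝ)..1, f u

structure Cls (D : ℝ) (l : ℕ) (f : ℝ → ℝ) : Prop where
  cd : ContDiff ℝ 1 f
  per : Function.Periodic f 1
  bd : ∀ y, |f y| ≤ 1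
  int : ∫ y in (0:ℝ)..1, |f y| ≤ D / 16 ^ l
  der : ∀ y, |deriv f y| ≤ D * 16 ^ l

theorem cen_props {f : ℝ → ℝ} (cd : ContDiff ℝ 1 f) (per : Function.Periodic f 1) :
    ContDiff ℝ 1 (cen f) ∧ Function.Periodic (cen f) 1 ∧ (∫ y in (0:ℝ)..1, cen f y = 0) ∧ deriv (cen f) = deriv f := by
  refine ⟨cd.sub contDiff_const, fun y => by simp [cen, per y], ?_, ?_⟩
  · unfold cen
    rw [intervalIntegral.integral_sub (cd.continuous.intervalIntegrable _ _) (continuous_const.intervalIntegrable _ _)]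
    simp
  · ext y; unfold cen; simp

theorem int_abs_le {f : ℝ → ℝ} : |∫ u in (0:ℝ)..1, f u| ≤ ∫ u in (0:ℝ)..1, |f u| :=
  intervalIntegral.abs_integral_le_integral_abs zero_le_one

theorem int_le_one {f : ℝ → ℝ} (cf : Continuous f) (h : ∀ y, f y ≤ 1) : ∫ u in (0:ℝ)..1, f u ≤ 1 := by
  have := intervalIntegral.integral_mono_on (a := (0:ℝ)) (b := 1) (μ := volume) zero_le_one
    (cf.intervalIntegrable _ _) ((continuous_const (y := (1:ℝ))).intervalIntegrable _ _) (fun x _ => h x)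
  simpa using this

theorem Cls.cen_bd {D : ℝ} {l : ℕ} {f : ℝ → ℝ} (h : Cls D l f) : (∀ y, |cen f y| ≤ 2) ∧
    (∫ y in (0:ℝ)..1, |cen f y|) ≤ 2 * (D / 16 ^ l) := by
  have c := h.cd.continuous
  have i1 := int_abs_le (f := f)
  have i2 : ∫ u in (0:ℝ)..1, |f u| ≤ 1 := int_le_one c.abs h.bd
  constructor
  · intro y
    unfold cen
    refine (abs_sub _ _).trans ?_
    linarith [h.bd y]
  · have := intervalIntegral.integral_mono_on (a := (0:ℝ)) (b := 1) (μ := volume) zero_le_one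
      ((by unfold cen; fun_prop : Continuous fun y => |cen f y|).intervalIntegrable _ _)
      ((by fun_prop : Continuous fun y => |f y| + |∫ u in (0:ℝ)..1, f u|).intervalIntegrable _ _) (fun x _ => abs_sub _ _)
    rw [intervalIntegral.integral_add (c.abs.intervalIntegrable _ _) (continuous_const.intervalIntegrable _ _)] at this
    simp only [intervalIntegral.integral_const, sub_zero, one_smul] at this
    linarith [h.int]

theorem Cls.int_nonneg {D : ℝ} {l : ℕ} {f : ℝ → ℝ} (h : Cls D l f) : 0 ≤ D := by
  have : 0 ≤ D * 16 ^ l := (abs_nonneg _).trans (h.der 0)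
  exact nonneg_of_mul_nonneg_left this (by positivity)

theorem four_thirds (m : ℕ) : 1 + (m:ℝ) / 3 ≤ (4/3:ℝ) ^ m := by
  have := one_add_mul_le_pow (a := (1/3:ℝ)) (by norm_num) m
  norm_num at this; linarith

theorem exp4 : (16:ℝ) ≤ Real.exp 4 := by
  have := Real.add_one_le_exp (1:ℝ)
  have e : Real.exp 4 = Real.exp 1 ^ 4 := by rw [← Real.exp_nat_mul]; norm_num
  rw [e]
  calc (16:ℝ) = 2 ^ 4 := by norm_num
    _ ≤ _ := by gcongr; linarith

/-- the counting estimate -/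
theorem count_bd {C2 lg : ℝ} (h1 : 1 ≤ lg) (h2 : 0 ≤ C2) (m : ℕ) :
    (16:ℝ) ^ m * Real.exp (C2 * lg - (C2 + 12) * (4/3:ℝ) ^ m * lg) ≤ Real.exp (-(12 * lg)) := by
  have f := four_thirds m
  have e : (16:ℝ) ^ m ≤ Real.exp (4 * m) := by
    rw [mul_comm, Real.exp_nat_mul]; exact pow_le_pow_left₀ (by norm_num) exp4 m
  calc (16:ℝ) ^ m * Real.exp (C2 * lg - (C2 + 12) * (4/3:ℝ) ^ m * lg) ≤ Real.exp (4 * m) * Real.exp (C2 * lg - (C2 + 12) * (4/3:ℝ) ^ m * lg) := by gcongr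
    _ = Real.exp (4 * m + (C2 * lg - (C2 + 12) * (4/3:ℝ) ^ m * lg)) := by rw [Real.exp_add]
    _ ≤ _ := by
      apply Real.exp_le_exp.2
      have m0 : (0:ℝ) ≤ m := Nat.cast_nonneg m
      have a1 : (C2 + 12) * lg * (1 + (m:ℝ)/3) ≤ (C2 + 12) * lg * (4/3:ℝ) ^ m := by gcongr
      have a2 : (12:ℝ) * 1 * (m / 3) ≤ (C2 + 12) * lg * (m/3) := by gcongr; linarith
      nlinarith

theorem crude_event {ξ A0 B0 D : ℝ} (hξ : 0 < ξ) (hA0 : 1 < A0) (hB0 : A0 ≤ B0) (hD : 0 ≤ D) :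
    ∃ C ≥ (0:ℝ), ∃ C2 ≥ (0:ℝ), ∃ k0 : ℕ, ∀ κ ≥ k0, ∀ l ≤ 2 * κ, ∀ s ≤ 3 * κ, ∀ f, Cls D l f → ∀ M H : ℕ,
      H ≤ 16 * 16 ^ (4 * κ - s) → volume.restrict (Set.Ioc A0 B0)
        {x | (C2 + 12) * (2/3) ^ (l+s) * (16 ^ (2 * κ) * Real.sqrt (Real.log κ)) < |∑ n ∈ Finset.Ioc M (M+H), cen f (ξ * x ^ n)|}
        ≤ ENNReal.ofReal (2 * C * Real.exp (C2 * Real.log κ - (C2 + 12) * (4/3) ^ (l+s) * Real.log κ)) := by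
  obtain ⟨lam1, hl0, hl1, C, hC, key⟩ := crude_mgf hξ hA0 hB0 (by positivity : 0 ≤ 2 * D)
  obtain ⟨K, hK⟩ := pow_unbounded_of_one_lt (16:ℝ) hA0
  have K0 : 1 ≤ K := by
    rcases Nat.eq_zero_or_pos K with h | h
    · subst h; norm_num at hK
    · exact h
  have hev : ∀ᶠ κ : ℕ in atTop, 1 ≤ Real.log κ ∧ (κ:ℝ) ^ 2 * (3 * K) / 2 ^ κ ≤ lam1 := by
    refine ((Real.tendsto_log_atTop.comp tendsto_natCast_atTop_atTop).eventually_ge_atTop 1).and ?_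
    have t1 := tendsto_pow_const_div_const_pow_of_one_lt 2 (by norm_num : (1:ℝ) < 2)
    have t2 := t1.mul_const (3 * (K:ℝ))
    rw [zero_mul] at t2
    filter_upwards [t2.eventually_le_const hl0] with κ hκ
    rwa [div_mul_eq_mul_div] at hκ
  obtain ⟨k0, hk0⟩ := (hev.and (eventually_ge_atTop 1)).exists_forall_of_atTop
  refine ⟨C, by linarith, 32 * C * K * D, by positivity, k0, ?_⟩
  intro κ hκ l hl s hs f hf M H hH
  obtain ⟨⟨lg1, hlam⟩, κ1⟩ := hk0 κ hκ
  set lg := Real.log κ with hlg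
  have sq : Real.sqrt lg ^ 2 = lg := Real.sq_sqrt (by linarith)
  have sq1 : 1 ≤ Real.sqrt lg := Real.one_le_sqrt.2 lg1
  set g := K * (l+1) with hg
  set lam := 2 ^ (l+s) * Real.sqrt lg / 16 ^ (2 * κ) with hlam'
  have lam0 : 0 < lam := by positivity
  obtain ⟨p1, p2, p3, p4⟩ := cen_props hf.cd hf.per
  obtain ⟨b1, b2⟩ := hf.cen_bd
  have lg_le : Real.sqrt lg ≤ κ := by
    have : lg ≤ κ := (Real.log_le_self (Nat.cast_nonneg _))
    nlinarith
  have hlg' : lam * g ≤ lam1 := by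
    refine le_trans ?_ hlam
    have e1 : (16:ℝ) ^ (2 * κ) = 2 ^ (5 * κ) * 2 ^ (3 * κ) := by
      rw [← pow_add, show (16:ℝ) = 2 ^ 4 by norm_num, ← pow_mul]; congr 1; ring
    have e2 : (2:ℝ) ^ (l+s) ≤ 2 ^ (5 * κ) := pow_le_pow_right₀ (by norm_num) (by omega)
    have e3 : (2:ℝ) ^ κ ≤ 2 ^ (3 * κ) := pow_le_pow_right₀ (by norm_num) (by omega)
    have e4 : (g:ℝ) ≤ K * (3 * κ) := by
      rw [hg]; push_cast; gcongr; exact_mod_cast (by omega : l + 1 ≤ 3 * κ)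
    rw [hlam', e1, div_mul_eq_mul_div, div_le_div_iff₀ (by positivity) (by positivity)]
    calc 2 ^ (l+s) * Real.sqrt lg * g * 2 ^ κ ≤ 2 ^ (5*κ) * κ * (K * (3 * κ)) * 2 ^ (3 * κ) := by gcongr
      _ = _ := by ring
  have hg1 : 1 ≤ g := by rw [hg]; exact Nat.mul_pos K0 (by omega)
  have hFg : D * 16 ^ l * (A0⁻¹) ^ g ≤ 2 * D := by
    have : (A0⁻¹) ^ g ≤ ((16:ℝ) ^ l)⁻¹ := by
      rw [inv_pow]
      apply inv_anti₀ (by positivity)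
      rw [hg, pow_mul]
      calc (16:ℝ) ^ l ≤ 16 ^ (l+1) := pow_le_pow_right₀ (by norm_num) (by omega)
        _ ≤ _ := by gcongr
    calc D * 16 ^ l * (A0⁻¹) ^ g ≤ D * 16 ^ l * ((16:ℝ) ^ l)⁻¹ := by gcongr
      _ = D := by field_simp
      _ ≤ _ := by linarith
  have hδ : 2 * (D / 16 ^ l) ≤ 2 * D := by
    gcongr; exact div_le_self hD (one_le_pow₀ (by norm_num))
  have cc := p1.continuous
  have cS : Continuous fun x : ℝ => ∑ n ∈ Finset.Ioc M (M+H), cen f (ξ * x ^ n) := by fun_prop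
  have expo : C * lam ^ 2 * g * (2 * (D / 16 ^ l)) * H ≤ 32 * C * K * D * lg := by
    have h1 : (H:ℝ) ≤ 16 * 16 ^ (4 * κ - s) := by exact_mod_cast hH
    have h2 : (l:ℝ) + 1 ≤ 4 ^ l := by
      have := one_add_mul_le_pow (a := (3:ℝ)) (by norm_num) l
      norm_num at this
      have : (0:ℝ) ≤ l := Nat.cast_nonneg l
      linarith
    have h3 : (16:ℝ) ^ (4 * κ - s) * 16 ^ s = 16 ^ (4 * κ) := by rw [← pow_add]; congr 1; omega
    have h4 : (4:ℝ) ^ s ≤ 16 ^ s := pow_le_pow_left₀ (by norm_num) (by norm_num) s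
    have h5 : lam ^ 2 = 4 ^ l * 4 ^ s * lg / 16 ^ (4 * κ) := by
      rw [hlam', div_pow, mul_pow, sq]
      congr 1
      · rw [← pow_mul, mul_comm, mul_comm (l+s) 2, pow_mul, ← pow_add]; norm_num; ring
      · rw [← pow_mul]; congr 1; ring
    have h6 : (4:ℝ) ^ l * 4 ^ l = 16 ^ l := by rw [← mul_pow]; norm_num
    calc C * lam ^ 2 * g * (2 * (D / 16 ^ l)) * H ≤ C * lam ^ 2 * (K * 4 ^ l) * (2 * (D / 16 ^ l)) * (16 * 16 ^ (4 * κ - s)) := by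
          gcongr
          rw [hg]; push_cast; gcongr
      _ = 32 * C * K * D * lg * ((4 ^ s * 16 ^ (4 * κ - s)) / 16 ^ (4 * κ)) := by
          rw [h5, ← h6]; field_simp; ring
      _ ≤ 32 * C * K * D * lg * ((16 ^ s * 16 ^ (4 * κ - s)) / 16 ^ (4 * κ)) := by
          gcongr
      _ = 32 * C * K * D * lg := by rw [mul_comm ((16:ℝ)^s), h3, div_self (by positivity), mul_one]
  have k1 := key A0 B0 le_rfl hB0 le_rfl (cen f) p1 p2 p3 b1 (D * 16 ^ l) _ (by rw [p4]; exact hf.der) b2 hδ g hg1 hFg lam lam0 hlg' M H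
  have k2 := key A0 B0 le_rfl hB0 le_rfl (fun y => - cen f y) p1.neg (fun y => by simp only [p2 y]) (by simp [p3])
    (by simpa using b1) (D * 16 ^ l) _ (by
      intro y
      have : deriv (fun y => - cen f y) y = - deriv (cen f) y := by simp
      rw [this, abs_neg, p4]; exact hf.der y) (by simpa using b2) hδ g hg1 hFg lam lam0 hlg' M H
  simp only [Finset.sum_neg_distrib] at k2
  have m := markov2 (t := (32 * C * K * D + 12) * (2/3) ^ (l+s) * (16 ^ (2 * κ) * Real.sqrt lg)) hB0 lam0.le
    (by positivity) cS k1 k2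
  refine m.trans (ENNReal.ofReal_le_ofReal ?_)
  rw [← mul_assoc 2 C, mul_assoc (2 * C), ← Real.exp_add]
  gcongr
  have e : lam * ((32 * C * K * D + 12) * (2/3) ^ (l+s) * (16 ^ (2 * κ) * Real.sqrt lg)) = (32 * C * K * D + 12) * (4/3) ^ (l+s) * lg := by
    have : (4/3:ℝ) ^ (l+s) = 2 ^ (l+s) * (2/3) ^ (l+s) := by rw [← mul_pow]; norm_num
    rw [this, hlam']
    calc _ = (2 ^ (l+s)) * (2/3) ^ (l+s) * (32 * C * K * D + 12) * (Real.sqrt lg ^ 2) * (16 ^ (2 * κ) / 16 ^ (2 * κ)) := by ring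
      _ = _ := by rw [sq, div_self (by positivity)]; ring
  rw [e]; linarith

theorem crude_blocks {ξ A0 B0 D : ℝ} (hξ : 0 < ξ) (hA0 : 1 < A0) (hB0 : A0 ≤ B0) (hD : 0 ≤ D) :
    ∃ C1 ≥ (0:ℝ), ∀ (c0 : ℕ) (r : ℕ → ℕ → ℝ → ℝ), (∀ l j, Cls D l (r l j)) →
      ∀ᵐ x ∂(volume.restrict (Set.Ioc A0 B0)), ∀ᶠ κ : ℕ in atTop, ∀ l ≤ 2 * κ, ∀ s ≤ 3 * κ, ∀ j < c0 * 16 ^ l, ∀ p < 16 ^ s,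
        |∑ n ∈ Finset.Ioc (p / 16 * (16 * 16 ^ (4 * κ - s))) (p * 16 ^ (4 * κ - s)), cen (r l j) (ξ * x ^ n)| ≤
          C1 * (2/3) ^ (l+s) * (16 ^ (2 * κ) * Real.sqrt (Real.log κ)) := by
  obtain ⟨C, hC, C2, hC2, k0, ev⟩ := crude_event hξ hA0 hB0 hD
  refine ⟨C2 + 12, by linarith, fun c0 r hr => ?_⟩
  set μ := volume.restrict (Set.Ioc A0 B0) with hμ
  set E : ℕ → Set ℝ := fun κ => ⋃ l ∈ Finset.range (2*κ+1), ⋃ s ∈ Finset.range (3*κ+1), ⋃ j ∈ Finset.range (c0 * 16 ^ l),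
    ⋃ p ∈ Finset.range (16 ^ s), {x | (C2 + 12) * (2/3) ^ (l+s) * (16 ^ (2 * κ) * Real.sqrt (Real.log κ)) <
      |∑ n ∈ Finset.Ioc (p / 16 * (16 * 16 ^ (4 * κ - s))) (p * 16 ^ (4 * κ - s)), cen (r l j) (ξ * x ^ n)|} with hE
  have main : ∀ᵐ x ∂μ, ∀ᶠ κ in atTop, x ∉ E κ := by
    apply bc_sum (c := 24 * c0 * C) (k0 := max k0 3)
    intro κ hκ
    have hk0 : k0 ≤ κ := (le_max_left _ _).trans hκ
    have hk3 : 3 ≤ κ := (le_max_right _ _).trans hκ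
    have κ0 : (0:ℝ) < κ := by positivity
    have lg1 : 1 ≤ Real.log κ := by
      rw [Real.le_log_iff_exp_le κ0]
      have := Real.exp_one_lt_d9
      have : (3:ℝ) ≤ κ := by exact_mod_cast hk3
      linarith
    have b1 : ∀ l ∈ Finset.range (2*κ+1), ∀ s ∈ Finset.range (3*κ+1), ∀ j ∈ Finset.range (c0 * 16 ^ l), ∀ p ∈ Finset.range (16 ^ s),
        μ {x | (C2 + 12) * (2/3) ^ (l+s) * (16 ^ (2 * κ) * Real.sqrt (Real.log κ)) <
      |∑ n ∈ Finset.Ioc (p / 16 * (16 * 16 ^ (4 * κ - s))) (p * 16 ^ (4 * κ - s)), cen (r l j) (ξ * x ^ n)|} ≤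
      ENNReal.ofReal (2 * C * Real.exp (C2 * Real.log κ - (C2 + 12) * (4/3) ^ (l+s) * Real.log κ)) := by
      intro l hl s hs j hj p hp
      have h1 := Nat.div_add_mod' p 16
      have h2 := Nat.mod_lt p (by norm_num : 0 < 16)
      have e : p * 16 ^ (4 * κ - s) = p / 16 * (16 * 16 ^ (4 * κ - s)) + (p % 16) * 16 ^ (4 * κ - s) := by
        conv_lhs => rw [← h1]
        ring
      rw [e]
      apply ev κ hk0 l (by simpa [Nat.lt_succ_iff] using hl) s (by simpa [Nat.lt_succ_iff] using hs) _ (hr l j)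
      gcongr
    have b2 : μ (E κ) ≤ ENNReal.ofReal ((2*κ+1:ℕ) * ((3*κ+1:ℕ) * (2 * c0 * C * Real.exp (-(12 * Real.log κ))))) := by
      have w := meas_bU μ (Finset.range (2*κ+1)) (fun l => ⋃ s ∈ Finset.range (3*κ+1), ⋃ j ∈ Finset.range (c0 * 16 ^ l),
        ⋃ p ∈ Finset.range (16 ^ s), {x | (C2 + 12) * (2/3) ^ (l+s) * (16 ^ (2 * κ) * Real.sqrt (Real.log κ)) <
        |∑ n ∈ Finset.Ioc (p / 16 * (16 * 16 ^ (4 * κ - s))) (p * 16 ^ (4 * κ - s)), cen (r l j) (ξ * x ^ n)|})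
        ((3*κ+1:ℕ) * (2 * c0 * C * Real.exp (-(12 * Real.log κ))))
      rw [Finset.card_range] at w
      apply w
      intro l hl
      have w2 := meas_bU μ (Finset.range (3*κ+1)) (fun s => ⋃ j ∈ Finset.range (c0 * 16 ^ l),
        ⋃ p ∈ Finset.range (16 ^ s), {x | (C2 + 12) * (2/3) ^ (l+s) * (16 ^ (2 * κ) * Real.sqrt (Real.log κ)) <
        |∑ n ∈ Finset.Ioc (p / 16 * (16 * 16 ^ (4 * κ - s))) (p * 16 ^ (4 * κ - s)), cen (r l j) (ξ * x ^ n)|})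
        (2 * c0 * C * Real.exp (-(12 * Real.log κ)))
      rw [Finset.card_range] at w2
      apply w2
      intro s hs
      refine (meas_bU μ _ _ _ fun j hj => meas_bU μ _ _ _ fun p hp => b1 l hl s hs j hj p hp).trans (ENNReal.ofReal_le_ofReal ?_)
      have := count_bd lg1 hC2 (l+s)
      simp only [Finset.card_range]
      push_cast
      calc c0 * 16 ^ l * (16 ^ s * (2 * C * Real.exp (C2 * Real.log κ - (C2 + 12) * (4/3) ^ (l+s) * Real.log κ))) =
          2 * c0 * C * (16 ^ (l+s) * Real.exp (C2 * Real.log κ - (C2 + 12) * (4/3) ^ (l+s) * Real.log κ)) := by rw [pow_add]; ring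
        _ ≤ _ := by gcongr
    refine b2.trans (ENNReal.ofReal_le_ofReal ?_)
    have e1 : Real.exp (-(12 * Real.log κ)) ≤ ((κ:ℝ) ^ 4)⁻¹ := by
      rw [Real.exp_neg]
      apply inv_anti₀ (by positivity)
      calc (κ:ℝ) ^ 4 = Real.exp (4 * Real.log κ) := by
            rw [← Real.exp_log (by positivity : (0:ℝ) < κ ^ 4), Real.log_pow]; norm_num
        _ ≤ _ := Real.exp_le_exp.2 (by linarith)
    have κ1 : (1:ℝ) ≤ κ := by exact_mod_cast (by omega : 1 ≤ κ)
    push_cast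
    calc (2 * (κ:ℝ) + 1) * ((3 * κ + 1) * (2 * c0 * C * Real.exp (-(12 * Real.log κ)))) ≤
        (3 * κ) * ((4 * κ) * (2 * c0 * C * ((κ:ℝ) ^ 4)⁻¹)) := by gcongr <;> linarith
      _ = _ := by
        rw [Real.rpow_two]; field_simp; ring
  filter_upwards [main] with x hx
  filter_upwards [hx] with κ hκ l hl s hs j hj p hp
  by_contra hcon
  apply hκ
  simp only [hE, Set.mem_iUnion, Finset.mem_range, Set.mem_ofPred_eq]
  exact ⟨l, by omega, s, by omega, j, hj, p, hp, not_le.1 hcon⟩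

/-- all `N` -/
theorem crude_ae {ξ A0 B0 D : ℝ} (hξ : 0 < ξ) (hA0 : 1 < A0) (hB0 : A0 ≤ B0) (hD : 0 ≤ D) :
    ∃ C1 ≥ (0:ℝ), ∀ (c0 : ℕ) (r : ℕ → ℕ → ℝ → ℝ), (∀ l j, Cls D l (r l j)) →
      ∀ᵐ x ∂(volume.restrict (Set.Ioc A0 B0)), ∀ᶠ κ : ℕ in atTop, ∀ l ≤ 2 * κ, ∀ s0 ≤ 3 * κ, ∀ j < c0 * 16 ^ l, ∀ N < 16 ^ (4 * κ),
        |∑ n ∈ Finset.Ioc (N / 16 ^ (4 * κ - s0) * 16 ^ (4 * κ - s0)) N, cen (r l j) (ξ * x ^ n)| ≤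
          C1 * (2/3) ^ (l+s0) * (16 ^ (2 * κ) * Real.sqrt (Real.log κ)) := by
  obtain ⟨C1, hC1, key⟩ := crude_blocks hξ hA0 hB0 hD
  refine ⟨3 * C1 + 2, by linarith, fun c0 r hr => ?_⟩
  filter_upwards [key c0 r hr] with x hx
  filter_upwards [hx, eventually_ge_atTop 3] with κ hκ hk3 l hl s0 hs0 j hj N hN
  have κ0 : (0:ℝ) < κ := by positivity
  have lg1 : 1 ≤ Real.log κ := by
    rw [Real.le_log_iff_exp_le κ0]
    have := Real.exp_one_lt_d9
    have : (3:ℝ) ≤ κ := by exact_mod_cast hk3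
    linarith
  have sq1 : 1 ≤ Real.sqrt (Real.log κ) := Real.one_le_sqrt.2 lg1
  set R := (16:ℝ) ^ (2 * κ) * Real.sqrt (Real.log κ) with hR
  have R0 : 0 ≤ R := by positivity
  set φ : ℕ → ℝ := fun n => cen (r l j) (ξ * x ^ n) with hφ
  set NN : ℕ → ℕ := fun s => N / 16 ^ (4 * κ - s) * 16 ^ (4 * κ - s) with hNN
  have step : ∀ d, s0 + d ≤ 3 * κ → NN s0 ≤ NN (s0 + d) ∧
      |∑ n ∈ Finset.Ioc (NN s0) (NN (s0 + d)), φ n| ≤ 3 * C1 * (2/3) ^ l * R * ((2/3) ^ s0 - (2/3) ^ (s0 + d)) := by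
    intro d
    induction d with
    | zero => intro _; simp
    | succ d ih =>
      intro hd
      obtain ⟨i1, i2⟩ := ih (by omega)
      have e : NN (s0 + d) = (N / 16 ^ (4 * κ - (s0 + d + 1))) / 16 * (16 * 16 ^ (4 * κ - (s0 + d + 1))) := by
        simp only [hNN]
        have : 4 * κ - (s0 + d) = 4 * κ - (s0 + d + 1) + 1 := by omega
        rw [this, pow_succ, Nat.div_div_eq_div_mul, mul_comm 16]
      have hp : N / 16 ^ (4 * κ - (s0 + d + 1)) < 16 ^ (s0 + d + 1) := by
        rw [Nat.div_lt_iff_lt_mul (by positivity), ← pow_add]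
        refine hN.trans_le (Nat.pow_le_pow_right (by norm_num) (by omega))
      have h1 := hκ l hl (s0 + d + 1) (by omega) j hj _ hp
      rw [← e] at h1
      have le : NN (s0 + d) ≤ NN (s0 + d + 1) := by
        rw [e]; simp only [hNN]
        rw [← mul_assoc]
        gcongr
        exact Nat.div_mul_le_self _ _
      refine ⟨i1.trans le, ?_⟩
      rw [← add_assoc, ← Finset.sum_Ioc_consecutive φ i1 le]
      refine (abs_add_le _ _).trans ((add_le_add i2 h1).trans ?_)
      rw [pow_add (2/3:ℝ) l, pow_succ (2/3:ℝ) (s0 + d)]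
      have : 0 ≤ C1 * (2/3) ^ l * R * (2/3) ^ (s0 + d) := by positivity
      linarith
  obtain ⟨s1, s2⟩ := step (3 * κ - s0) (by omega)
  rw [Nat.add_sub_cancel' hs0] at s1 s2
  have le : NN (3 * κ) ≤ N := Nat.div_mul_le_self _ _
  have rem : |∑ n ∈ Finset.Ioc (NN (3 * κ)) N, φ n| ≤ 2 * 16 ^ κ := by
    refine (Finset.abs_sum_le_sum_abs _ _).trans ((Finset.sum_le_sum fun i _ => (hr l j).cen_bd.1 _).trans ?_)
    have : N - NN (3 * κ) ≤ 16 ^ κ := by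
      have h1 := Nat.div_add_mod' N (16 ^ κ)
      have h2 := Nat.mod_lt N (by positivity : 0 < 16 ^ κ)
      have h3 : 4 * κ - 3 * κ = κ := by omega
      simp only [hNN]
      rw [h3]
      omega
    have : ((N - NN (3 * κ) : ℕ):ℝ) ≤ 16 ^ κ := by exact_mod_cast this
    simp only [Finset.sum_const, Nat.card_Ioc, nsmul_eq_mul]
    linarith
  have rem2 : (16:ℝ) ^ κ ≤ (2/3) ^ (l + s0) * R := by
    have : (2/3:ℝ) ^ (5 * κ) ≤ (2/3) ^ (l + s0) := pow_le_pow_of_le_one (by norm_num) (by norm_num) (by omega)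
    have h1 : (16:ℝ) ^ κ * 1 ≤ 16 ^ κ * ((2/3) ^ (5*κ) * 16 ^ κ) := by
      gcongr
      rw [pow_mul, ← mul_pow]
      apply one_le_pow₀; norm_num
    calc (16:ℝ) ^ κ ≤ (2/3) ^ (5*κ) * (16 ^ (2 * κ) * 1) := by
          rw [two_mul κ, pow_add]; linarith
      _ ≤ _ := by rw [hR]; gcongr
  rw [← Finset.sum_Ioc_consecutive φ s1 le]
  refine (abs_add_le _ _).trans ((add_le_add s2 rem).trans ?_)
  rw [pow_add] at rem2 ⊢
  have : 0 ≤ C1 * (2/3) ^ l * R * (2/3) ^ (3*κ) := by positivity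
  linarith

theorem st_mono : Monotone Real.smoothTransition := Real.smoothTransition.monotone

theorem st_deriv : ∃ C ≥ (1:ℝ), ∀ t, |deriv Real.smoothTransition t| ≤ C := by
  have cd : ContDiff ℝ 1 Real.smoothTransition := Real.smoothTransition.contDiff
  have c : Continuous (deriv Real.smoothTransition) := cd.continuous_deriv le_rfl
  obtain ⟨C, hC⟩ := (isCompact_Icc (a := (0:ℝ)) (b := 1)).exists_bound_of_continuousOn c.continuousOn
  refine ⟨max C 1, le_max_right _ _, fun t => ?_⟩
  by_cases h : t ∈ Set.Icc (0:ℝ) 1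
  · exact (hC t h).trans (le_max_left _ _)
  · have : deriv Real.smoothTransition t = 0 := by
      rw [Set.mem_Icc, not_and_or, not_le, not_le] at h
      rcases h with h | h
      · have : Real.smoothTransition =ᶠ[nhds t] fun _ => 0 := by
          filter_upwards [gt_mem_nhds h] with u hu
          exact Real.smoothTransition.zero_of_nonpos hu.le
        rw [this.deriv_eq]; simp
      · have : Real.smoothTransition =ᶠ[nhds t] fun _ => 1 := by
          filter_upwards [lt_mem_nhds h] with u hu
          exact Real.smoothTransition.one_of_one_le hu.le
        rw [this.deriv_eq]; simp
    rw [this, abs_zero]; positivity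

noncomputable def SF (l : ℕ) (y : ℝ) : ℝ := ⌊y⌋ - 1 + Real.smoothTransition (16 ^ (l+1) * Int.fract y)

theorem SF_local (l : ℕ) (m : ℤ) {y : ℝ} (h1 : (m:ℝ) - 1/2 < y) (h2 : y < m + 1) :
    SF l y = m - 1 + Real.smoothTransition (16 ^ (l+1) * (y - m)) := by
  unfold SF
  by_cases h : (m:ℝ) ≤ y
  · have : ⌊y⌋ = m := Int.floor_eq_iff.2 ⟨h, h2⟩
    rw [Int.fract, this]
  · rw [not_le] at h
    have e : ⌊y⌋ = m - 1 := Int.floor_eq_iff.2 ⟨by push_cast; linarith, by push_cast; linarith⟩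
    have p : (2:ℝ) ≤ 16 ^ (l+1) := by
      calc (2:ℝ) ≤ 16 ^ 1 := by norm_num
        _ ≤ _ := pow_le_pow_right₀ (by norm_num) (by omega)
    rw [Int.fract, e, Real.smoothTransition.one_of_one_le, Real.smoothTransition.zero_of_nonpos]
    · push_cast; ring
    · exact mul_nonpos_of_nonneg_of_nonpos (by positivity) (by linarith)
    · push_cast
      nlinarith

theorem SF_event (l : ℕ) (y0 : ℝ) : SF l =ᶠ[nhds y0] fun y => (⌊y0⌋:ℝ) - 1 + Real.smoothTransition (16 ^ (l+1) * (y - ⌊y0⌋)) := by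
  have h1 := Int.floor_le y0
  have h2 := Int.lt_floor_add_one y0
  filter_upwards [lt_mem_nhds (by linarith : (⌊y0⌋:ℝ) - 1/2 < y0), gt_mem_nhds h2] with y hy1 hy2
  exact SF_local l _ hy1 hy2

theorem SF_cd (l : ℕ) : ContDiff ℝ 1 (SF l) := by
  rw [contDiff_iff_contDiffAt]
  intro y0
  refine ContDiffAt.congr_of_eventuallyEq ?_ (SF_event l y0)
  have : ContDiff ℝ 1 Real.smoothTransition := Real.smoothTransition.contDiff
  apply ContDiff.contDiffAt
  fun_prop

theorem SF_cont (l : ℕ) : Continuous (SF l) := (SF_cd l).continuous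

theorem SF_deriv {C : ℝ} (hC : ∀ t, |deriv Real.smoothTransition t| ≤ C) (l : ℕ) (y : ℝ) : |deriv (SF l) y| ≤ C * 16 ^ (l+1) := by
  rw [(SF_event l y).deriv_eq]
  have cd : ContDiff ℝ 1 Real.smoothTransition := Real.smoothTransition.contDiff
  have d := (cd.differentiable one_ne_zero (16 ^ (l+1) * (y - ⌊y⌋))).hasDerivAt
  have i : HasDerivAt (fun z : ℝ => (16:ℝ) ^ (l+1) * (z - ⌊y⌋)) (16 ^ (l+1)) y := by
    simpa using ((hasDerivAt_id y).sub_const (⌊y⌋:ℝ)).const_mul ((16:ℝ) ^ (l+1))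
  have := (d.comp y i).const_add ((⌊y⌋:ℝ) - 1)
  rw [HasDerivAt.deriv (f := fun y' : ℝ => (⌊y⌋:ℝ) - 1 + Real.smoothTransition (16 ^ (l+1) * (y' - ⌊y⌋))) this, abs_mul, abs_of_pos (by positivity : (0:ℝ) < 16 ^ (l+1))]
  gcongr
  exact hC _

theorem SF_add_one (l : ℕ) (y : ℝ) : SF l (y+1) = SF l y + 1 := by
  unfold SF
  rw [Int.floor_add_one, Int.fract_add_one]; push_cast; ring

theorem SF_sub_one (l : ℕ) (y : ℝ) : SF l (y-1) = SF l y - 1 := by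
  have := SF_add_one l (y-1)
  rw [sub_add_cancel] at this; linarith

theorem SF_le (l : ℕ) (y : ℝ) : SF l y ≤ ⌊y⌋ := by
  unfold SF
  linarith [Real.smoothTransition.le_one (16 ^ (l+1) * Int.fract y)]

theorem SF_ge' (l : ℕ) (y : ℝ) : (⌊y⌋:ℝ) - 1 ≤ SF l y := by
  unfold SF
  linarith [Real.smoothTransition.nonneg (16 ^ (l+1) * Int.fract y)]

theorem SF_ge (l : ℕ) (y : ℝ) : (⌊y - 1 / 16 ^ (l+1)⌋:ℝ) ≤ SF l y := by
  by_cases h : 1 / 16 ^ (l+1) ≤ Int.fract y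
  · have : SF l y = ⌊y⌋ := by
      unfold SF
      rw [Real.smoothTransition.one_of_one_le]
      · ring
      · rwa [div_le_iff₀' (by positivity)] at h
    rw [this]
    exact Int.cast_le.2 (Int.floor_mono (by linarith [show (0:ℝ) < 1 / 16 ^ (l+1) by positivity]))
  · rw [not_le] at h
    refine le_trans ?_ (SF_ge' l y)
    have : ⌊y - 1 / 16 ^ (l+1)⌋ < ⌊y⌋ := by
      rw [Int.floor_lt]
      have := Int.floor_add_fract y
      linarith
    have : ⌊y - 1 / 16 ^ (l+1)⌋ ≤ ⌊y⌋ - 1 := by omega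
    exact_mod_cast this

theorem SF_mono (l : ℕ) : Monotone (SF l) := by
  intro y z h
  have hf := Int.floor_mono h
  rcases hf.eq_or_lt with e | e
  · unfold SF
    rw [Int.fract, Int.fract, e]
    gcongr
    exact st_mono (by gcongr)
  · refine (SF_le l y).trans (le_trans ?_ (SF_ge' l z))
    have : ⌊y⌋ ≤ ⌊z⌋ - 1 := by omega
    exact_mod_cast this

theorem SF_add_int (l : ℕ) (y : ℝ) (k : ℕ) : SF l (y + k) = SF l y + k := by
  induction k with
  | zero => simp
  | succ k ih => push_cast; rw [← add_assoc, SF_add_one, ih]; ring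

noncomputable def ee (l j : ℕ) (y : ℝ) : ℝ := SF l (y - j / 16 ^ l)

noncomputable def rr (l j : ℕ) (y : ℝ) : ℝ := ee (l+1) j y - ee l (j/16) y

theorem ee_cd (l j : ℕ) : ContDiff ℝ 1 (ee l j) := by
  unfold ee
  exact (SF_cd l).comp (contDiff_id.sub contDiff_const)

theorem ee_add_one (l j : ℕ) (y : ℝ) : ee l j (y+1) = ee l j y + 1 := by
  unfold ee; rw [← SF_add_one]; congr 1; ring

theorem ee_deriv {C : ℝ} (hC : ∀ t, |deriv Real.smoothTransition t| ≤ C) (l j : ℕ) (y : ℝ) : |deriv (ee l j) y| ≤ C * 16 ^ (l+1) := by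
  unfold ee
  rw [deriv_comp_sub_const]
  exact SF_deriv hC l _

theorem ee_shift (l j : ℕ) (y : ℝ) : ee l (j + 16 ^ l) y = ee l j y - 1 := by
  unfold ee
  rw [← SF_sub_one]; congr 1; push_cast; field_simp; ring

theorem rr_bd (l j : ℕ) (y : ℝ) : |rr l j y| ≤ (⌊y - (j/16:ℕ) / 16 ^ l⌋:ℝ) - ⌊y - (j/16:ℕ) / 16 ^ l - 1 / 16 ^ l⌋ := by
  have h1 := Nat.div_add_mod' j 16
  have h2 := Nat.mod_lt j (by norm_num : 0 < 16)
  unfold rr ee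
  set u := y - (j/16:ℕ) / 16 ^ l with hu
  set d : ℝ := (j % 16 : ℕ) / 16 ^ (l+1) with hd
  have e : y - j / 16 ^ (l+1) = u - d := by
    have : (j:ℝ) = (j/16:ℕ) * 16 + (j % 16 : ℕ) := by exact_mod_cast h1.symm
    rw [hu, hd, this, pow_succ]; field_simp; ring
  rw [e]
  have d0 : 0 ≤ d := by positivity
  have d1 : d + 1 / 16 ^ (l+2) ≤ 1 / 16 ^ l := by
    have : ((j % 16 : ℕ):ℝ) ≤ 15 := by exact_mod_cast (by omega : j % 16 ≤ 15)
    have q : (0:ℝ) < 16 ^ l := by positivity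
    rw [hd, pow_succ, pow_succ, pow_succ]
    field_simp
    linarith
  have a1 := SF_le (l+1) (u - d)
  have a2 := SF_ge (l+1) (u - d)
  have a3 := SF_le l u
  have a4 := SF_ge l u
  have f1 : (⌊u - d⌋:ℝ) ≤ ⌊u⌋ := by exact Int.cast_le.2 (Int.floor_mono (by linarith))
  have f2 : (⌊u - 1/16^l⌋:ℝ) ≤ ⌊u - d - 1 / 16 ^ (l+1+1)⌋ := by exact Int.cast_le.2 (Int.floor_mono (by linarith))
  have f3 : (⌊u - 1/16^l⌋:ℝ) ≤ ⌊u - 1 / 16 ^ (l+1)⌋ := by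
    have : (1:ℝ) / 16 ^ (l+1) ≤ 1 / 16 ^ l := by
      apply one_div_le_one_div_of_le (by positivity)
      exact pow_le_pow_right₀ (by norm_num) (by omega)
    exact Int.cast_le.2 (Int.floor_mono (by linarith))
  rw [abs_le]; constructor <;> linarith

theorem rr_cls {C : ℝ} (hC1 : 1 ≤ C) (hC : ∀ t, |deriv Real.smoothTransition t| ≤ C) (l j : ℕ) : Cls (272 * C) l (rr l j) := by
  have cd : ContDiff ℝ 1 (rr l j) := (ee_cd _ _).sub (ee_cd _ _)
  have q0 : (0:ℝ) < 1 / 16 ^ l := by positivity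
  have q1 : (1:ℝ) / 16 ^ l ≤ 1 := by
    rw [div_le_one (by positivity)]; exact one_le_pow₀ (by norm_num)
  have per : Function.Periodic (rr l j) 1 := by
    intro y; unfold rr; rw [ee_add_one, ee_add_one]; ring
  have bd : ∀ y, |rr l j y| ≤ 1 := by
    intro y
    refine (rr_bd l j y).trans ?_
    set u := y - (j/16:ℕ) / 16 ^ l
    have : ⌊u⌋ - 1 ≤ ⌊u - 1 / 16 ^ l⌋ := by rw [← Int.floor_sub_one]; exact Int.floor_mono (by linarith)
    have : (⌊u⌋:ℝ) - 1 ≤ ⌊u - 1 / 16 ^ l⌋ := by exact_mod_cast this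
    linarith
  refine ⟨cd, per, bd, ?_, ?_⟩
  · set c : ℝ := (j/16:ℕ) / 16 ^ l with hc
    have pa : Function.Periodic (fun y => |rr l j y|) 1 := fun y => by simp only [per y]
    have ca : Continuous fun y => |rr l j y| := cd.continuous.abs
    have e := pa.intervalIntegral_add_eq 0 c
    rw [zero_add] at e
    rw [e, ← intervalIntegral.integral_add_adjacent_intervals (b := c + 1 / 16 ^ l) (ca.intervalIntegrable _ _) (ca.intervalIntegrable _ _)]
    have i1 : ∫ y in c..(c + 1 / 16 ^ l), |rr l j y| ≤ 1 / 16 ^ l := by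
      have := intervalIntegral.integral_mono_on (a := c) (b := c + 1 / 16 ^ l) (μ := volume) (by linarith)
        (ca.intervalIntegrable _ _) ((continuous_const (y := (1:ℝ))).intervalIntegrable _ _) (fun x _ => bd x)
      simpa using this
    have i2 : ∫ y in (c + 1 / 16 ^ l)..(c+1), |rr l j y| ≤ 0 := by
      rw [intervalIntegral.integral_of_le (by linarith), integral_Ioc_eq_integral_Ioo]
      apply setIntegral_nonpos measurableSet_Ioo
      intro y hy
      refine (rr_bd l j y).trans (le_of_eq ?_)
      rw [← hc]
      have a : ⌊y - c⌋ = 0 := Int.floor_eq_iff.2 ⟨by push_cast; linarith [hy.1], by push_cast; linarith [hy.2]⟩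
      have b : ⌊y - c - 1 / 16 ^ l⌋ = 0 := Int.floor_eq_iff.2 ⟨by push_cast; linarith [hy.1], by push_cast; linarith [hy.2]⟩
      rw [a, b]; simp
    calc _ ≤ 1 / 16 ^ l + 0 := add_le_add i1 i2
      _ ≤ _ := by rw [add_zero]; gcongr; linarith
  · intro y
    have : deriv (rr l j) y = deriv (ee (l+1) j) y - deriv (ee l (j/16)) y :=
      deriv_fun_sub ((ee_cd _ _).differentiable one_ne_zero _) ((ee_cd _ _).differentiable one_ne_zero _)
    rw [this]
    refine (abs_sub _ _).trans ((add_le_add (ee_deriv hC _ _ _) (ee_deriv hC _ _ _)).trans (le_of_eq ?_))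
    ring

theorem ee_chain (l0 d j : ℕ) (y : ℝ) :
    ee (l0 + d) j y = ee l0 (j / 16 ^ d) y + ∑ i ∈ Finset.range d, rr (l0 + i) (j / 16 ^ (d - 1 - i)) y := by
  induction d generalizing j with
  | zero => simp
  | succ d ih =>
    rw [Finset.sum_range_succ]
    have h1 := ih (j / 16)
    have e2 : ee (l0 + (d+1)) j y = ee (l0 + d) (j/16) y + rr (l0 + d) j y := by unfold rr; rw [add_assoc]; ring
    have e3 : ∑ i ∈ Finset.range d, rr (l0 + i) (j / 16 ^ (d + 1 - 1 - i)) y = ∑ i ∈ Finset.range d, rr (l0 + i) (j / 16 / 16 ^ (d - 1 - i)) y := by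
      apply Finset.sum_congr rfl
      intro i hi
      rw [Finset.mem_range] at hi
      have : d + 1 - 1 - i = (d - 1 - i) + 1 := by omega
      rw [Nat.div_div_eq_div_mul, this, pow_succ, mul_comm 16]
    rw [e2, h1, e3, Nat.div_div_eq_div_mul, pow_succ, mul_comm 16]
    simp
    ring

theorem fract_ind {a b : ℝ} (ha : 0 ≤ a) (hab : a ≤ b) (hb : b ≤ 1) (y : ℝ) :
    Set.indicator (Set.Ico a b) (fun _ => (1:ℝ)) (Int.fract y) = (⌊y - a⌋:ℝ) - ⌊y - b⌋ := by
  have h0 := Int.fract_nonneg y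
  have h1 := Int.fract_lt_one y
  have hy := Int.floor_add_fract y
  have key : ∀ c : ℝ, 0 ≤ c → c ≤ 1 → (⌊y - c⌋:ℝ) = ⌊y⌋ - (if Int.fract y < c then 1 else 0) := by
    intro c c0 c1
    split_ifs with h
    · have : ⌊y - c⌋ = ⌊y⌋ - 1 := Int.floor_eq_iff.2 ⟨by push_cast; linarith, by push_cast; linarith⟩
      rw [this]; push_cast; ring
    · have : ⌊y - c⌋ = ⌊y⌋ := Int.floor_eq_iff.2 ⟨by linarith, by linarith⟩
      rw [this]; ring
  rw [key a ha (hab.trans hb), key b (ha.trans hab) hb, Set.indicator_apply]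
  simp only [Set.mem_Ico]
  by_cases c1 : Int.fract y < a
  · have c2 : Int.fract y < b := c1.trans_le hab
    simp [c1, c2]
  · by_cases c2 : Int.fract y < b
    · simp [c1, c2, not_lt.1 c1]
    · simp [c1, c2]

theorem sand_lo (l : ℕ) {a : ℝ} (y : ℝ) : ee l (⌊a * 16 ^ l⌋₊ + 1) y ≤ ⌊y - a⌋ := by
  unfold ee
  refine (SF_le _ _).trans ?_
  have h2 := Nat.lt_floor_add_one (a * 16 ^ l)
  have : a ≤ (⌊a * 16 ^ l⌋₊ + 1 : ℕ) / 16 ^ l := by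
    rw [le_div_iff₀ (by positivity)]; push_cast; exact h2.le
  exact Int.cast_le.2 (Int.floor_mono (by linarith))

theorem sand_up (l : ℕ) {a : ℝ} (ha : 0 ≤ a) (y : ℝ) : (⌊y - a⌋:ℝ) ≤ ee l (⌊a * 16 ^ l⌋₊ + 16 ^ l - 1) y + 1 := by
  have h1 := Nat.floor_le (by positivity : 0 ≤ a * 16 ^ l)
  have p : 1 ≤ 16 ^ l := Nat.one_le_pow _ _ (by norm_num)
  unfold ee
  rw [← SF_add_one]
  refine le_trans ?_ (SF_ge _ _)
  have e : (y:ℝ) - (⌊a * 16 ^ l⌋₊ + 16 ^ l - 1 : ℕ) / 16 ^ l + 1 = y - ⌊a * 16 ^ l⌋₊ / 16 ^ l + 1 / 16 ^ l := by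
    rw [Nat.cast_sub (by omega)]; push_cast; field_simp; ring
  have e2 : (1:ℝ) / 16 ^ (l+1) ≤ 1 / 16 ^ l := by
    apply one_div_le_one_div_of_le (by positivity)
    exact pow_le_pow_right₀ (by norm_num) (by omega)
  have e3 : (⌊a * 16 ^ l⌋₊:ℝ) / 16 ^ l ≤ a := by rwa [div_le_iff₀ (by positivity)]
  rw [e]
  exact Int.cast_le.2 (Int.floor_mono (by linarith))

theorem SF_add_z (l : ℕ) (y : ℝ) (k : ℤ) : SF l (y + k) = SF l y + k := by
  unfold SF
  rw [Int.floor_add_intCast, Int.fract_add_intCast]; push_cast; ring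

theorem ee_int (l i : ℕ) : ∫ y in (0:ℝ)..1, ee l i y = (∫ y in (0:ℝ)..1, SF l y) - i / 16 ^ l := by
  set c : ℝ := i / 16 ^ l with hc
  have cS := SF_cont l
  have per : Function.Periodic (fun y => SF l y - y) 1 := by
    intro y; simp only [SF_add_one]; ring
  have e1 : ∫ y in (0:ℝ)..1, (SF l (y - c) - (y - c)) = ∫ y in (0:ℝ)..1, (SF l y - y) := by
    rw [intervalIntegral.integral_comp_sub_right (fun y => SF l y - y) c]
    have := per.intervalIntegral_add_eq (0 - c) 0
    rw [zero_add] at this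
    rw [← this]; congr 1; ring
  rw [intervalIntegral.integral_sub (Continuous.intervalIntegrable (by fun_prop) _ _) (Continuous.intervalIntegrable (by fun_prop) _ _),
    intervalIntegral.integral_sub (Continuous.intervalIntegrable (by fun_prop) _ _) (Continuous.intervalIntegrable (by fun_prop) _ _),
    intervalIntegral.integral_sub (Continuous.intervalIntegrable (by fun_prop) _ _) (Continuous.intervalIntegrable (by fun_prop) _ _)] at e1
  simp at e1
  have e3 := intervalIntegral.integral_comp_sub_right (a := 0) (b := 1) (SF l) c
  rw [zero_sub] at e3
  unfold ee
  rw [← hc]; linarith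

theorem ee_mean (l i i' : ℕ) : ∫ y in (0:ℝ)..1, (ee l i y - ee l i' y) = ((i':ℝ) - i) / 16 ^ l := by
  rw [intervalIntegral.integral_sub ((ee_cd l i).continuous.intervalIntegrable _ _) ((ee_cd l i').continuous.intervalIntegrable _ _), ee_int, ee_int]
  ring

noncomputable def bb (l i i' : ℕ) : ℝ → ℝ := cen (fun y => ee l i y - ee l i' y)

theorem bb_eq (l i i' : ℕ) (y : ℝ) : bb l i i' y = ee l i y - ee l i' y - ((i':ℝ) - i) / 16 ^ l := by
  unfold bb cen; rw [ee_mean]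

theorem ed_cd (l i i' : ℕ) : ContDiff ℝ 1 (fun y => ee l i y - ee l i' y) := (ee_cd l i).sub (ee_cd l i')

theorem ed_per (l i i' : ℕ) : Function.Periodic (fun y => ee l i y - ee l i' y) 1 := by
  intro y; simp only [ee_add_one]; ring

theorem ed_range (l i i' : ℕ) : ∃ k : ℝ, ∀ y, k ≤ ee l i y - ee l i' y ∧ ee l i y - ee l i' y ≤ k + 1 := by
  set t : ℝ := ((i':ℝ) - i) / 16 ^ l with ht
  refine ⟨⌊t⌋, fun y => ?_⟩
  have e : ee l i y = SF l (y - i' / 16 ^ l + t) := by unfold ee; congr 1; rw [ht]; ring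
  have e' : ee l i' y = SF l (y - i' / 16 ^ l) := rfl
  rw [e, e']
  set u := y - i' / 16 ^ l
  have h1 := SF_mono l (by linarith [Int.floor_le t] : u + ⌊t⌋ ≤ u + t)
  have h2 := SF_mono l (by push_cast; linarith [Int.lt_floor_add_one t] : u + t ≤ u + (⌊t⌋ + 1 : ℤ))
  rw [SF_add_z] at h1 h2
  push_cast at h2
  constructor <;> linarith

theorem range_facts {f : ℝ → ℝ} {k : ℝ} (cf : Continuous f) (h : ∀ y, k ≤ f y ∧ f y ≤ k + 1) :
    (∀ y, |cen f y| ≤ 1) ∧ ∫ y in (0:ℝ)..1, cen f y ^ 2 ≤ 1/4 := by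
  set m := ∫ u in (0:ℝ)..1, f u with hm
  have m1 : k ≤ m := by
    have := intervalIntegral.integral_mono_on (a := (0:ℝ)) (b := 1) (μ := volume) zero_le_one
      ((continuous_const (y := k)).intervalIntegrable _ _) (cf.intervalIntegrable _ _) (fun x _ => (h x).1)
    simpa using this
  have m2 : m ≤ k + 1 := by
    have := intervalIntegral.integral_mono_on (a := (0:ℝ)) (b := 1) (μ := volume) zero_le_one
      (cf.intervalIntegrable _ _) ((continuous_const (y := k + 1)).intervalIntegrable _ _) (fun x _ => (h x).2)
    simpa using this
  have e : ∀ y, cen f y = f y - m := fun y => rfl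
  constructor
  · intro y; rw [e, abs_le]; constructor <;> linarith [(h y).1, (h y).2]
  · set p := m - k with hp
    have pt : ∀ y, cen f y ^ 2 ≤ (1 - 2 * p) * (f y - m) + p * (1 - p) := by
      intro y
      rw [e]
      have := mul_nonneg (sub_nonneg.2 (h y).1) (sub_nonneg.2 (h y).2)
      have e2 : f y - k = (f y - m) + p := by rw [hp]; ring
      have e3 : k + 1 - f y = 1 - p - (f y - m) := by rw [hp]; ring
      rw [e2, e3] at this
      nlinarith
    have := intervalIntegral.integral_mono_on (a := (0:ℝ)) (b := 1) (μ := volume) zero_le_one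
      ((by unfold cen; fun_prop : Continuous fun y => cen f y ^ 2).intervalIntegrable _ _)
      ((by fun_prop : Continuous fun y => (1 - 2 * p) * (f y - m) + p * (1 - p)).intervalIntegrable _ _) (fun x _ => pt x)
    refine this.trans ?_
    rw [intervalIntegral.integral_add (Continuous.intervalIntegrable (by fun_prop) _ _) (Continuous.intervalIntegrable (by fun_prop) _ _),
      intervalIntegral.integral_const_mul, intervalIntegral.integral_sub (cf.intervalIntegrable _ _) (Continuous.intervalIntegrable (by fun_prop) _ _), ← hm]
    simp
    nlinarith [sq_nonneg (p - 1/2)]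

theorem bb_facts {C : ℝ} (hC : ∀ t, |deriv Real.smoothTransition t| ≤ C) (l i i' : ℕ) :
    ContDiff ℝ 1 (bb l i i') ∧ Function.Periodic (bb l i i') 1 ∧ (∫ y in (0:ℝ)..1, bb l i i' y = 0) ∧
    (∀ y, |bb l i i' y| ≤ 1) ∧ (∀ y, |deriv (bb l i i') y| ≤ 2 * C * 16 ^ (l+1)) ∧ ∫ y in (0:ℝ)..1, bb l i i' y ^ 2 ≤ 1/4 := by
  obtain ⟨p1, p2, p3, p4⟩ := cen_props (ed_cd l i i') (ed_per l i i')
  obtain ⟨k, hk⟩ := ed_range l i i'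
  obtain ⟨q1, q2⟩ := range_facts (ed_cd l i i').continuous hk
  refine ⟨p1, p2, p3, q1, ?_, q2⟩
  intro y
  unfold bb
  rw [p4]
  have : deriv (fun y => ee l i y - ee l i' y) y = deriv (ee l i) y - deriv (ee l i') y :=
      deriv_fun_sub ((ee_cd _ _).differentiable one_ne_zero _) ((ee_cd _ _).differentiable one_ne_zero _)
  rw [this]
  refine (abs_sub _ _).trans ((add_le_add (ee_deriv hC _ _ _) (ee_deriv hC _ _ _)).trans (le_of_eq ?_))
  ring

theorem bb_cls {C : ℝ} (hC1 : 1 ≤ C) (hC : ∀ t, |deriv Real.smoothTransition t| ≤ C) (l i i' : ℕ) :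
    Cls (2 * C * 16 ^ (l+1)) 0 (bb l i i') ∧ cen (bb l i i') = bb l i i' := by
  obtain ⟨p1, p2, p3, p4, p5, p6⟩ := bb_facts hC l i i'
  refine ⟨⟨p1, p2, p4, ?_, by simpa using p5⟩, ?_⟩
  · refine (int_le_one p1.continuous.abs p4).trans ?_
    have : (1:ℝ) ≤ 16 ^ (l+1) := one_le_pow₀ (by norm_num)
    rw [pow_zero, div_one]; nlinarith
  · ext y; unfold cen; rw [p3, sub_zero]

theorem rr_mean (l j : ℕ) : ∃ c : ℝ, ∀ y, cen (rr l j) y = rr l j y - c := ⟨_, fun _ => rfl⟩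

theorem cen_rr (l j : ℕ) (y : ℝ) : cen (rr l j) y = ee (l+1) j y - ee l (j/16) y - ((∫ u in (0:ℝ)..1, ee (l+1) j u) - ∫ u in (0:ℝ)..1, ee l (j/16) u) := by
  unfold cen rr
  rw [intervalIntegral.integral_sub ((ee_cd _ _).continuous.intervalIntegrable _ _) ((ee_cd _ _).continuous.intervalIntegrable _ _)]

theorem cee_chain (l0 d j : ℕ) (y : ℝ) :
    cen (ee (l0 + d) j) y = cen (ee l0 (j / 16 ^ d)) y + ∑ i ∈ Finset.range d, cen (rr (l0 + i) (j / 16 ^ (d - 1 - i))) y := by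
  have e := ee_chain l0 d j y
  have e2 : ∫ u in (0:ℝ)..1, ee (l0 + d) j u = (∫ u in (0:ℝ)..1, ee l0 (j / 16 ^ d) u) + ∑ i ∈ Finset.range d, ∫ u in (0:ℝ)..1, rr (l0 + i) (j / 16 ^ (d - 1 - i)) u := by
    have cr : ∀ l j, Continuous (rr l j) := fun l j => ((ee_cd _ _).sub (ee_cd _ _)).continuous
    rw [← intervalIntegral.integral_finsetSum (fun i _ => (cr _ _).intervalIntegrable _ _), ← intervalIntegral.integral_add ((ee_cd _ _).continuous.intervalIntegrable _ _)]
    · congr 1; ext u; exact ee_chain l0 d j u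
    · apply Continuous.intervalIntegrable
      exact continuous_finsetSum _ fun i _ => cr _ _
  unfold cen
  rw [e, e2, Finset.sum_sub_distrib]; ring

theorem bb_cen (l i i' : ℕ) (y : ℝ) : bb l i i' y = cen (ee l i) y - cen (ee l i') y := by
  unfold bb cen
  rw [intervalIntegral.integral_sub ((ee_cd _ _).continuous.intervalIntegrable _ _) ((ee_cd _ _).continuous.intervalIntegrable _ _)]
  ring

theorem geo_tail (l0 d : ℕ) : ∑ i ∈ Finset.range d, (2/3:ℝ) ^ (l0 + i) ≤ 3 * (2/3) ^ l0 := by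
  have : ∑ i ∈ Finset.range d, (2/3:ℝ) ^ (l0 + i) = 3 * (2/3) ^ l0 - 3 * (2/3) ^ (l0 + d) := by
    induction d with
    | zero => simp
    | succ d ih => rw [Finset.sum_range_succ, ih, ← add_assoc, pow_succ]; ring
  rw [this]
  have : (0:ℝ) ≤ (2/3) ^ (l0 + d) := by positivity
  linarith

theorem chain_bd {z : ℕ → ℝ} {s : Finset ℕ} {T : ℝ} (hT : 0 ≤ T) (l0 d : ℕ)
    (h : ∀ l, l0 ≤ l → l < l0 + d → ∀ j < 48 * 16 ^ l, |∑ n ∈ s, cen (rr l j) (z n)| ≤ T * (2/3) ^ l)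
    (j : ℕ) (hj : j < 3 * 16 ^ (l0 + d)) :
    |(∑ n ∈ s, cen (ee (l0 + d) j) (z n)) - ∑ n ∈ s, cen (ee l0 (j / 16 ^ d)) (z n)| ≤ 3 * T * (2/3) ^ l0 := by
  have e : (∑ n ∈ s, cen (ee (l0 + d) j) (z n)) - ∑ n ∈ s, cen (ee l0 (j / 16 ^ d)) (z n) =
      ∑ i ∈ Finset.range d, ∑ n ∈ s, cen (rr (l0 + i) (j / 16 ^ (d - 1 - i))) (z n) := by
    rw [Finset.sum_comm, ← Finset.sum_sub_distrib]
    apply Finset.sum_congr rfl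
    intro n _
    rw [cee_chain]; ring
  rw [e]
  refine (Finset.abs_sum_le_sum_abs _ _).trans ((Finset.sum_le_sum (g := fun i => T * (2/3) ^ (l0 + i)) fun i hi => ?_).trans ?_)
  · rw [Finset.mem_range] at hi
    apply h _ (by omega) (by omega)
    rw [Nat.div_lt_iff_lt_mul (by positivity)]
    refine hj.trans_le (le_of_eq ?_)
    rw [mul_assoc, ← pow_add, show l0 + d = (l0 + i + (d - 1 - i)) + 1 by omega, pow_succ]
    ring
  · rw [← Finset.mul_sum]
    have := mul_le_mul_of_nonneg_left (geo_tail l0 d) hT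
    linarith

theorem bb_chain {z : ℕ → ℝ} {s : Finset ℕ} {T : ℝ} (hT : 0 ≤ T) (l0 d : ℕ)
    (h : ∀ l, l0 ≤ l → l < l0 + d → ∀ j < 48 * 16 ^ l, |∑ n ∈ s, cen (rr l j) (z n)| ≤ T * (2/3) ^ l)
    (j j' : ℕ) (hj : j < 3 * 16 ^ (l0 + d)) (hj' : j' < 3 * 16 ^ (l0 + d)) :
    |(∑ n ∈ s, bb (l0 + d) j j' (z n)) - ∑ n ∈ s, bb l0 (j / 16 ^ d) (j' / 16 ^ d) (z n)| ≤ 6 * T * (2/3) ^ l0 := by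
  have h1 := chain_bd hT l0 d h j hj
  have h2 := chain_bd hT l0 d h j' hj'
  simp only [bb_cen, Finset.sum_sub_distrib]
  rw [abs_le] at *
  constructor <;> linarith

theorem disc_up {z : ℕ → ℝ} {s : Finset ℕ} (L : ℕ) {a b X : ℝ} (ha : 0 ≤ a) (hab : a ≤ b) (hb : b ≤ 1)
    (h : ∀ j < 3 * 16 ^ L, ∀ j' < 3 * 16 ^ L, |∑ n ∈ s, bb L j j' (z n)| ≤ X) :
    |∑ n ∈ s, Set.indicator (Set.Ico a b) (fun _ => (1:ℝ)) (Int.fract (z n)) - s.card * (b - a)| ≤ X + 3 * s.card / 16 ^ L := by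
  simp only [fract_ind ha hab hb]
  have p : 1 ≤ 16 ^ L := Nat.one_le_pow _ _ (by norm_num)
  have q0 : (0:ℝ) < 16 ^ L := by positivity
  have fl : ∀ c : ℝ, c ≤ 1 → ⌊c * 16 ^ L⌋₊ ≤ 16 ^ L := by
    intro c hc
    apply Nat.floor_le_of_le
    push_cast; nlinarith
  have fa := fl a (hab.trans hb)
  have fb := fl b hb
  have a1 := Nat.floor_le (by positivity : 0 ≤ a * 16 ^ L)
  have b1 := Nat.floor_le (mul_nonneg (ha.trans hab) q0.le : 0 ≤ b * 16 ^ L)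
  have a2 := Nat.lt_floor_add_one (a * 16 ^ L)
  have b2 := Nat.lt_floor_add_one (b * 16 ^ L)
  have hu := h (⌊a * 16 ^ L⌋₊ + 16 ^ L - 1) (by omega) (⌊b * 16 ^ L⌋₊ + 1) (by omega)
  have hl := h (⌊a * 16 ^ L⌋₊ + 1) (by omega) (⌊b * 16 ^ L⌋₊ + 16 ^ L - 1) (by omega)
  have su : ∑ n ∈ s, ((⌊z n - a⌋:ℝ) - ⌊z n - b⌋) ≤ ∑ n ∈ s, (bb L (⌊a * 16 ^ L⌋₊ + 16 ^ L - 1) (⌊b * 16 ^ L⌋₊ + 1) (z n) + ((b - a) + 3 / 16 ^ L)) := by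
    apply Finset.sum_le_sum
    intro n _
    have u1 := sand_up L ha (z n)
    have u2 := sand_lo L (a := b) (z n)
    rw [bb_eq, Nat.cast_sub (by omega)]
    have : ((⌊b * 16 ^ L⌋₊ + 1 : ℕ) - (((⌊a * 16 ^ L⌋₊ + 16 ^ L : ℕ):ℝ) - (1:ℕ))) / 16 ^ L + 1 ≤ (b - a) + 3 / 16 ^ L := by
      push_cast
      rw [← sub_nonneg]
      have : (b - a) + 3 / 16 ^ L - ((⌊b * 16 ^ L⌋₊ + 1 - ((⌊a * 16 ^ L⌋₊ + 16 ^ L:ℝ) - 1)) / 16 ^ L + 1) =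
        ((b * 16 ^ L - ⌊b * 16 ^ L⌋₊) + (⌊a * 16 ^ L⌋₊ + 1 - a * 16 ^ L)) / 16 ^ L := by field_simp; ring
      rw [this]
      apply div_nonneg _ q0.le
      linarith
    linarith
  have sl : ∑ n ∈ s, (bb L (⌊a * 16 ^ L⌋₊ + 1) (⌊b * 16 ^ L⌋₊ + 16 ^ L - 1) (z n) + ((b - a) - 3 / 16 ^ L)) ≤ ∑ n ∈ s, ((⌊z n - a⌋:ℝ) - ⌊z n - b⌋) := by
    apply Finset.sum_le_sum
    intro n _
    have u1 := sand_up L (ha.trans hab) (z n)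
    have u2 := sand_lo L (a := a) (z n)
    rw [bb_eq, Nat.cast_sub (by omega)]
    have : (b - a) - 3 / 16 ^ L ≤ ((((⌊b * 16 ^ L⌋₊ + 16 ^ L : ℕ):ℝ) - (1:ℕ)) - (⌊a * 16 ^ L⌋₊ + 1 : ℕ)) / 16 ^ L - 1 := by
      push_cast
      rw [← sub_nonneg]
      have : ((⌊b * 16 ^ L⌋₊ + 16 ^ L:ℝ) - 1 - (⌊a * 16 ^ L⌋₊ + 1)) / 16 ^ L - 1 - ((b - a) - 3 / 16 ^ L) =
        ((⌊b * 16 ^ L⌋₊ + 1 - b * 16 ^ L) + (a * 16 ^ L - ⌊a * 16 ^ L⌋₊)) / 16 ^ L := by field_simp; ring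
      rw [this]
      apply div_nonneg _ q0.le
      linarith
    linarith
  rw [Finset.sum_add_distrib] at su sl
  simp only [Finset.sum_const, nsmul_eq_mul] at su sl
  have e : 3 * (s.card:ℝ) / 16 ^ L = s.card * (3 / 16 ^ L) := by ring
  rw [abs_le] at *
  rw [e]
  constructor <;> linarith

theorem half_lo {z : ℕ → ℝ} {s : Finset ℕ} (m : ℕ) :
    ∑ n ∈ s, bb (m+1) 1 (24 * 16 ^ m - 1) (z n) - 3 * s.card / 16 ^ (m+1) ≤
    ∑ n ∈ s, Set.indicator (Set.Ico 0 (1/2)) (fun _ => (1:ℝ)) (Int.fract (z n)) - s.card * (1/2) := by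
  simp only [fract_ind le_rfl (by norm_num : (0:ℝ) ≤ 1/2) (by norm_num)]
  have p : 1 ≤ 16 ^ m := Nat.one_le_pow _ _ (by norm_num)
  have fh : ⌊(1/2:ℝ) * 16 ^ (m+1)⌋₊ = 8 * 16 ^ m := by
    have : (1/2:ℝ) * 16 ^ (m+1) = (8 * 16 ^ m : ℕ) := by push_cast; ring
    rw [this, Nat.floor_natCast]
  have sl : ∑ n ∈ s, (bb (m+1) 1 (24 * 16 ^ m - 1) (z n) + (1/2 - 3 / 16 ^ (m+1))) ≤ ∑ n ∈ s, ((⌊z n - 0⌋:ℝ) - ⌊z n - 1/2⌋) := by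
    apply Finset.sum_le_sum
    intro n _
    have u1 := sand_up (m+1) (by norm_num : (0:ℝ) ≤ 1/2) (z n)
    have u2 := sand_lo (m+1) (a := 0) (z n)
    rw [fh, show 8 * 16 ^ m + 16 ^ (m+1) - 1 = 24 * 16 ^ m - 1 by rw [pow_succ]; omega] at u1
    simp only [zero_mul, Nat.floor_zero, zero_add] at u2
    rw [bb_eq, Nat.cast_sub (by omega)]
    have : (((24 * 16 ^ m : ℕ):ℝ) - (1:ℕ) - (1:ℕ)) / 16 ^ (m+1) = 3/2 - 2 / 16 ^ (m+1) := by
      push_cast; rw [pow_succ]; field_simp; ring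
    have : (0:ℝ) < 1 / 16 ^ (m+1) := by positivity
    have : (3:ℝ) / 16 ^ (m+1) = 2 / 16 ^ (m+1) + 1 / 16 ^ (m+1) := by ring
    linarith
  rw [Finset.sum_add_distrib] at sl
  simp only [Finset.sum_const, nsmul_eq_mul] at sl
  have e : 3 * (s.card:ℝ) / 16 ^ (m+1) = s.card * (3 / 16 ^ (m+1)) := by ring
  rw [e]
  linarith

theorem half_div (m d : ℕ) : (24 * 16 ^ (m+d) - 1) / 16 ^ d = 24 * 16 ^ m - 1 := by
  have p : 1 ≤ 16 ^ m := Nat.one_le_pow _ _ (by norm_num)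
  have p' : 1 ≤ 16 ^ d := Nat.one_le_pow _ _ (by norm_num)
  rw [Nat.div_eq_iff (by omega)]
  have e : 24 * 16 ^ (m+d) = (24 * 16 ^ m - 1) * 16 ^ d + 16 ^ d := by
    have : 24 * 16 ^ m = (24 * 16 ^ m - 1) + 1 := by omega
    rw [pow_add, ← mul_assoc]
    conv_lhs => rw [this]
    ring
  omega

/-- variance lower bound -/
theorem half_var (m : ℕ) : 1/4 - 2 / 16 ^ (m+1) ≤ ∫ y in (0:ℝ)..1, bb (m+1) 0 (24 * 16 ^ m - 1) y ^ 2 := by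
  have p : 1 ≤ 16 ^ m := Nat.one_le_pow _ _ (by norm_num)
  set q : ℝ := 1 / 16 ^ (m+1) with hq
  have q0 : 0 < q := by positivity
  have q1 : q ≤ 1/16 := by
    apply one_div_le_one_div_of_le (by norm_num)
    calc (16:ℝ) = 16 ^ 1 := by norm_num
      _ ≤ _ := pow_le_pow_right₀ (by norm_num) (by omega)
  set ε : ℝ := 1 / 16 ^ (m+1+1) with hε
  have ε0 : 0 < ε := by positivity
  have εq : ε = q / 16 := by rw [hε, hq, pow_succ (16:ℝ) (m+1)]; field_simp
  set t := 1/2 - q with ht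
  have cast : ((24 * 16 ^ m - 1 : ℕ):ℝ) / 16 ^ (m+1) = 3/2 - q := by
    rw [Nat.cast_sub (by omega)]; push_cast; rw [hq, pow_succ]; field_simp; ring
  have f : ∀ y, bb (m+1) 0 (24 * 16 ^ m - 1) y = SF (m+1) y - SF (m+1) (y - t) - t := by
    intro y
    rw [bb_eq]
    unfold ee
    rw [sub_div, cast]
    have : y - (3/2 - q) = (y - t) - 1 := by rw [ht]; ring
    rw [this, SF_sub_one]; simp; rw [ht]; ring
  have cb : Continuous fun y => bb (m+1) 0 (24 * 16 ^ m - 1) y ^ 2 := by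
    have := SF_cont (m+1)
    simp only [f]; fun_prop
  have v1 : ∀ y ∈ Set.Ioo ε t, (1 - t) ^ 2 ≤ bb (m+1) 0 (24 * 16 ^ m - 1) y ^ 2 := by
    intro y hy
    rw [f]
    have a1 := SF_ge (m+1) y
    have a2 : ⌊y - 1 / 16 ^ (m+1+1)⌋ = 0 := Int.floor_eq_iff.2 ⟨by rw [← hε]; push_cast; linarith [hy.1], by rw [← hε]; push_cast; linarith [hy.2]⟩
    have a3 := SF_le (m+1) (y - t)
    have a4 : ⌊y - t⌋ = -1 := Int.floor_eq_iff.2 ⟨by push_cast; linarith [hy.1], by push_cast; linarith [hy.2]⟩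
    rw [a2] at a1; rw [a4] at a3
    push_cast at a1 a3
    apply pow_le_pow_left₀ <;> linarith
  have v2 : ∀ y ∈ Set.Ioo (t + ε) 1, t ^ 2 ≤ bb (m+1) 0 (24 * 16 ^ m - 1) y ^ 2 := by
    intro y hy
    rw [f]
    have a1 := SF_ge (m+1) (y - t)
    have a2 : ⌊y - t - 1 / 16 ^ (m+1+1)⌋ = 0 := Int.floor_eq_iff.2 ⟨by rw [← hε]; push_cast; linarith [hy.1], by rw [← hε]; push_cast; linarith [hy.2]⟩
    have a3 := SF_le (m+1) y
    have a4 : ⌊y⌋ = 0 := Int.floor_eq_iff.2 ⟨by push_cast; linarith [hy.1], by push_cast; linarith [hy.2]⟩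
    rw [a2] at a1; rw [a4] at a3
    push_cast at a1 a3
    rw [← neg_sq (SF (m+1) y - SF (m+1) (y - t) - t)]
    apply pow_le_pow_left₀ <;> linarith
  have ii : ∀ a b, IntervalIntegrable (fun y => bb (m+1) 0 (24 * 16 ^ m - 1) y ^ 2) volume a b := fun a b => cb.intervalIntegrable a b
  have low : ∀ a b c : ℝ, a ≤ b → (∀ y ∈ Set.Ioo a b, c ≤ bb (m+1) 0 (24 * 16 ^ m - 1) y ^ 2) → (b - a) * c ≤ ∫ y in a..b, bb (m+1) 0 (24 * 16 ^ m - 1) y ^ 2 := by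
    intro a b c hab h
    have := intervalIntegral.integral_mono_on_of_le_Ioo (μ := volume) hab ((continuous_const (y := c)).intervalIntegrable _ _) (ii a b) h
    simpa using this
  have l1 := low 0 ε 0 ε0.le (fun y _ => sq_nonneg _)
  have l2 := low ε t _ (by linarith) v1
  have l3 := low t (t + ε) 0 (by linarith) (fun y _ => sq_nonneg _)
  have l4 := low (t + ε) 1 _ (by linarith) v2
  rw [← intervalIntegral.integral_add_adjacent_intervals (ii 0 (t+ε)) (ii (t+ε) 1),
    ← intervalIntegral.integral_add_adjacent_intervals (ii 0 t) (ii t (t+ε)),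
    ← intervalIntegral.integral_add_adjacent_intervals (ii 0 ε) (ii ε t)]
  have e2 : (2:ℝ) / 16 ^ (m+1) = 2 * q := by rw [hq]; ring
  rw [e2]
  have key : 1/4 - 2 * q ≤ (t - ε) * (1 - t) ^ 2 + (1 - (t + ε)) * t ^ 2 := by
    have e : (t - ε) * (1 - t) ^ 2 + (1 - (t + ε)) * t ^ 2 = 1/4 - q ^ 2 - q / 16 * (1/2 + 2 * q ^ 2) := by
      rw [εq, ht]; ring
    have q2 : q ^ 2 ≤ q / 16 := by nlinarith
    have : q / 16 * (1/2 + 2 * q ^ 2) ≤ q / 16 * (1/2 + 2) := by gcongr; nlinarith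
    rw [e]; linarith
  linarith

theorem bc_sum_p {μ : Measure ℝ} {E : ℕ → Set ℝ} {c p : ℝ} (hp : 1 < p)
    (h : ∀ᶠ k : ℕ in atTop, μ (E k) ≤ ENNReal.ofReal (c * ((k:ℝ) ^ p)⁻¹)) : ∀ᵐ x ∂μ, ∀ᶠ k in atTop, x ∉ E k := by
  obtain ⟨k0, h⟩ := h.exists_forall_of_atTop
  have s1 : Summable fun k : ℕ => c * ((k:ℝ) ^ p)⁻¹ :=
    (Real.summable_nat_rpow_inv.2 hp).mul_left c
  have : ∑' k, μ (if k0 ≤ k then E k else ∅) ≠ ⊤ := by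
    refine ne_top_of_le_ne_top s1.tsum_ofReal_ne_top (ENNReal.tsum_le_tsum fun k => ?_)
    split_ifs with hk
    · exact h k hk
    · simp
  filter_upwards [ae_eventually_notMem this] with x hx
  filter_upwards [hx, eventually_ge_atTop k0] with k hk hk0
  simpa [hk0] using hk

theorem ev_big (c : ℝ) : ∀ᶠ κ : ℕ in atTop, c * (κ:ℝ) ^ 2 ≤ 16 ^ κ := by
  have t1 := (tendsto_pow_const_div_const_pow_of_one_lt 2 (by norm_num : (1:ℝ) < 16)).const_mul c
  rw [mul_zero] at t1
  filter_upwards [t1.eventually_le_const one_pos] with κ hκ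
  rw [← mul_div_assoc, div_le_one (by positivity)] at hκ
  exact hκ

theorem sum_split {ξ x : ℝ} {f : ℝ → ℝ} (f1 : ∀ y, |f y| ≤ 1) {M N L : ℕ} (hL : 1 ≤ L) (hMN : M ≤ N) :
    |∑ n ∈ Finset.Ioc 0 N, f (ξ * x ^ n) - ∑ n ∈ Finset.Ioc M (M + (N - M) / L * L), f (ξ * x ^ n)| ≤ M + L := by
  have h1 := Nat.div_add_mod' (N - M) L
  have h2 := Nat.mod_lt (N - M) hL
  set q := (N - M) / L
  rw [← Finset.sum_Ioc_consecutive _ (Nat.zero_le M) hMN,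
    ← Finset.sum_Ioc_consecutive _ (by omega : M ≤ M + q * L) (by omega : M + q * L ≤ N)]
  have b : ∀ a c : ℕ, |∑ n ∈ Finset.Ioc a c, f (ξ * x ^ n)| ≤ (c - a : ℕ) := by
    intro a c
    refine (Finset.abs_sum_le_sum_abs _ _).trans ((Finset.sum_le_sum fun i _ => f1 _).trans ?_)
    simp
  have b1 := b 0 M
  have b2 := b (M + q * L) N
  have b3 : ((N - (M + q * L) : ℕ):ℝ) ≤ L := by exact_mod_cast (by omega)
  rw [Nat.sub_zero] at b1
  rw [abs_le] at *
  constructor <;> linarith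

theorem sharp_one {ξ A0 B0 x0 F ε : ℝ} (hξ : 0 < ξ) (hA0 : 1 < A0) (hB0 : A0 ≤ B0) (hx : Transcendental ℤ x0) {f : ℝ → ℝ}
    (hf : ContDiff ℝ 1 f) (pf : Function.Periodic f 1) (m0 : ∫ y in (0:ℝ)..1, f y = 0) (f1 : ∀ y, |f y| ≤ 1)
    (hF : ∀ y, |deriv f y| ≤ F) (hV : ∫ y in (0:ℝ)..1, f y ^ 2 ≤ 1/4) (hε : 0 < ε) (hε1 : ε ≤ 1) :
    ∃ r > (0:ℝ), ∀ A B : ℝ, A0 ≤ A → A ≤ B → B ≤ B0 → x0 - r ≤ A → B ≤ x0 + r → ∀ s0 m : ℕ, 1 ≤ m → m < 16 ^ s0 →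
      ∀ᵐ x ∂(volume.restrict (Set.Ioc A B)), ∀ᶠ κ : ℕ in atTop,
        ∑ n ∈ Finset.Ioc 0 (m * 16 ^ (4 * κ - s0)), f (ξ * x ^ n) ≤ (1 + ε) * Real.sqrt (1/2 * (m * 16 ^ (4 * κ - s0)) * Real.log κ) := by
  obtain ⟨r, hr, L, hL, lam0, hl0, n0, C, hC, key⟩ := mgf hξ hA0 hB0 hx hf pf m0 f1 hF (by positivity : 0 < ε / 8) (by linarith) rfl
  refine ⟨r, hr, fun A B hA hAB hB hrA hrB s0 m hm hms => ?_⟩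
  obtain ⟨K, hK⟩ := pow_unbounded_of_one_lt (256:ℝ) hA0
  have K0 : 1 ≤ K := by
    rcases Nat.eq_zero_or_pos K with h | h
    · subst h; norm_num at hK
    · exact h
  set V := ∫ y in (0:ℝ)..1, f y ^ 2 with hVd
  have V0 : 0 ≤ V := intervalIntegral.integral_nonneg zero_le_one fun x _ => sq_nonneg _
  have i0 : 0 < A0⁻¹ := by positivity
  have i1 : A0⁻¹ < 1 := inv_lt_one_of_one_lt₀ hA0
  set NN : ℕ → ℕ := fun κ => m * 16 ^ (4 * κ - s0) with hNN
  set t : ℕ → ℝ := fun κ => (1 + ε / 2) * Real.sqrt (1/2 * NN κ * Real.log κ) with ht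
  set S : ℕ → ℝ → ℝ := fun κ x => ∑ n ∈ Finset.Ioc (K * κ) (K * κ + (NN κ - K * κ) / L * L), f (ξ * x ^ n) with hS
  have ev : ∀ᶠ κ : ℕ in atTop, 1 ≤ Real.log κ ∧ (16:ℝ) ^ (3 * κ) ≤ NN κ ∧ (NN κ : ℝ) ≤ 16 ^ (4 * κ) ∧
      8 * Real.log κ ≤ lam0 ^ 2 * NN κ ∧ (K * κ + L : ℝ) ≤ ε / 2 * Real.sqrt (1/2 * NN κ * Real.log κ) ∧ n0 ≤ K * κ ∧ K * κ ≤ NN κ := by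
    filter_upwards [(Real.tendsto_log_atTop.comp tendsto_natCast_atTop_atTop).eventually_ge_atTop 1, eventually_ge_atTop s0,
      ev_big (8 / lam0 ^ 2), ev_big ((K + L) * (4 / ε)), ev_big K, eventually_ge_atTop n0, eventually_ge_atTop 1] with κ lg1 hs e1 e2 e3 hn0 κ1
    simp only [Function.comp] at lg1
    have κ1' : (1:ℝ) ≤ κ := by exact_mod_cast κ1
    have κκ : (κ:ℝ) ≤ κ ^ 2 := by nlinarith
    have n1 : (16:ℝ) ^ (3 * κ) ≤ NN κ := by
      have : 16 ^ (3 * κ) ≤ NN κ := by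
        rw [hNN]
        calc 16 ^ (3 * κ) ≤ 16 ^ (4 * κ - s0) := Nat.pow_le_pow_right (by norm_num) (by omega)
          _ ≤ _ := Nat.le_mul_of_pos_left _ hm
      exact_mod_cast this
    have n2 : (NN κ:ℝ) ≤ 16 ^ (4 * κ) := by
      have : NN κ ≤ 16 ^ (4 * κ) := by
        rw [hNN]
        calc m * 16 ^ (4 * κ - s0) ≤ 16 ^ s0 * 16 ^ (4 * κ - s0) := by gcongr
          _ = _ := by rw [← pow_add]; congr 1; omega
      exact_mod_cast this
    have lgκ : Real.log κ ≤ κ := Real.log_le_self (Nat.cast_nonneg _)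
    have p3 : (16:ℝ) ^ κ ≤ NN κ := (pow_le_pow_right₀ (by norm_num) (by omega)).trans n1
    have p2 : ((16:ℝ) ^ κ) ^ 2 ≤ NN κ := by
      rw [← pow_mul]; exact (pow_le_pow_right₀ (by norm_num) (by omega)).trans n1
    refine ⟨lg1, n1, n2, ?_, ?_, ?_, ?_⟩
    · rw [div_mul_eq_mul_div, div_le_iff₀ (by positivity)] at e1
      have := mul_le_mul_of_nonneg_right p3 (sq_nonneg lam0)
      nlinarith
    · have h1 : (16:ℝ) ^ κ / 2 ≤ Real.sqrt (1/2 * NN κ * Real.log κ) := by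
        apply Real.le_sqrt_of_sq_le
        have : (NN κ:ℝ) * 1 ≤ NN κ * Real.log κ := by gcongr
        nlinarith
      have h2 : (K * κ + L:ℝ) ≤ (K + L) * κ ^ 2 := by
        have : (K:ℝ) * κ ≤ K * κ ^ 2 := by gcongr
        have : (L:ℝ) * 1 ≤ L * κ ^ 2 := by gcongr; linarith
        linarith
      calc (K * κ + L:ℝ) ≤ (K + L) * κ ^ 2 := h2
        _ = ε / 4 * ((K + L) * (4 / ε) * κ ^ 2) := by field_simp
        _ ≤ ε / 4 * 16 ^ κ := by gcongr
        _ = ε / 2 * (16 ^ κ / 2) := by ring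
        _ ≤ _ := by gcongr
    · calc n0 ≤ κ := hn0
        _ ≤ _ := Nat.le_mul_of_pos_left _ K0
    · have : (K * κ:ℝ) ≤ NN κ := by
        have : (K:ℝ) * κ ≤ K * κ ^ 2 := by gcongr
        linarith
      exact_mod_cast this
  have main : ∀ᵐ x ∂(volume.restrict (Set.Ioc A B)), ∀ᶠ κ in atTop, x ∉ {x | t κ ≤ S κ x} := by
    apply bc_sum_p (p := 1 + ε / 2) (c := B0 + C) (by linarith)
    filter_upwards [ev, eventually_ge_atTop 1] with κ ⟨lg1, n1, n2, e1, e2, e3, e4⟩ κ1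
    have N0 : (0:ℝ) < NN κ := lt_of_lt_of_le (by positivity) n1
    set lg := Real.log κ with hlg
    set lam := Real.sqrt (8 * lg / NN κ) with hlam
    have lam2 : lam ^ 2 = 8 * lg / NN κ := Real.sq_sqrt (by positivity)
    have lam00 : 0 < lam := Real.sqrt_pos.2 (by positivity)
    have lam1 : lam ≤ lam0 := by
      rw [hlam, Real.sqrt_le_left hl0.le, div_le_iff₀ N0]; exact e1
    have lamM : (A0⁻¹) ^ (K * κ) ≤ lam := by
      rw [pow_mul, inv_pow]
      have : ((A0 ^ K)⁻¹) ^ κ ≤ ((256:ℝ)⁻¹) ^ κ := by gcongr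
      refine this.trans ?_
      apply Real.le_sqrt_of_sq_le
      rw [← pow_mul, le_div_iff₀ N0]
      calc ((256:ℝ)⁻¹) ^ (κ * 2) * NN κ ≤ ((256:ℝ)⁻¹) ^ (κ * 2) * 16 ^ (4 * κ) := by gcongr
        _ = 1 := by
          rw [mul_comm κ 2, pow_mul, pow_mul, ← mul_pow]; norm_num
        _ ≤ 8 * lg := by linarith
    have k := (key A B hA hAB hB hrA hrB lam lam00 lam1 (K * κ) e3 lamM (fun _ => 1) contDiff_const
      (fun x hx => ⟨zero_le_one, le_rfl, by
        rw [deriv_const, mul_zero, abs_zero, mul_one]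
        have hx0 : 0 ≤ x := by linarith [hx.1]
        exact mul_nonneg lam00.le (UU_nonneg _ hx0)⟩) ((NN κ - K * κ) / L)).1
    simp only [one_mul] at k
    have cf := hf.continuous
    have cS : Continuous (S κ) := by rw [hS]; fun_prop
    have mk := markov1 (t := t κ) hAB lam00.le cS k
    refine mk.trans (ENNReal.ofReal_le_ofReal ?_)
    have i3 : (∫ x in A..B, (1:ℝ)) + C * A0⁻¹ ^ (K * κ) ≤ B0 + C := by
      have : C * A0⁻¹ ^ (K * κ) ≤ C * 1 := by gcongr; exact pow_le_one₀ i0.le i1.le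
      rw [intervalIntegral.integral_const, smul_eq_mul]; linarith
    have i30 : 0 ≤ B0 + C := by linarith
    have i31 : 0 ≤ (∫ x in A..B, (1:ℝ)) + C * A0⁻¹ ^ (K * κ) := by
      rw [intervalIntegral.integral_const, smul_eq_mul, mul_one]
      have : 0 ≤ C * A0⁻¹ ^ (K * κ) := by positivity
      linarith
    have q1 : (L:ℝ) * ((NN κ - K * κ) / L : ℕ) ≤ NN κ := by
      have : L * ((NN κ - K * κ) / L) ≤ NN κ := (Nat.mul_div_le _ _).trans (Nat.sub_le _ _)
      exact_mod_cast this
    have x1 : lam ^ 2 * L * (V + ε / 8) / 2 * ((NN κ - K * κ) / L : ℕ) ≤ lg * (1 + ε / 2) := by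
      calc lam ^ 2 * L * (V + ε / 8) / 2 * ((NN κ - K * κ) / L : ℕ) = lam ^ 2 * (V + ε / 8) / 2 * (L * ((NN κ - K * κ) / L : ℕ)) := by ring
        _ ≤ lam ^ 2 * (1/4 + ε / 8) / 2 * NN κ := by gcongr
        _ = lg * (1 + ε / 2) := by rw [lam2]; field_simp; ring
    have x2 : lam * t κ = (2 + ε) * lg := by
      have : lam * Real.sqrt (1/2 * NN κ * lg) = 2 * lg := by
        rw [hlam, ← Real.sqrt_mul (by positivity)]
        have : 8 * lg / NN κ * (1/2 * NN κ * lg) = (2 * lg) ^ 2 := by field_simp; ring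
        rw [this, Real.sqrt_sq (by linarith)]
      simp only [ht]
      calc lam * ((1 + ε/2) * Real.sqrt (1/2 * NN κ * lg)) = (1 + ε/2) * (lam * Real.sqrt (1/2 * NN κ * lg)) := by ring
        _ = _ := by rw [this]; ring
    have κ0 : (0:ℝ) < κ := by exact_mod_cast κ1
    calc _ ≤ Real.exp (lg * (1 + ε / 2)) * (B0 + C) * Real.exp (-(lam * t κ)) := by gcongr
      _ = (B0 + C) * Real.exp (-(lg * (1 + ε/2))) := by
        rw [mul_comm (Real.exp _) (B0 + C), mul_assoc, ← Real.exp_add, x2]; congr 2; ring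
      _ = _ := by
        rw [Real.exp_neg, Real.rpow_def_of_pos κ0]
  filter_upwards [main] with x hx
  filter_upwards [hx, ev] with κ hκ ⟨lg1, n1, n2, e1, e2, e3, e4⟩
  have h1 : S κ x < t κ := not_le.1 hκ
  have h2 := (abs_le.1 (sum_split (ξ := ξ) (x := x) f1 hL e4)).2
  have h3 : (NN κ : ℝ) = m * 16 ^ (4 * κ - s0) := by simp [hNN]
  simp only [ht] at h1
  push_cast at h2
  rw [← h3]
  have h4 : ∑ n ∈ Finset.Ioc (K * κ) (K * κ + (NN κ - K * κ) / L * L), f (ξ * x ^ n) = S κ x := rfl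
  rw [h4] at h2
  linarith

theorem ev_lt {P : ℕ → ℕ → Prop} (n : ℕ) (h : ∀ i < n, ∀ᶠ κ in atTop, P i κ) : ∀ᶠ κ in atTop, ∀ i < n, P i κ :=
  (eventually_all_finite (Set.finite_lt_nat n)).2 h

theorem sharp_fam {ξ A0 B0 x0 ε : ℝ} (hξ : 0 < ξ) (hA0 : 1 < A0) (hB0 : A0 ≤ B0) (hx : Transcendental ℤ x0)
    (hε : 0 < ε) (hε1 : ε ≤ 1) (l0 : ℕ) :
    ∃ r > (0:ℝ), ∀ A B : ℝ, A0 ≤ A → A ≤ B → B ≤ B0 → x0 - r ≤ A → B ≤ x0 + r → ∀ s0 : ℕ,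
      ∀ᵐ x ∂(volume.restrict (Set.Ioc A B)), ∀ᶠ κ : ℕ in atTop, ∀ m : ℕ, m < 16 ^ s0 → ∀ i < 3 * 16 ^ l0, ∀ i' < 3 * 16 ^ l0,
        |∑ n ∈ Finset.Ioc 0 (m * 16 ^ (4 * κ - s0)), bb l0 i i' (ξ * x ^ n)| ≤ (1 + ε) * Real.sqrt (1/2 * (m * 16 ^ (4 * κ - s0)) * Real.log κ) := by
  obtain ⟨C, hC1, hC⟩ := st_deriv
  have h := fun i i' => let ⟨g1, g2, g3, g4, g5, g6⟩ := bb_facts hC l0 i i'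
    sharp_one hξ hA0 hB0 hx g1 g2 g3 g4 g5 g6 hε hε1
  choose r hr h using h
  have ev : ∀ᶠ t in nhdsWithin (0:ℝ) (Set.Ioi 0), ∀ i ∈ Finset.range (3 * 16 ^ l0), ∀ i' ∈ Finset.range (3 * 16 ^ l0), t ≤ r i i' :=
    (Finset.eventually_all _).2 fun i _ => (Finset.eventually_all _).2 fun i' _ =>
      mem_of_superset (Ioc_mem_nhdsGT (hr i i')) fun t ht => ht.2
  obtain ⟨t, ht, t0⟩ := (ev.and self_mem_nhdsWithin).exists
  refine ⟨t, t0, fun A B hA hAB hB h1 h2 s0 => ?_⟩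
  have a1 : ∀ᵐ x ∂(volume.restrict (Set.Ioc A B)), ∀ m i i' : ℕ, 1 ≤ m → m < 16 ^ s0 → i < 3 * 16 ^ l0 → i' < 3 * 16 ^ l0 →
      ∀ᶠ κ : ℕ in atTop,
        ∑ n ∈ Finset.Ioc 0 (m * 16 ^ (4 * κ - s0)), bb l0 i i' (ξ * x ^ n) ≤ (1 + ε) * Real.sqrt (1/2 * (m * 16 ^ (4 * κ - s0)) * Real.log κ) := by
    simp only [ae_all_iff]
    intro m i i' m1 m2 hi hi'
    have := ht i (Finset.mem_range.2 hi) i' (Finset.mem_range.2 hi')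
    exact h i i' A B hA hAB hB (by linarith) (by linarith) s0 m m1 m2
  filter_upwards [a1] with x hx
  refine ev_lt _ fun m hm => ev_lt _ fun i hi =>
    ev_lt _ fun i' hi' => ?_
  rcases Nat.eq_zero_or_pos m with h0 | h0
  · subst h0; simp
  filter_upwards [hx m i i' h0 hm hi hi', hx m i' i h0 hm hi' hi] with κ k1 k2
  refine abs_le'.2 ⟨k1, ?_⟩
  refine le_trans (le_of_eq ?_) k2
  rw [← Finset.sum_neg_distrib]
  refine Finset.sum_congr rfl fun n _ => ?_
  rw [bb_eq, bb_eq]; ring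

theorem base_ae {ξ A0 B0 D : ℝ} (hξ : 0 < ξ) (hA0 : 1 < A0) (hB0 : A0 ≤ B0) (hD : 0 ≤ D) :
    ∃ C1 ≥ (0:ℝ), ∀ f : ℝ → ℝ, Cls D 0 f → ∀ᵐ x ∂(volume.restrict (Set.Ioc A0 B0)), ∀ᶠ κ : ℕ in atTop, ∀ s0 ≤ 3 * κ, ∀ N < 16 ^ (4 * κ),
      |∑ n ∈ Finset.Ioc (N / 16 ^ (4 * κ - s0) * 16 ^ (4 * κ - s0)) N, cen f (ξ * x ^ n)| ≤ C1 * (2/3) ^ s0 * (16 ^ (2 * κ) * Real.sqrt (Real.log κ)) := by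
  obtain ⟨C1, hC1, h⟩ := crude_ae hξ hA0 hB0 hD
  refine ⟨C1, hC1, fun f hf => ?_⟩
  have hr : ∀ l j : ℕ, Cls D l ((fun l (_ : ℕ) => if l = 0 then f else fun _ => 0) l j) := by
    intro l j
    by_cases hl : l = 0
    · subst hl; exact hf
    · simp only [hl, if_false]
      exact ⟨contDiff_const, fun _ => rfl, by simp, by simp; positivity, by simp; positivity⟩
  filter_upwards [h 1 _ hr] with x hx
  filter_upwards [hx] with κ hκ s0 hs N hN
  simpa using hκ 0 (by omega) s0 hs 0 (by simp) N hN

theorem geo_small (c : ℝ) {ε : ℝ} (hc : 0 ≤ c) (hε : 0 < ε) : ∃ s : ℕ, c * (2/3) ^ s ≤ ε := by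
  obtain ⟨s, hs⟩ := exists_pow_lt_of_lt_one (by positivity : 0 < ε / (c + 1)) (by norm_num : (2/3:ℝ) < 1)
  refine ⟨s, ?_⟩
  calc c * (2/3) ^ s ≤ (c + 1) * (ε / (c + 1)) := by gcongr; linarith
    _ = ε := by field_simp

theorem kap_facts {N κ : ℕ} (h2 : 2 ≤ κ) (h1 : 16 ^ (4 * (κ - 1)) ≤ N) : 0 ≤ Real.log κ ∧ Real.log κ ≤ Real.log (Real.log N) ∧
    (16:ℝ) ^ (2 * κ) ≤ 256 * Real.sqrt N := by
  have h2' : (2:ℝ) ≤ κ := by exact_mod_cast h2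
  obtain ⟨j, rfl⟩ : ∃ j, κ = j + 1 := ⟨κ - 1, by omega⟩
  rw [Nat.add_sub_cancel] at h1
  have h1' : (16:ℝ) ^ (4 * j) ≤ N := by exact_mod_cast h1
  refine ⟨Real.log_nonneg (by linarith), Real.log_le_log (by linarith) ?_, ?_⟩
  · have l1 : 1 ≤ Real.log 16 := by
      rw [Real.le_log_iff_exp_le (by norm_num)]; linarith [Real.exp_one_lt_d9]
    have := Real.log_le_log (by positivity) h1'
    rw [Real.log_pow] at this
    push_cast at *
    have : 4 * (j:ℝ) * 1 ≤ 4 * j * Real.log 16 := by gcongr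
    linarith
  · have : (16:ℝ) ^ (2 * j) ≤ Real.sqrt N := by
      apply Real.le_sqrt_of_sq_le
      rw [← pow_mul]; convert h1' using 2; ring
    calc (16:ℝ) ^ (2 * (j + 1)) = 256 * 16 ^ (2 * j) := by ring
      _ ≤ _ := by gcongr

theorem ev_kap {P : ℕ → Prop} (h : ∀ᶠ κ in atTop, P κ) : ∀ᶠ N : ℕ in atTop, ∃ κ, P κ ∧ 16 ^ (4 * (κ - 1)) ≤ N ∧ N < 16 ^ (4 * κ) := by
  obtain ⟨k0, h⟩ := h.exists_forall_of_atTop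
  filter_upwards [eventually_ge_atTop (65536 ^ k0), eventually_ge_atTop 1] with N hN hN1
  have a : (16 ^ 4 : ℕ) = 65536 := by norm_num
  refine ⟨Nat.log 65536 N + 1, h _ ?_, ?_, ?_⟩
  · exact (Nat.le_log_of_pow_le (by norm_num) hN).trans (Nat.le_succ _)
  · rw [pow_mul, a, Nat.add_sub_cancel]; exact Nat.pow_log_le_self _ (by omega)
  · rw [pow_mul, a]; exact Nat.lt_pow_succ_log_self (by norm_num) _

theorem chain_ae {ξ A0 B0 : ℝ} (hξ : 0 < ξ) (hA0 : 1 < A0) (hB0 : A0 ≤ B0) : ∃ C1 ≥ (0:ℝ), ∀ l0 : ℕ,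
    ∀ᵐ x ∂(volume.restrict (Set.Ioc A0 B0)), ∀ᶠ κ : ℕ in atTop, ∀ N < 16 ^ (4 * κ), ∀ d, l0 + d ≤ 2 * κ →
      ∀ j < 3 * 16 ^ (l0 + d), ∀ j' < 3 * 16 ^ (l0 + d), |∑ n ∈ Finset.Ioc 0 N, bb (l0 + d) j j' (ξ * x ^ n) -
        ∑ n ∈ Finset.Ioc 0 N, bb l0 (j / 16 ^ d) (j' / 16 ^ d) (ξ * x ^ n)| ≤ C1 * (2/3) ^ l0 * (16 ^ (2 * κ) * Real.sqrt (Real.log κ)) := by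
  obtain ⟨C, hC1, hC⟩ := st_deriv
  obtain ⟨C1, hC1', h⟩ := crude_ae hξ hA0 hB0 (by positivity : 0 ≤ 272 * C)
  refine ⟨6 * C1, by positivity, fun l0 => ?_⟩
  filter_upwards [h 48 rr (rr_cls hC1 hC)] with x hx
  filter_upwards [hx] with κ hκ N hN d hd j hj j' hj'
  have := bb_chain (z := fun n => ξ * x ^ n) (s := Finset.Ioc 0 N) (T := C1 * (16 ^ (2 * κ) * Real.sqrt (Real.log κ))) (by positivity) l0 d
    (fun l _ hl2 i hi => ?_) j j' hj hj'
  · refine this.trans (le_of_eq (by ring))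
  · have := hκ l (by omega) 0 (by omega) i hi N hN
    rw [Nat.sub_zero, Nat.div_eq_of_lt hN, zero_mul, add_zero] at this
    refine this.trans (le_of_eq (by ring))

theorem upper {ξ A0 B0 x0 ε : ℝ} (hξ : 0 < ξ) (hA0 : 1 < A0) (hB0 : A0 ≤ B0) (hx : Transcendental ℤ x0)
    (hε : 0 < ε) (hε1 : ε ≤ 1) :
    ∃ r > (0:ℝ), ∀ A B : ℝ, A0 ≤ A → A ≤ B → B ≤ B0 → x0 - r ≤ A → B ≤ x0 + r →
      ∀ᵐ x ∂(volume.restrict (Set.Ioc A B)), ∀ᶠ N : ℕ in atTop, ∀ a b : ℝ, 0 ≤ a → a ≤ b → b ≤ 1 →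
        |∑ n ∈ Finset.Ioc 0 N, Set.indicator (Set.Ico a b) (fun _ => (1:ℝ)) (Int.fract (ξ * x ^ n)) - N * (b - a)| ≤
          (1 / Real.sqrt 2 + ε) * (Real.sqrt N * Real.sqrt (Real.log (Real.log N))) := by
  obtain ⟨Cc, hCc, chain⟩ := chain_ae hξ hA0 hB0
  obtain ⟨l0, hl0⟩ := geo_small (Cc * 256) (by positivity) (by positivity : 0 < ε / 4)
  obtain ⟨C, hC1, hC⟩ := st_deriv
  obtain ⟨Cb, hCb, base⟩ := base_ae (D := 2 * C * 16 ^ (l0 + 1)) hξ hA0 hB0 (by positivity)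
  obtain ⟨s0, hs0⟩ := geo_small (Cb * 256) (by positivity) (by positivity : 0 < ε / 4)
  obtain ⟨r, hr, sharp⟩ := sharp_fam hξ hA0 hB0 hx (by positivity : 0 < ε / 4) (by linarith) l0
  refine ⟨r, hr, fun A B hA hAB hB h1 h2 => ?_⟩
  have sub : ∀ {p : ℝ → Prop}, (∀ᵐ x ∂(volume.restrict (Set.Ioc A0 B0)), p x) → ∀ᵐ x ∂(volume.restrict (Set.Ioc A B)), p x :=
    fun h => ae_restrict_of_ae_restrict_of_subset (Set.Ioc_subset_Ioc hA hB) h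
  have base' : ∀ᵐ x ∂(volume.restrict (Set.Ioc A0 B0)), ∀ i i' : ℕ, ∀ᶠ κ : ℕ in atTop, ∀ s0 ≤ 3 * κ, ∀ N < 16 ^ (4 * κ),
      |∑ n ∈ Finset.Ioc (N / 16 ^ (4 * κ - s0) * 16 ^ (4 * κ - s0)) N, bb l0 i i' (ξ * x ^ n)| ≤ Cb * (2/3) ^ s0 * (16 ^ (2 * κ) * Real.sqrt (Real.log κ)) := by
    simp only [ae_all_iff]
    intro i i'
    have := bb_cls hC1 hC l0 i i'
    have := base _ this.1
    rwa [(bb_cls hC1 hC l0 i i').2] at this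
  filter_upwards [sharp A B hA hAB hB h1 h2 s0, sub base', sub (chain l0)] with x x1 x2 x3
  have x2' : ∀ᶠ κ : ℕ in atTop, ∀ i < 3 * 16 ^ l0, ∀ i' < 3 * 16 ^ l0, ∀ s0 ≤ 3 * κ, ∀ N < 16 ^ (4 * κ),
      |∑ n ∈ Finset.Ioc (N / 16 ^ (4 * κ - s0) * 16 ^ (4 * κ - s0)) N, bb l0 i i' (ξ * x ^ n)| ≤ Cb * (2/3) ^ s0 * (16 ^ (2 * κ) * Real.sqrt (Real.log κ)) :=
    ev_lt _ fun i hi => ev_lt _ fun i' hi' => x2 i i'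
  have lgt : ∀ᶠ κ : ℕ in atTop, (12 / ε) ^ 2 ≤ Real.log κ :=
    (Real.tendsto_log_atTop.comp tendsto_natCast_atTop_atTop).eventually_ge_atTop _
  filter_upwards [ev_kap (x1.and (x2'.and (x3.and (lgt.and (eventually_ge_atTop (s0 + l0 + 2))))))] with N ⟨κ, ⟨k1, k2, k3, k4, k5⟩, n1, n2⟩ a b ha hab hb
  obtain ⟨lg0, lgl, rt⟩ := kap_facts (by omega) n1
  set Q := Real.sqrt N * Real.sqrt (Real.log (Real.log N)) with hQ
  have Q0 : 0 ≤ Q := by positivity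
  have sl : Real.sqrt (Real.log κ) ≤ Real.sqrt (Real.log (Real.log N)) := Real.sqrt_le_sqrt lgl
  have RQ : 16 ^ (2 * κ) * Real.sqrt (Real.log κ) ≤ 256 * Q := by
    calc _ ≤ 256 * Real.sqrt N * Real.sqrt (Real.log (Real.log N)) := by gcongr
      _ = _ := by rw [hQ]; ring
  have du := disc_up (z := fun n => ξ * x ^ n) (s := Finset.Ioc 0 N) (2 * κ) (X := (1 / Real.sqrt 2 + 3 * (ε / 4)) * Q) ha hab hb ?_
  · rw [Nat.card_Ioc, Nat.sub_zero] at du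
    refine du.trans ?_
    have : 3 * (N:ℝ) / 16 ^ (2 * κ) ≤ ε / 4 * Q := by
      have n2' : (N:ℝ) ≤ (16 ^ (2 * κ)) ^ 2 := by
        rw [← pow_mul, mul_right_comm]; exact_mod_cast n2.le
      have s1 : Real.sqrt N ≤ 16 ^ (2 * κ) := by
        rw [Real.sqrt_le_left (by positivity)]; exact n2'
      have s2 : 12 / ε ≤ Real.sqrt (Real.log (Real.log N)) := Real.le_sqrt_of_sq_le (k4.trans lgl)
      rw [div_le_iff₀ (by positivity)]
      calc 3 * (N:ℝ) = ε / 4 * (Real.sqrt N * (12 / ε)) * Real.sqrt N := by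
            have := Real.mul_self_sqrt (Nat.cast_nonneg (α := ℝ) N)
            field_simp; linarith
        _ ≤ ε / 4 * (Real.sqrt N * Real.sqrt (Real.log (Real.log N))) * 16 ^ (2 * κ) := by gcongr
    linarith
  · intro j hj j' hj'
    obtain ⟨d, hd⟩ : ∃ d, 2 * κ = l0 + d := ⟨2 * κ - l0, by omega⟩
    rw [hd] at hj hj' ⊢
    have dv : ∀ j, j < 3 * 16 ^ (l0 + d) → j / 16 ^ d < 3 * 16 ^ l0 := fun j hj => by
      rw [Nat.div_lt_iff_lt_mul (by positivity), mul_assoc, ← pow_add]; exact hj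
    have c1 := k3 N n2 d hd.ge j hj j' hj'
    have c2 := k2 _ (dv j hj) _ (dv j' hj') s0 (by omega) N n2
    set m := N / 16 ^ (4 * κ - s0) with hm
    have m1 : m < 16 ^ s0 := by
      rw [hm, Nat.div_lt_iff_lt_mul (by positivity), ← pow_add]
      convert n2 using 2; omega
    have m2 : m * 16 ^ (4 * κ - s0) ≤ N := Nat.div_mul_le_self _ _
    have c3 := k1 m m1 _ (dv j hj) _ (dv j' hj')
    have c4 : (1 + ε/4) * Real.sqrt (1/2 * (m * 16 ^ (4 * κ - s0)) * Real.log κ) ≤ (1 / Real.sqrt 2 + ε / 4) * Q := by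
      have m2' : (m * 16 ^ (4 * κ - s0) : ℝ) ≤ N := by exact_mod_cast m2
      have : Real.sqrt (1/2 * (m * 16 ^ (4 * κ - s0)) * Real.log κ) ≤ 1 / Real.sqrt 2 * Q := by
        calc _ ≤ Real.sqrt (1/2 * N * Real.log (Real.log N)) := Real.sqrt_le_sqrt (by gcongr)
          _ = _ := by
            rw [Real.sqrt_mul (by positivity), Real.sqrt_mul (by positivity), hQ, Real.sqrt_div' _ (by norm_num), Real.sqrt_one]; ring
      have s2 : 1 / Real.sqrt 2 ≤ 1 := by
        rw [div_le_one (by positivity)]; exact Real.one_le_sqrt.2 (by norm_num)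
      calc _ ≤ (1 + ε / 4) * (1 / Real.sqrt 2 * Q) := by gcongr
        _ = 1 / Real.sqrt 2 * Q + ε / 4 * (1 / Real.sqrt 2) * Q := by ring
        _ ≤ 1 / Real.sqrt 2 * Q + ε / 4 * 1 * Q := by gcongr
        _ = _ := by ring
    have c5 : Cc * (2/3) ^ l0 * (16 ^ (2 * κ) * Real.sqrt (Real.log κ)) ≤ ε / 4 * Q := by
      calc _ ≤ Cc * (2/3) ^ l0 * (256 * Q) := by gcongr
        _ = Cc * 256 * (2/3) ^ l0 * Q := by ring
        _ ≤ _ := by gcongr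
    have c6 : Cb * (2/3) ^ s0 * (16 ^ (2 * κ) * Real.sqrt (Real.log κ)) ≤ ε / 4 * Q := by
      calc _ ≤ Cb * (2/3) ^ s0 * (256 * Q) := by gcongr
        _ = Cb * 256 * (2/3) ^ s0 * Q := by ring
        _ ≤ _ := by gcongr
    have sp := Finset.sum_Ioc_consecutive (fun n => bb l0 (j / 16 ^ d) (j' / 16 ^ d) (ξ * x ^ n)) (Nat.zero_le _) m2
    rw [← sp] at c1
    rw [abs_le] at *
    constructor <;> linarith [c1.1, c1.2, c2.1, c2.2, c3.1, c3.2]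

theorem tilt {A B c ζ T t τ Z : ℝ} {W X : ℝ → ℝ} (hAB : A ≤ B) (cW : Continuous W) (cX : Continuous X)
    (W0 : ∀ x ∈ Set.Icc A B, 0 ≤ W x) (hζ : 0 < ζ) (hc : c = 1 - ζ) (hT : 12 ≤ Real.exp (ζ ^ 2 * T / 2)) (T0 : 0 ≤ T) (t0 : 0 < t)
    (hτ : τ * t = 2 * T) (τ0 : 0 < τ) (Z0 : 0 ≤ Z) (c0 : 0 < c)
    (h0 : Real.exp ((c ^ 2 - ζ ^ 2 / 4) * T) * (Z / 2) ≤ ∫ x in A..B, W x * Real.exp (c * τ * X x))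
    (h1 : ∫ x in A..B, W x * Real.exp ((c + ζ) * τ * X x) ≤ Real.exp (((c + ζ) ^ 2 + ζ ^ 2 / 4) * T) * (3 / 2 * Z))
    (h2 : ∫ x in A..B, W x * Real.exp ((c - ζ) * τ * X x) ≤ Real.exp (((c - ζ) ^ 2 + ζ ^ 2 / 4) * T) * (3 / 2 * Z)) :
    Z / 4 * Real.exp (-T) ≤ ∫ x in A..B, W x * Real.smoothTransition ((X x - (c - 2 * ζ) * t) / (ζ * t)) := by
  have cs := Real.smoothTransition.continuous
  have pt : ∀ x ∈ Set.Icc A B, W x * Real.exp (c * τ * X x) ≤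
      Real.exp (2 * c * T) * (W x * Real.smoothTransition ((X x - (c - 2 * ζ) * t) / (ζ * t))) +
      (Real.exp (-(2 * ζ * T)) * (W x * Real.exp ((c + ζ) * τ * X x)) +
      Real.exp (2 * ζ * (c - ζ) * T) * (W x * Real.exp ((c - ζ) * τ * X x))) := by
    intro x hx
    have w := W0 x hx
    have y0 := Real.smoothTransition.nonneg ((X x - (c - 2 * ζ) * t) / (ζ * t))
    have key : Real.exp (c * τ * X x) ≤ Real.exp (2 * c * T) * Real.smoothTransition ((X x - (c - 2 * ζ) * t) / (ζ * t)) +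
      (Real.exp (-(2 * ζ * T)) * Real.exp ((c + ζ) * τ * X x) + Real.exp (2 * ζ * (c - ζ) * T) * Real.exp ((c - ζ) * τ * X x)) := by
      rw [← Real.exp_add, ← Real.exp_add]
      have p1 := Real.exp_pos (-(2 * ζ * T) + (c + ζ) * τ * X x)
      have p2 := Real.exp_pos (2 * ζ * (c - ζ) * T + (c - ζ) * τ * X x)
      have p3 : 0 ≤ Real.exp (2 * c * T) * Real.smoothTransition ((X x - (c - 2 * ζ) * t) / (ζ * t)) := by positivity
      rcases le_total t (X x) with hX | hX
      · have : c * τ * X x ≤ -(2 * ζ * T) + (c + ζ) * τ * X x := by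
          have : ζ * (τ * t) ≤ ζ * (τ * X x) := by gcongr
          rw [hτ] at this; linarith
        linarith [Real.exp_le_exp.2 this]
      · rcases le_total (X x) ((c - ζ) * t) with hY | hY
        · have : c * τ * X x ≤ 2 * ζ * (c - ζ) * T + (c - ζ) * τ * X x := by
            have h : ζ * (τ * X x) ≤ ζ * (τ * ((c - ζ) * t)) := by gcongr
            have e : ζ * (τ * ((c - ζ) * t)) = ζ * (c - ζ) * (τ * t) := by ring
            rw [e, hτ] at h; linarith
          linarith [Real.exp_le_exp.2 this]
        · rw [Real.smoothTransition.one_of_one_le (by rw [le_div_iff₀ (by positivity)]; linarith), mul_one] at *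
          have : c * τ * X x ≤ 2 * c * T := by
            have h : c * (τ * X x) ≤ c * (τ * t) := by gcongr
            rw [hτ] at h; linarith
          linarith [Real.exp_le_exp.2 this]
    calc _ ≤ W x * _ := mul_le_mul_of_nonneg_left key w
      _ = _ := by ring
  have im := intervalIntegral.integral_mono_on (μ := volume) hAB (Continuous.intervalIntegrable (by fun_prop) _ _) (Continuous.intervalIntegrable (by fun_prop) _ _) pt
  rw [intervalIntegral.integral_add (Continuous.intervalIntegrable (by fun_prop) _ _) (Continuous.intervalIntegrable (by fun_prop) _ _),
    intervalIntegral.integral_add (Continuous.intervalIntegrable (by fun_prop) _ _) (Continuous.intervalIntegrable (by fun_prop) _ _),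
    intervalIntegral.integral_const_mul, intervalIntegral.integral_const_mul, intervalIntegral.integral_const_mul] at im
  set J := ∫ x in A..B, W x * Real.smoothTransition ((X x - (c - 2 * ζ) * t) / (ζ * t))
  have b1 := mul_le_mul_of_nonneg_left h1 (Real.exp_pos (-(2 * ζ * T))).le
  have b2 := mul_le_mul_of_nonneg_left h2 (Real.exp_pos (2 * ζ * (c - ζ) * T)).le
  rw [← mul_assoc, ← Real.exp_add] at b1 b2
  have e1 : -(2 * ζ * T) + ((c + ζ) ^ 2 + ζ ^ 2 / 4) * T = (c ^ 2 - ζ ^ 2 / 4) * T + -(ζ ^ 2 * T / 2) := by rw [hc]; ring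
  have e2 : 2 * ζ * (c - ζ) * T + ((c - ζ) ^ 2 + ζ ^ 2 / 4) * T = (c ^ 2 - ζ ^ 2 / 4) * T + -(ζ ^ 2 * T / 2) := by ring
  rw [e1] at b1
  rw [e2] at b2
  rw [Real.exp_add, Real.exp_neg (ζ ^ 2 * T / 2)] at b1 b2
  have e3 : (Real.exp (ζ ^ 2 * T / 2))⁻¹ ≤ 12⁻¹ := by gcongr
  set E := Real.exp ((c ^ 2 - ζ ^ 2 / 4) * T) with hE
  have E0 : 0 < E := Real.exp_pos _
  have b3 : E * (Real.exp (ζ ^ 2 * T / 2))⁻¹ * (3 / 2 * Z) ≤ E * 12⁻¹ * (3 / 2 * Z) := by gcongr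
  have b4 : E * (Z / 4) ≤ Real.exp (2 * c * T) * J := by linarith
  have b5 : Real.exp (-T) * Real.exp (2 * c * T) ≤ E := by
    rw [← Real.exp_add, hE, Real.exp_le_exp]
    have : 0 ≤ ζ ^ 2 * T := by positivity
    rw [hc]; linarith
  have b6 : Real.exp (-T) * Real.exp (2 * c * T) * (Z / 4) ≤ Real.exp (2 * c * T) * J := (mul_le_mul_of_nonneg_right b5 (by positivity)).trans b4
  refine le_of_mul_le_mul_left ?_ (Real.exp_pos (2 * c * T))
  linarith

theorem diverge {Z a : ℕ → ℝ} {k0 : ℕ} (Z0 : ∀ k, 0 ≤ Z k) (ha : Tendsto a atTop (nhds 0))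
    (h : ∀ k ≥ k0, a k ≤ Z k → Z (k + 1) ≤ Z k - Z k / (8 * k)) (hk0 : 1 ≤ k0) {z : ℝ} (hz : 0 < z) : ∃ k ≥ k0, Z k < z := by
  by_contra! hcon
  obtain ⟨k1, h1⟩ := (ha.eventually_le_const hz).exists_forall_of_atTop
  set m := max k0 k1 with hm
  have st : ∀ d : ℕ, z / 8 * ∑ j ∈ Finset.range d, (1 / ((j:ℝ) + 1 + (m:ℝ))) ≤ Z m - Z (m + d) := by
    intro d
    induction d with
    | zero => simp
    | succ d ih =>
      have k0m : k0 ≤ m + d := by omega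
      have s := h (m + d) k0m ((h1 _ (by omega)).trans (hcon _ k0m))
      have zz := hcon (m + d) k0m
      have hp : (0:ℝ) < (m + d : ℕ) := by exact_mod_cast (by omega)
      have : z / 8 * (1 / ((d:ℝ) + 1 + m)) ≤ Z (m + d) / (8 * (m + d : ℕ)) := by
        calc _ = z / (8 * ((d:ℝ) + 1 + m)) := by field_simp
          _ ≤ _ := by
            gcongr
            all_goals (push_cast; linarith)
      rw [Finset.sum_range_succ, mul_add]
      rw [← add_assoc]; linarith
  have nb := (Real.not_summable_one_div_natCast)
  rw [← summable_nat_add_iff (m + 1)] at nb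
  apply nb
  refine summable_of_sum_range_le (c := 8 / z * Z m) (fun n => by positivity) fun n => ?_
  have := st n
  have hh := Z0 (m + n)
  rw [div_mul_eq_mul_div, le_div_iff₀ hz]
  have e : ∑ i ∈ Finset.range n, 1 / (((i + (m + 1) : ℕ)):ℝ) = ∑ j ∈ Finset.range n, (1 / ((j:ℝ) + 1 + (m:ℝ))) :=
    Finset.sum_congr rfl fun i _ => by push_cast; ring
  rw [e]; linarith

theorem g_facts {ξ F C u w : ℝ} (hξ : 0 ≤ ξ) {f : ℝ → ℝ} (hf : ContDiff ℝ 1 f) (hF : ∀ y, |deriv f y| ≤ F)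
    (hC : ∀ t, |deriv Real.smoothTransition t| ≤ C) (hw : 0 < w) {M E N : ℕ} (hM : M ≤ E) (hE : E ≤ N) {g : ℝ → ℝ}
    (hg : g = fun x => 1 - Real.smoothTransition ((∑ n ∈ Finset.Ioc M E, f (ξ * x ^ n) - u) / w) / 2) :
    ContDiff ℝ 1 g ∧ ∀ x, 0 ≤ x → 1/2 ≤ g x ∧ g x ≤ 1 ∧ |x * deriv g x| ≤ C * F * ξ / w * UU N x * g x := by
  have cst : ContDiff ℝ 1 Real.smoothTransition := Real.smoothTransition.contDiff
  have F0 : 0 ≤ F := (abs_nonneg _).trans (hF 0)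
  have C0 : 0 ≤ C := (abs_nonneg _).trans (hC 0)
  constructor
  · rw [hg]; fun_prop
  intro x hx
  have g1 : 1/2 ≤ g x := by
    rw [hg]; linarith [Real.smoothTransition.le_one ((∑ n ∈ Finset.Ioc M E, f (ξ * x ^ n) - u) / w)]
  refine ⟨g1, by rw [hg]; linarith [Real.smoothTransition.nonneg ((∑ n ∈ Finset.Ioc M E, f (ξ * x ^ n) - u) / w)], ?_⟩
  have df : ∀ y, HasDerivAt f (deriv f y) y := fun y => (hf.differentiable one_ne_zero y).hasDerivAt
  have dn : ∀ n : ℕ, HasDerivAt (fun x => f (ξ * x ^ n)) (deriv f (ξ * x ^ n) * (ξ * (n * x ^ (n-1)))) x :=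
    fun n => (df (ξ * x ^ n)).comp x ((hasDerivAt_pow n x).const_mul ξ)
  have dS := HasDerivAt.fun_sum (u := Finset.Ioc M E) fun n _ => dn n
  set v := (∑ n ∈ Finset.Ioc M E, f (ξ * x ^ n) - u) / w with hv
  set D := ∑ n ∈ Finset.Ioc M E, deriv f (ξ * x ^ n) * (ξ * (n * x ^ (n-1)))
  have ds : HasDerivAt Real.smoothTransition (deriv Real.smoothTransition v) v := (cst.differentiable one_ne_zero v).hasDerivAt
  have d : HasDerivAt g (-(deriv Real.smoothTransition v * (D / w) / 2)) x := by
    rw [hg]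
    exact ((HasDerivAt.comp x ds ((dS.sub_const u).div_const w)).div_const 2).const_sub 1
  rw [d.deriv]
  have hD : |x * D| ≤ F * ξ * UU N x := by
    have : UU M x + ∑ n ∈ Finset.Ioc M E, (n : ℝ) * x ^ n ≤ UU N x := by
      rw [sum_Ioc_UU hM]; exact UU_mono hE hx
    have u0 := UU_nonneg M hx
    refine le_trans ?_ (mul_le_mul_of_nonneg_left (by linarith : ∑ n ∈ Finset.Ioc M E, (n : ℝ) * x ^ n ≤ UU N x) (by positivity))
    rw [Finset.mul_sum, Finset.mul_sum]
    refine (Finset.abs_sum_le_sum_abs _ _).trans (Finset.sum_le_sum fun n _ => ?_)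
    have : x * (deriv f (ξ * x ^ n) * (ξ * (n * x ^ (n-1)))) = deriv f (ξ * x ^ n) * (ξ * (n * x ^ n)) := by
      rcases n with _ | n
      · simp
      · simp only [Nat.add_sub_cancel]; rw [pow_succ]; ring
    rw [this, abs_mul, abs_of_nonneg (by positivity : 0 ≤ ξ * (n * x ^ n)), mul_assoc]
    exact mul_le_mul_of_nonneg_right (hF _) (by positivity)
  have u0 := UU_nonneg N hx
  calc |x * -(deriv Real.smoothTransition v * (D / w) / 2)| = |deriv Real.smoothTransition v| * |x * D| / w * (1/2) := by
        rw [← abs_of_pos hw, ← abs_mul, ← abs_div, ← abs_of_pos (by norm_num : (0:ℝ) < 1/2), ← abs_mul, abs_of_pos hw, ← abs_neg]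
        congr 1; ring
    _ ≤ C * (F * ξ * UU N x) / w * g x := by gcongr; exact hC v
    _ = _ := by ring

theorem W_facts {K : ℝ} (hK : 0 ≤ K) {P : ℕ → ℕ} (hP : Monotone P) {g : ℕ → ℝ → ℝ} {k0 : ℕ} (h : ∀ j ≥ k0, ContDiff ℝ 1 (g j) ∧ ∀ x, 0 ≤ x →
    1/2 ≤ g j x ∧ g j x ≤ 1 ∧ |x * deriv (g j) x| ≤ K * UU (P (j + 1)) x * g j x) : ∀ k ≥ k0,
    ContDiff ℝ 1 (fun x => ∏ j ∈ Finset.Ico k0 k, g j x) ∧ ∀ x, 0 ≤ x →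
      0 ≤ ∏ j ∈ Finset.Ico k0 k, g j x ∧ ∏ j ∈ Finset.Ico k0 k, g j x ≤ 1 ∧
      |x * deriv (fun x => ∏ j ∈ Finset.Ico k0 k, g j x) x| ≤ K * k * UU (P k) x * ∏ j ∈ Finset.Ico k0 k, g j x := by
  intro k hk
  induction k, hk using Nat.le_induction with
  | base =>
    refine ⟨by simp only [Finset.Ico_self, Finset.prod_empty]; exact contDiff_const, fun x hx => ?_⟩
    have := UU_nonneg (P k0) hx
    simp; positivity
  | succ k hk ih =>
    obtain ⟨c1, i1⟩ := ih
    obtain ⟨c2, i2⟩ := h k hk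
    simp only [Finset.prod_Ico_succ_top hk]
    refine ⟨c1.mul c2, fun x hx => ?_⟩
    obtain ⟨w0, w1, w2⟩ := i1 x hx
    obtain ⟨g0, g1, g2⟩ := i2 x hx
    have g0' : 0 ≤ g k x := by linarith
    refine ⟨by positivity, mul_le_one₀ w1 g0' g1, ?_⟩
    have d := ((c1.differentiable one_ne_zero x).hasDerivAt).mul ((c2.differentiable one_ne_zero x).hasDerivAt)
    rw [HasDerivAt.deriv (f := fun x => (∏ j ∈ Finset.Ico k0 k, g j x) * g k x) d]
    set w := ∏ j ∈ Finset.Ico k0 k, g j x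
    set w' := deriv (fun x => ∏ j ∈ Finset.Ico k0 k, g j x) x
    have um := UU_mono (hP (Nat.le_succ k)) hx
    have : x * (w' * g k x + w * deriv (g k) x) = (x * w') * g k x + w * (x * deriv (g k) x) := by ring
    rw [this]
    refine (abs_add_le _ _).trans ?_
    rw [abs_mul _ (g k x), abs_mul w, abs_of_nonneg g0', abs_of_nonneg w0]
    calc _ ≤ K * k * UU (P k) x * w * g k x + w * (K * UU (P (k + 1)) x * g k x) := by gcongr
      _ ≤ K * k * UU (P (k + 1)) x * w * g k x + w * (K * UU (P (k + 1)) x * g k x) := by gcongr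
      _ = _ := by push_cast; ring

theorem low_ev {A0 V ζ lam0 K : ℝ} (hA0 : 1 < A0) (V0 : 0 < V) (V1 : V ≤ 1) (hζ : 0 < ζ) (hl0 : 0 < lam0) (hK : 0 ≤ K) {L b : ℕ}
    (hL : 1 ≤ L) (hb : 1 ≤ b) (n0 : ℕ) : ∀ᶠ k : ℕ in atTop, 1 ≤ k ∧ 1 ≤ Real.log k ∧ 12 ≤ Real.exp (ζ ^ 2 * Real.log k / 2) ∧
      ∀ ℓ : ℝ, ℓ = ((16 ^ (4 * b * (k + 1)) - 2 * 16 ^ (4 * b * k)) / L * L : ℕ) → 0 < ℓ ∧ 1 ≤ Real.sqrt (2 * V * ℓ * Real.log k) ∧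
        Real.sqrt (2 * Real.log k / (V * ℓ)) ≤ lam0 ∧ n0 ≤ 2 * 16 ^ (4 * b * k) ∧
        (A0⁻¹) ^ (2 * 16 ^ (4 * b * k)) ≤ Real.sqrt (2 * Real.log k / (V * ℓ)) / 2 ∧
        K * k * (A0⁻¹) ^ (16 ^ (4 * b * k)) ≤ Real.sqrt (2 * Real.log k / (V * ℓ)) / 2 := by
  have lgt := Real.tendsto_log_atTop.comp tendsto_natCast_atTop_atTop
  have yt : Tendsto (fun k : ℕ => 16 ^ (4 * b * k)) atTop atTop := by
    apply tendsto_atTop_mono (fun k => ?_) tendsto_id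
    calc k ≤ 4 * b * k := Nat.le_mul_of_pos_left _ (by omega)
      _ ≤ _ := (Nat.lt_pow_self (by norm_num)).le
  have pt : ∀ᶠ y : ℕ in atTop, 2 * (K + 1) * 16 ^ (4 * b) * (y:ℝ) ^ 2 ≤ A0 ^ y := by
    have t1 := (tendsto_pow_const_div_const_pow_of_one_lt 2 hA0).const_mul (2 * (K + 1) * 16 ^ (4 * b))
    rw [mul_zero] at t1
    filter_upwards [t1.eventually_le_const one_pos] with κ hκ
    rwa [← mul_div_assoc, div_le_one (by positivity)] at hκ
  filter_upwards [eventually_ge_atTop 1, lgt.eventually_ge_atTop 1, lgt.eventually_ge_atTop (2 * Real.log 12 / ζ ^ 2),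
    yt.eventually pt, yt.eventually (eventually_ge_atTop (L + n0)), ev_big (2 / (V * lam0 ^ 2)), ev_big (1 / V)] with k k1 l1 l2 hy yL e1 e2
  simp only [Function.comp] at l1 l2
  refine ⟨k1, l1, ?_, fun ℓ hℓ => ?_⟩
  · rw [← Real.exp_log (by norm_num : (0:ℝ) < 12), Real.exp_le_exp]
    rw [div_le_iff₀ (by positivity)] at l2
    linarith
  have yk : 16 ^ k ≤ 16 ^ (4 * b * k) := Nat.pow_le_pow_right (by norm_num) (Nat.le_mul_of_pos_left _ (by omega))
  have ky : k ≤ 16 ^ (4 * b * k) := (Nat.lt_pow_self (by norm_num)).le.trans yk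
  have P1 : 16 ^ (4 * b * (k + 1)) = 16 ^ (4 * b) * 16 ^ (4 * b * k) := by rw [← pow_add]; congr 1; ring
  have b16 : 16 ^ 1 ≤ 16 ^ (4 * b) := Nat.pow_le_pow_right (by norm_num) (by omega)
  rw [P1] at hℓ
  set y := 16 ^ (4 * b * k) with hyd
  have P2 : 16 * y ≤ 16 ^ (4 * b) * y := Nat.mul_le_mul_right _ b16
  have y1 : 1 ≤ y := Nat.one_le_pow _ _ (by norm_num)
  have h1 := Nat.div_add_mod' (16 ^ (4 * b) * y - 2 * y) L
  have h2 := Nat.mod_lt (16 ^ (4 * b) * y - 2 * y) hL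
  have l3 : y ≤ (16 ^ (4 * b) * y - 2 * y) / L * L := by omega
  have l4 : (16 ^ (4 * b) * y - 2 * y) / L * L ≤ 16 ^ (4 * b) * y := by omega
  have l3' : (y:ℝ) ≤ ℓ := by rw [hℓ]; exact_mod_cast l3
  have l4' : ℓ ≤ 16 ^ (4 * b) * y := by rw [hℓ]; exact_mod_cast l4
  have y1' : (1:ℝ) ≤ y := by exact_mod_cast y1
  have yk' : (16:ℝ) ^ k ≤ y := by exact_mod_cast yk
  have ky' : (k:ℝ) ≤ y := by exact_mod_cast ky
  have k1' : (1:ℝ) ≤ k := by exact_mod_cast k1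
  have ℓ0 : 0 < ℓ := by linarith
  have lk : Real.log k ≤ (k:ℝ) ^ 2 := (Real.log_le_self (by linarith)).trans (le_self_pow₀ k1' two_ne_zero)
  have k2 : 1 ≤ (k:ℝ) ^ 2 := one_le_pow₀ k1'
  set z : ℝ := 16 ^ (4 * b) * y with hz
  have z1 : 1 ≤ z := one_le_mul_of_one_le_of_one_le (one_le_pow₀ (by norm_num)) y1'
  have tz : 1 / z ≤ Real.sqrt (2 * Real.log k / (V * ℓ)) := by
    apply Real.le_sqrt_of_sq_le
    rw [div_pow, one_pow, div_le_div_iff₀ (by positivity) (by positivity)]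
    have : V * ℓ ≤ 1 * z := by gcongr
    have : z * 1 ≤ z ^ 2 := by rw [sq]; gcongr
    have : z ^ 2 * 1 ≤ z ^ 2 * Real.log k := by gcongr
    linarith
  have dec : ∀ c : ℝ, 0 ≤ c → c ≤ (K + 1) * y → c * (A0⁻¹) ^ y ≤ Real.sqrt (2 * Real.log k / (V * ℓ)) / 2 := by
    intro c c0 hc
    refine le_trans ?_ (div_le_div_of_nonneg_right tz (by norm_num))
    rw [inv_pow, ← div_eq_mul_inv, div_div, div_le_div_iff₀ (by positivity) (by positivity), one_mul]
    refine le_trans ?_ hy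
    calc c * (z * 2) ≤ (K + 1) * y * (z * 2) := by gcongr
      _ = _ := by rw [hz]; ring
  refine ⟨ℓ0, ?_, ?_, by omega, ?_, ?_⟩
  · rw [Real.one_le_sqrt]
    have : 1 / V * 1 ≤ y := (mul_le_mul_of_nonneg_left k2 (by positivity)).trans (e2.trans yk')
    rw [mul_one, div_le_iff₀ V0] at this
    have h3 : V * y * 1 ≤ V * ℓ * Real.log k := by gcongr
    linarith
  · rw [Real.sqrt_le_left hl0.le, div_le_iff₀ (by positivity)]
    have := e1.trans (yk'.trans l3')
    rw [div_mul_eq_mul_div, div_le_iff₀ (by positivity)] at this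
    linarith
  · have := dec 1 zero_le_one (one_le_mul_of_one_le_of_one_le (by linarith) y1')
    rw [one_mul] at this
    refine le_trans (pow_le_pow_of_le_one (by positivity) (inv_le_one_of_one_le₀ hA0.le) (by omega)) this
  · exact dec (K * k) (by positivity) (mul_le_mul (by linarith) ky' (by positivity) (by positivity))

theorem low_core {ξ A0 B0 x0 F ζ V : ℝ} (hξ : 0 < ξ) (hA0 : 1 < A0) (hB0 : A0 ≤ B0) (hx : Transcendental ℤ x0) {f : ℝ → ℝ}
    (hf : ContDiff ℝ 1 f) (pf : Function.Periodic f 1) (m0 : ∫ y in (0:ℝ)..1, f y = 0) (f1 : ∀ y, |f y| ≤ 1)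
    (hF : ∀ y, |deriv f y| ≤ F) (hV : V = ∫ y in (0:ℝ)..1, f y ^ 2) (V0 : 0 < V) (V1 : V ≤ 1) (hζ : 0 < ζ) (hζ1 : ζ ≤ 1/4) :
    ∃ r > (0:ℝ), ∃ L : ℕ, 1 ≤ L ∧ ∀ A B : ℝ, A0 ≤ A → A ≤ B → B ≤ B0 → x0 - r ≤ A → B ≤ x0 + r → ∀ b : ℕ, 1 ≤ b →
      ∀ᵐ x ∂(volume.restrict (Set.Ioc A B)), ∃ᶠ k : ℕ in atTop,
        (1 - 3 * ζ) * Real.sqrt (2 * V * ((16 ^ (4 * b * (k + 1)) - 2 * 16 ^ (4 * b * k)) / L * L : ℕ) * Real.log k) <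
        ∑ n ∈ Finset.Ioc (2 * 16 ^ (4 * b * k)) (2 * 16 ^ (4 * b * k) + (16 ^ (4 * b * (k + 1)) - 2 * 16 ^ (4 * b * k)) / L * L), f (ξ * x ^ n) := by
  have ζ2 : ζ ^ 2 ≤ 1 := pow_le_one₀ hζ.le (by linarith)
  have η1 : V * ζ ^ 2 / 4 ≤ V / 4 := by
    have := mul_le_mul_of_nonneg_left ζ2 V0.le
    linarith
  obtain ⟨r, hr, L, hL, lam0, hl0, n0, C, hC, key⟩ := mgf hξ hA0 hB0 hx hf pf m0 f1 hF (by positivity : 0 < V * ζ ^ 2 / 4) (by linarith) hV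
  refine ⟨r, hr, L, hL, fun A B hA hAB hB hrA hrB b hb => ?_⟩
  obtain ⟨Cs, hCs1, hCs⟩ := st_deriv
  have F0 : 0 ≤ F := (abs_nonneg _).trans (hF 0)
  have A1 : 0 < A0 - 1 := by linarith
  set K := Cs * F * ξ / ζ with hKd
  have K0 : 0 ≤ K := by positivity
  obtain ⟨k1, ev⟩ := (low_ev hA0 V0 V1 hζ hl0 (by positivity : 0 ≤ K * (A0 / (A0 - 1))) hL hb n0).exists_forall_of_atTop
  set P : ℕ → ℕ := fun k => 16 ^ (4 * b * k) with hP
  have hPm : Monotone P := fun i j h => Nat.pow_le_pow_right (by norm_num) (Nat.mul_le_mul_left _ h)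
  set q : ℕ → ℕ := fun k => (P (k + 1) - 2 * P k) / L with hq
  set t : ℕ → ℝ := fun k => Real.sqrt (2 * V * (q k * L : ℕ) * Real.log k) with ht
  set S : ℕ → ℝ → ℝ := fun k x => ∑ n ∈ Finset.Ioc (2 * P k) (2 * P k + q k * L), f (ξ * x ^ n) with hS
  have cf := hf.continuous
  have cS : ∀ k, Continuous (S k) := fun k => by rw [hS]; fun_prop
  set c := 1 - ζ with hc
  set g : ℕ → ℝ → ℝ := fun k x => 1 - Real.smoothTransition ((S k x - (c - 2 * ζ) * t k) / (ζ * t k)) / 2 with hg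
  have gf : ∀ k ≥ k1, ContDiff ℝ 1 (g k) ∧ ∀ x, 0 ≤ x → 1/2 ≤ g k x ∧ g k x ≤ 1 ∧ |x * deriv (g k) x| ≤ K * UU (P (k + 1)) x * g k x := by
    intro k hk
    obtain ⟨k1', T1, T12, hh⟩ := ev k hk
    obtain ⟨l0, t1, -, -, -, -⟩ := hh _ rfl
    have t1' : 1 ≤ t k := t1
    have E1 : 2 * P k + q k * L ≤ P (k + 1) := by
      have : q k * L ≤ P (k + 1) - 2 * P k := Nat.div_mul_le_self _ _
      have : 2 * P k ≤ P (k + 1) := by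
        calc 2 * P k ≤ 16 ^ (4 * b) * P k := Nat.mul_le_mul_right _ (le_trans (by norm_num) (Nat.pow_le_pow_right (by norm_num) (by omega : 1 ≤ 4 * b)))
          _ = _ := by simp only [hP]; rw [← pow_add]; congr 1; ring
      omega
    have := g_facts (u := (c - 2 * ζ) * t k) (w := ζ * t k) hξ.le hf hF hCs (by positivity) (Nat.le_add_right (2 * P k) (q k * L)) E1 (g := g k) rfl
    refine ⟨this.1, fun x hx => ?_⟩
    obtain ⟨a1, a2, a3⟩ := this.2 x hx
    refine ⟨a1, a2, a3.trans ?_⟩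
    have u0 := UU_nonneg (P (k + 1)) hx
    have : Cs * F * ξ / (ζ * t k) ≤ K := by
      rw [hKd]; gcongr; nlinarith
    gcongr
  have null : ∀ k0 ≥ k1, volume.restrict (Set.Ioc A B) {x | ∀ j ≥ k0, S j x ≤ (c - 2 * ζ) * t j} = 0 := by
    intro k0 hk0
    have wf := W_facts (k0 := k0) K0 hPm fun j hj => gf j (hk0.trans hj)
    set W : ℕ → ℝ → ℝ := fun k x => ∏ j ∈ Finset.Ico k0 k, g j x with hW
    set Z : ℕ → ℝ := fun k => ∫ x in A..B, W k x with hZ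
    have pos : ∀ x ∈ Set.Icc A B, 0 ≤ x := fun x hx => by linarith [hx.1]
    have W0 : ∀ k, ∀ x ∈ Set.Icc A B, 0 ≤ W k x := fun k x hx =>
      Finset.prod_nonneg fun j hj => by
        have := ((gf j (hk0.trans (Finset.mem_Ico.1 hj).1)).2 x (pos x hx)).1
        linarith
    have Z0 : ∀ k, 0 ≤ Z k := fun k => intervalIntegral.integral_nonneg hAB (W0 k)
    have at0 : Tendsto (fun k => 2 * C * (A0⁻¹) ^ (2 * P k)) atTop (nhds 0) := by
      have yt : Tendsto (fun k : ℕ => 2 * P k) atTop atTop := by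
        apply tendsto_atTop_mono (fun k => ?_) tendsto_id
        calc k ≤ 4 * b * k := Nat.le_mul_of_pos_left _ (by omega)
          _ ≤ P k := (Nat.lt_pow_self (by norm_num)).le
          _ ≤ _ := by omega
      have := ((tendsto_pow_atTop_nhds_zero_of_lt_one (by positivity) (inv_lt_one_of_one_lt₀ hA0)).comp yt).const_mul (2 * C)
      rwa [mul_zero] at this
    have step : ∀ k ≥ k0, 2 * C * (A0⁻¹) ^ (2 * P k) ≤ Z k → Z (k + 1) ≤ Z k - Z k / (8 * k) := by
      intro k hk hZk
      obtain ⟨k1', T1, T12, hh⟩ := ev k (hk0.trans hk)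
      obtain ⟨l0, t1, tl, e1, e2, e3⟩ := hh _ rfl
      obtain ⟨cdW, wf⟩ := wf k hk
      have l0' : (0:ℝ) < (q k * L : ℕ) := l0
      set T := Real.log k with hT
      set ℓ : ℝ := ((q k * L : ℕ):ℝ) with hℓ
      set τ := Real.sqrt (2 * T / (V * ℓ)) with hτ
      have ttk : t k = Real.sqrt (2 * V * ℓ * T) := rfl
      have t1' : 1 ≤ t k := t1
      have e2' : (A0⁻¹) ^ (2 * P k) ≤ τ / 2 := e2
      have e3' : K * (A0 / (A0 - 1)) * k * (A0⁻¹) ^ (P k) ≤ τ / 2 := e3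
      have tl' : τ ≤ lam0 := tl
      have τ0 : 0 < τ := Real.sqrt_pos.2 (by positivity)
      have τ2 : τ ^ 2 = 2 * T / (V * ℓ) := Real.sq_sqrt (by positivity)
      have τt : τ * t k = 2 * T := by
        rw [hτ, ttk, ← Real.sqrt_mul (by positivity)]
        have : 2 * T / (V * ℓ) * (2 * V * ℓ * T) = (2 * T) ^ 2 := by field_simp
        rw [this, Real.sqrt_sq (by linarith)]
      have mg : ∀ θ : ℝ, 1/2 ≤ θ → θ ≤ 1 →
          (∫ x in A..B, W k x * Real.exp (θ * τ * S k x) ≤ Real.exp ((θ ^ 2 + ζ ^ 2 / 4) * T) * (3/2 * Z k)) ∧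
          Real.exp ((θ ^ 2 - ζ ^ 2 / 4) * T) * (Z k / 2) ≤ ∫ x in A..B, W k x * Real.exp (θ * τ * S k x) := by
        intro θ h1 h2
        have θτ : τ / 2 ≤ θ * τ := by
          have := mul_le_mul_of_nonneg_right h1 τ0.le
          linarith
        have θτ1 : θ * τ ≤ 1 * τ := mul_le_mul_of_nonneg_right h2 τ0.le
        have m := key A B hA hAB hB hrA hrB (θ * τ) (by positivity) (by linarith) (2 * P k) e1 (e2'.trans θτ) (W k) cdW (fun x hx => by
          obtain ⟨w0, w1, w2⟩ := wf x (pos x hx)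
          refine ⟨w0, w1, w2.trans (mul_le_mul_of_nonneg_right ?_ w0)⟩
          have x0 := pos x hx
          have u1 := UU_le hA0 (hA.trans hx.1) (by omega : P k ≤ 2 * P k)
          have u2 : ((2 * P k : ℕ):ℝ) * x ^ (2 * P k) ≤ UU (2 * P k) x := by
            have : 1 ≤ 2 * P k := by
              have : 1 ≤ P k := Nat.one_le_pow _ _ (by norm_num)
              omega
            exact Finset.single_le_sum (f := fun n : ℕ => (n:ℝ) * x ^ n) (fun i _ => by positivity) (Finset.mem_Icc.2 ⟨this, le_rfl⟩)
          have e : 2 * P k - P k = P k := by omega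
          rw [e] at u1
          have u0 := UU_nonneg (2 * P k) x0
          calc K * k * UU (P k) x ≤ K * k * (A0 / (A0 - 1) * (A0⁻¹) ^ (P k) * UU (2 * P k) x) := by
                refine mul_le_mul_of_nonneg_left (u1.trans ?_) (by positivity)
                exact mul_le_mul_of_nonneg_left u2 (by positivity)
            _ = (K * (A0 / (A0 - 1)) * k * (A0⁻¹) ^ (P k)) * UU (2 * P k) x := by ring
            _ ≤ _ := mul_le_mul_of_nonneg_right (e3'.trans θτ) u0) (q k)
        have lq : (q k : ℝ) = ℓ / L := by
          have : (L:ℝ) ≠ 0 := by exact_mod_cast (by omega)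
          rw [hℓ]; push_cast; field_simp
        have L0 : (0:ℝ) < L := by exact_mod_cast hL
        have x1 : (θ * τ) ^ 2 * L * (V + V * ζ ^ 2 / 4) / 2 * q k = (θ ^ 2 + θ ^ 2 * (ζ ^ 2 / 4)) * T := by
          rw [mul_pow, τ2, lq]; field_simp
        have x2 : (θ * τ) ^ 2 * L * (V - V * ζ ^ 2 / 4) / 2 * q k = (θ ^ 2 - θ ^ 2 * (ζ ^ 2 / 4)) * T := by
          rw [mul_pow, τ2, lq]; field_simp
        have x3 : θ ^ 2 * (ζ ^ 2 / 4) ≤ 1 * (ζ ^ 2 / 4) := by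
          gcongr; exact pow_le_one₀ (by linarith) h2
        rw [x1, x2] at m
        have Zk : (∫ x in A..B, W k x) = Z k := rfl
        rw [Zk] at m
        constructor
        · refine m.1.trans (mul_le_mul (Real.exp_le_exp.2 (mul_le_mul_of_nonneg_right (by linarith) (by linarith))) (by linarith) ?_ (Real.exp_pos _).le)
          have := Z0 k
          positivity
        · refine le_trans (mul_le_mul (Real.exp_le_exp.2 (mul_le_mul_of_nonneg_right (by linarith) (by linarith))) (by linarith) ?_ (Real.exp_pos _).le) (m.2 (by linarith))
          have := Z0 k
          positivity
      have tl := tilt (Z := Z k) hAB cdW.continuous (cS k) (W0 k) hζ hc T12 (by linarith) (by linarith) τt τ0 (Z0 k) (by linarith)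
        (mg c (by linarith) (by linarith)).2 (mg (c + ζ) (by linarith) (by linarith)).1 (mg (c - ζ) (by linarith) (by linarith)).1
      have kp : (0:ℝ) < k := by exact_mod_cast k1'
      rw [hT, Real.exp_neg, Real.exp_log kp] at tl
      have cW := cdW.continuous
      have cSk := cS k
      have cs := Real.smoothTransition.continuous
      have e : Z (k + 1) = Z k - 1/2 * ∫ x in A..B, W k x * Real.smoothTransition ((S k x - (c - 2 * ζ) * t k) / (ζ * t k)) := by
        rw [← intervalIntegral.integral_const_mul, hZ]
        simp only
        rw [← intervalIntegral.integral_sub (Continuous.intervalIntegrable cW _ _) (Continuous.intervalIntegrable (by fun_prop) _ _)]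
        congr 1; ext x
        simp only [hW]
        rw [Finset.prod_Ico_succ_top hk]
        simp only [hg]; ring
      rw [e]
      have : Z k / (8 * k) = 1/2 * (Z k / 4 * (k:ℝ)⁻¹) := by field_simp; ring
      rw [this]; linarith
    by_contra hne
    have hfin : volume.restrict (Set.Ioc A B) {x | ∀ j ≥ k0, S j x ≤ (c - 2 * ζ) * t j} ≠ ⊤ := measure_ne_top _ _
    obtain ⟨k, hk, hlt⟩ := diverge Z0 at0 (k0 := max k0 1) (fun k hk => step k (le_of_max_le_left hk)) (le_max_right _ _) (ENNReal.toReal_pos hne hfin)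
    have hk' : k0 ≤ k := le_of_max_le_left hk
    have sub : {x | ∀ j ≥ k0, S j x ≤ (c - 2 * ζ) * t j} ⊆ {x | 1 ≤ W k x} := by
      intro x hx
      have : W k x = 1 := Finset.prod_eq_one fun j hj => by
        have h1 := (Finset.mem_Ico.1 hj).1
        have h2 := hx j h1
        obtain ⟨-, -, -, hh⟩ := ev j (hk0.trans h1)
        obtain ⟨-, t1, -⟩ := hh _ rfl
        have t1' : 1 ≤ t j := t1
        simp only [hg]
        rw [Real.smoothTransition.zero_of_nonpos (div_nonpos_of_nonpos_of_nonneg (by linarith) (by positivity))]; ring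
      exact this.ge
    have mk := mul_meas_ge_le_integral_of_nonneg (μ := volume.restrict (Set.Ioc A B)) (f := W k)
      ((ae_restrict_iff' measurableSet_Ioc).2 (ae_of_all _ fun x hx => W0 k x (Set.Ioc_subset_Icc_self hx)))
      ((wf k hk').1.continuous.intervalIntegrable A B).1 1
    rw [one_mul] at mk
    have ZZ : ∫ x in Set.Ioc A B, W k x = Z k := (intervalIntegral.integral_of_le hAB).symm
    rw [ZZ] at mk
    have := measureReal_mono (μ := volume.restrict (Set.Ioc A B)) sub
    have h3 : (volume.restrict (Set.Ioc A B)).real {x | ∀ j ≥ k0, S j x ≤ (c - 2 * ζ) * t j} = (volume.restrict (Set.Ioc A B) {x | ∀ j ≥ k0, S j x ≤ (c - 2 * ζ) * t j}).toReal := rfl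
    linarith
  have al : ∀ᵐ x ∂(volume.restrict (Set.Ioc A B)), ∀ k0 ≥ k1, ¬ ∀ j ≥ k0, S j x ≤ (c - 2 * ζ) * t j := by
    simp only [ae_all_iff]
    intro k0 hk0
    rw [ae_iff]
    simpa only [not_not] using null k0 hk0
  filter_upwards [al] with x hx
  rw [frequently_atTop]
  intro a
  have := hx (max a k1) (le_max_right _ _)
  push Not at this
  obtain ⟨j, hj, h⟩ := this
  refine ⟨j, le_of_max_le_left hj, ?_⟩
  have e : c - 2 * ζ = 1 - 3 * ζ := by rw [hc]; ring
  rw [e] at h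
  exact h

theorem low_log {ζ : ℝ} (hζ : 0 < ζ) (hζ1 : ζ ≤ 1) {b : ℕ} (hb : 1 ≤ b) (M0 : ℝ) : ∀ᶠ k : ℕ in atTop, ∀ N : ℕ,
    N ≤ 16 ^ (4 * b * (k + 1)) → 16 ^ (4 * b * (k + 1)) ≤ 4 * N →
      0 ≤ Real.log k ∧ Real.log k ≤ Real.log (Real.log N) ∧ (1 - ζ) * Real.log (Real.log N) ≤ Real.log k ∧
      Real.log (b * (k + 1) + 1 : ℕ) ≤ 4 * Real.log (Real.log N) ∧ M0 ≤ Real.log (Real.log N) := by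
  have lgt := Real.tendsto_log_atTop.comp tendsto_natCast_atTop_atTop
  filter_upwards [eventually_ge_atTop 2, lgt.eventually_ge_atTop (Real.log (24 * b) / ζ), lgt.eventually_ge_atTop (Real.log (3 * b)),
    lgt.eventually_ge_atTop M0] with k k2 h1 h2 h3 N n1 n2
  simp only [Function.comp] at h1 h2 h3
  have k2' : (2:ℝ) ≤ k := by exact_mod_cast k2
  have b1' : (1:ℝ) ≤ b := by exact_mod_cast hb
  have N1 : 16 ^ k ≤ N := by
    have : 16 ^ (k + 1) ≤ 16 ^ (4 * b * (k + 1)) := Nat.pow_le_pow_right (by norm_num) (Nat.le_mul_of_pos_left _ (by omega))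
    rw [pow_succ] at this; omega
  have N1' : (16:ℝ) ^ k ≤ N := by exact_mod_cast N1
  have n1' : (N:ℝ) ≤ 16 ^ (4 * b * (k + 1)) := by exact_mod_cast n1
  have N0 : (0:ℝ) < N := lt_of_lt_of_le (by positivity) N1'
  have l16 : 1 ≤ Real.log 16 := by
    rw [Real.le_log_iff_exp_le (by norm_num)]; linarith [Real.exp_one_lt_d9]
  have l16' : Real.log 16 ≤ 3 := by
    rw [Real.log_le_iff_le_exp (by norm_num)]
    have : Real.exp 3 = Real.exp 1 ^ 3 := by rw [← Real.exp_nat_mul]; norm_num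
    rw [this]
    calc (16:ℝ) ≤ 2.7 ^ 3 := by norm_num
      _ ≤ _ := by gcongr; linarith [Real.exp_one_gt_d9]
  have a1 : (k:ℝ) ≤ Real.log N := by
    have := Real.log_le_log (by positivity) N1'
    rw [Real.log_pow] at this
    have : (k:ℝ) * 1 ≤ k * Real.log 16 := by gcongr
    linarith
  have a2 : Real.log N ≤ 24 * b * k := by
    have := Real.log_le_log N0 n1'
    rw [Real.log_pow] at this
    push_cast at this
    calc Real.log N ≤ 4 * b * (k + 1) * Real.log 16 := this
      _ ≤ 4 * b * (k + k) * 3 := by gcongr; linarith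
      _ = _ := by ring
  have b1 := Real.log_le_log (by linarith) a1
  have b2 := Real.log_le_log (by linarith) a2
  rw [Real.log_mul (by positivity) (by positivity)] at b2
  have l0 : 0 ≤ Real.log k := Real.log_nonneg (by linarith)
  rw [div_le_iff₀ hζ] at h1
  refine ⟨l0, b1, ?_, ?_, by linarith⟩
  · have := mul_le_mul_of_nonneg_left b2 (by linarith : 0 ≤ 1 - ζ)
    have l24 : 0 ≤ Real.log (24 * b) := Real.log_nonneg (by linarith)
    have : 0 ≤ ζ * Real.log (24 * b) := by positivity
    linarith
  · have : ((b * (k + 1) + 1 : ℕ):ℝ) ≤ 3 * b * k := by push_cast; nlinarith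
    have := Real.log_le_log (by positivity) this
    rw [Real.log_mul (by positivity) (by positivity)] at this
    linarith

theorem sqrt_lo {ζ V ℓ N lg Λ : ℝ} (hζ : 0 ≤ ζ) (hζ1 : ζ ≤ 1/4) (hN : 0 ≤ N) (hΛ : 0 ≤ Λ) (hV : (1 - ζ) / 4 ≤ V) (hℓ : (1 - ζ) * N ≤ ℓ)
    (hlg : (1 - ζ) * Λ ≤ lg) : (1 / Real.sqrt 2 - 5 * ζ) * (Real.sqrt N * Real.sqrt Λ) ≤ (1 - 3 * ζ) * Real.sqrt (2 * V * ℓ * lg) := by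
  have u0 : 0 ≤ 1 - ζ := by linarith
  set Q := Real.sqrt N * Real.sqrt Λ with hQ
  have Q0 : 0 ≤ Q := by positivity
  have h1 : (1 - ζ) ^ 2 * (1 / Real.sqrt 2 * Q) ≤ Real.sqrt (2 * V * ℓ * lg) := by
    apply Real.le_sqrt_of_sq_le
    calc ((1 - ζ) ^ 2 * (1 / Real.sqrt 2 * Q)) ^ 2 = (1 - ζ) ^ 4 * (Real.sqrt N ^ 2 * Real.sqrt Λ ^ 2) / Real.sqrt 2 ^ 2 := by rw [hQ]; ring
      _ = 2 * ((1 - ζ) / 4) * ((1 - ζ) * N) * ((1 - ζ) * Λ) * (1 - ζ) := by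
        rw [Real.sq_sqrt hN, Real.sq_sqrt hΛ, Real.sq_sqrt (by norm_num)]; ring
      _ ≤ 2 * V * ℓ * lg * 1 := by
        have V0 : 0 ≤ V := le_trans (by positivity) hV
        have l0 : 0 ≤ ℓ := (mul_nonneg u0 hN).trans hℓ
        have lg0 : 0 ≤ lg := (mul_nonneg u0 hΛ).trans hlg
        gcongr; linarith
      _ = _ := by ring
  have s2 : 1 / Real.sqrt 2 ≤ 1 := by
    rw [div_le_one (by positivity)]; exact Real.one_le_sqrt.2 (by norm_num)
  have p : 1 - 5 * ζ ≤ (1 - 3 * ζ) * (1 - ζ) ^ 2 := by nlinarith [mul_nonneg hζ hζ]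
  calc (1 / Real.sqrt 2 - 5 * ζ) * Q ≤ (1 / Real.sqrt 2 - 5 * ζ * (1 / Real.sqrt 2)) * Q := by
        refine mul_le_mul_of_nonneg_right ?_ Q0
        have := mul_le_mul_of_nonneg_left s2 (by positivity : 0 ≤ 5 * ζ)
        linarith
    _ = (1 - 5 * ζ) * (1 / Real.sqrt 2 * Q) := by ring
    _ ≤ (1 - 3 * ζ) * (1 - ζ) ^ 2 * (1 / Real.sqrt 2 * Q) := by gcongr
    _ = (1 - 3 * ζ) * ((1 - ζ) ^ 2 * (1 / Real.sqrt 2 * Q)) := by ring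
    _ ≤ _ := by
      gcongr; linarith

theorem lower {ξ A0 B0 x0 ε : ℝ} (hξ : 0 < ξ) (hA0 : 1 < A0) (hB0 : A0 ≤ B0) (hx : Transcendental ℤ x0)
    (hε : 0 < ε) (hε1 : ε ≤ 1) :
    ∃ r > (0:ℝ), ∀ A B : ℝ, A0 ≤ A → A ≤ B → B ≤ B0 → x0 - r ≤ A → B ≤ x0 + r →
      ∀ᵐ x ∂(volume.restrict (Set.Ioc A B)), ∃ᶠ N : ℕ in atTop,
        (1 / Real.sqrt 2 - ε) * (Real.sqrt N * Real.sqrt (Real.log (Real.log N))) ≤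
        ∑ n ∈ Finset.Ioc 0 N, Set.indicator (Set.Ico 0 (1/2)) (fun _ => (1:ℝ)) (Int.fract (ξ * x ^ n)) - N * (1/2) := by
  obtain ⟨Cc, hCc, chain⟩ := chain_ae hξ hA0 hB0
  obtain ⟨m, hm⟩ := geo_small (Cc * 1024 + 8) (by positivity) (by positivity : 0 < ε / 20)
  have m16 : 8 / (16:ℝ) ^ (m + 1) ≤ 8 * (2/3) ^ m := by
    rw [div_eq_mul_inv, ← inv_pow]
    gcongr
    calc ((16:ℝ)⁻¹) ^ (m + 1) ≤ (16⁻¹) ^ m := pow_le_pow_of_le_one (by norm_num) (by norm_num) (by omega)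
      _ ≤ _ := by gcongr; norm_num
  have pm : (0:ℝ) < (2/3) ^ m := by positivity
  have hm1 : 0 ≤ Cc * (2/3) ^ m := by positivity
  obtain ⟨C, hC1, hC⟩ := st_deriv
  set f := bb (m + 1) 0 (24 * 16 ^ m - 1) with hf
  obtain ⟨g1, g2, g3, g4, g5, g6⟩ := bb_facts hC (m + 1) 0 (24 * 16 ^ m - 1)
  rw [← hf] at g1 g2 g3 g4 g5 g6
  obtain ⟨Cb, hCb, base⟩ := base_ae (D := 2 * C * 16 ^ (m + 1 + 1)) hξ hA0 hB0 (by positivity)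
  have base := base f (bb_cls hC1 hC (m + 1) 0 (24 * 16 ^ m - 1)).1
  rw [(bb_cls hC1 hC (m + 1) 0 (24 * 16 ^ m - 1)).2, ← hf] at base
  have hv := half_var m
  rw [← hf] at hv
  set V := ∫ y in (0:ℝ)..1, f y ^ 2 with hV
  have v16 : 8 / (16:ℝ) ^ (m + 1) = 4 * (2 / 16 ^ (m + 1)) := by ring
  have V1 : (1 - ε / 20) / 4 ≤ V := by linarith
  obtain ⟨r, hr, L, hL, core⟩ := low_core hξ hA0 hB0 hx g1 g2 g3 g4 g5 hV (by linarith) (by linarith) (by positivity : 0 < ε / 20) (by linarith)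
  obtain ⟨b', hb'⟩ := geo_small (Cb * 1024 + 8) (by positivity) (by positivity : 0 < ε / 20)
  set b := b' + 1 with hbd
  have hb : 1 ≤ b := by omega
  have b16 : ((16:ℝ) ^ (2 * b))⁻¹ ≤ (2/3) ^ b' := by
    rw [← inv_pow]
    calc ((16:ℝ)⁻¹) ^ (2 * b) ≤ (16⁻¹) ^ b' := pow_le_pow_of_le_one (by norm_num) (by norm_num) (by omega)
      _ ≤ _ := by gcongr; norm_num
  have pb : (0:ℝ) < (2/3) ^ b' := by positivity
  have hb1 : 0 ≤ Cb * (2/3) ^ b' := by positivity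
  refine ⟨r, hr, fun A B hA hAB hB h1 h2 => ?_⟩
  have sub : ∀ {p : ℝ → Prop}, (∀ᵐ x ∂(volume.restrict (Set.Ioc A0 B0)), p x) → ∀ᵐ x ∂(volume.restrict (Set.Ioc A B)), p x :=
    fun h => ae_restrict_of_ae_restrict_of_subset (Set.Ioc_subset_Ioc hA hB) h
  filter_upwards [core A B hA hAB hB h1 h2 b hb, sub base, sub (chain (m + 1))] with x x1 x2 x3
  have kle : ∀ k : ℕ, k ≤ b * k := fun k => Nat.le_mul_of_pos_left _ hb
  have t1 : Tendsto (fun k : ℕ => b * k + 1) atTop atTop := tendsto_atTop_mono (fun k => (kle k).trans (Nat.le_succ _)) tendsto_id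
  have t2 : Tendsto (fun k : ℕ => b * (k + 1) + 1) atTop atTop := tendsto_atTop_mono (fun k => (Nat.le_succ k).trans ((kle (k + 1)).trans (Nat.le_succ _))) tendsto_id
  have kP : ∀ k : ℕ, k ≤ 16 ^ (4 * b * k) := fun k =>
    (Nat.le_mul_of_pos_left k (by omega : 0 < 4 * b)).trans (Nat.lt_pow_self (by norm_num)).le
  have tE : Tendsto (fun k : ℕ => 2 * 16 ^ (4 * b * k) + (16 ^ (4 * b * (k + 1)) - 2 * 16 ^ (4 * b * k)) / L * L) atTop atTop :=
    tendsto_atTop_mono (fun k => by have := kP k; simp only [id]; omega) tendsto_id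
  refine tE.frequently ?_
  refine (x1.and_eventually ((t1.eventually x2).and ((t2.eventually x3).and ((low_log (by positivity : 0 < ε / 20) (by linarith) hb ((24 / ε) ^ 2)).and
    (eventually_ge_atTop (L + m + 1)))))).mono ?_
  rintro k ⟨y1, y2, y3, y4, y5⟩
  have PP : 16 ^ (4 * b * (k + 1)) = 16 ^ (4 * b) * 16 ^ (4 * b * k) := by rw [← pow_add]; congr 1; ring
  have P16 : 16 * 16 ^ (4 * b * k) ≤ 16 ^ (4 * b) * 16 ^ (4 * b * k) :=
    Nat.mul_le_mul_right _ (le_trans (by norm_num) (Nat.pow_le_pow_right (by norm_num) (by omega : 1 ≤ 4 * b)))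
  have kPk := kP k
  set P := 16 ^ (4 * b * k) with hP
  have dm := Nat.div_add_mod' (16 ^ (4 * b * (k + 1)) - 2 * P) L
  have ml := Nat.mod_lt (16 ^ (4 * b * (k + 1)) - 2 * P) hL
  set w := (16 ^ (4 * b * (k + 1)) - 2 * P) / L * L with hw
  set N := 2 * P + w with hN
  set P' := 16 ^ (4 * b * (k + 1)) with hP'
  have NP : N ≤ P' := by omega
  have PN : P' ≤ 4 * N := by omega
  obtain ⟨lg0, lgl, lgu, lκ, lM⟩ := y4 N NP PN
  set Λ := Real.log (Real.log N) with hΛ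
  have Λ0 : 0 ≤ Λ := lg0.trans lgl
  set Q := Real.sqrt N * Real.sqrt Λ with hQ
  have Q0 : 0 ≤ Q := by positivity
  have sκ : ∀ κ : ℕ, 1 ≤ κ → κ ≤ b * (k + 1) + 1 → Real.sqrt (Real.log κ) ≤ 2 * Real.sqrt Λ := by
    intro κ h1 h2
    have h1' : (0:ℝ) < κ := by exact_mod_cast h1
    have h2' : (κ:ℝ) ≤ (b * (k + 1) + 1 : ℕ) := by exact_mod_cast h2
    have := Real.sqrt_le_sqrt ((Real.log_le_log h1' h2').trans lκ)
    rwa [Real.sqrt_mul (by norm_num), (by norm_num : (4:ℝ) = 2 ^ 2), Real.sqrt_sq (by norm_num)] at this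
  have sN : (16:ℝ) ^ (2 * (b * (k + 1))) ≤ 2 * Real.sqrt N := by
    have : Real.sqrt (((16:ℝ) ^ (2 * (b * (k + 1)))) ^ 2) ≤ Real.sqrt (4 * N) := by
      apply Real.sqrt_le_sqrt
      have : (P':ℝ) ≤ 4 * N := by exact_mod_cast PN
      refine le_trans (le_of_eq ?_) this
      rw [hP', ← pow_mul]; push_cast; congr 1; ring
    rwa [Real.sqrt_sq (by positivity), Real.sqrt_mul (by norm_num), (by norm_num : (4:ℝ) = 2 ^ 2), Real.sqrt_sq (by norm_num)] at this
  have eP : P' = 16 ^ (4 * (b * (k + 1))) := by rw [hP', mul_assoc]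
  have N4 : N < 16 ^ (4 * (b * (k + 1) + 1)) := by
    have : 16 ^ (4 * (b * (k + 1) + 1)) = 65536 * P' := by rw [eP, mul_add, pow_add]; ring
    rw [this]
    have : 1 ≤ P' := Nat.one_le_pow _ _ (by norm_num)
    omega
  have P4 : 2 * P < 16 ^ (4 * (b * k + 1)) := by
    have : 16 ^ (4 * (b * k + 1)) = 65536 * P := by rw [hP, mul_add, pow_add, ← mul_assoc]; ring
    rw [this]
    have : 1 ≤ P := Nat.one_le_pow _ _ (by norm_num)
    omega
  -- base part
  have c1 := y2 0 (by omega) (2 * P) P4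
  rw [Nat.sub_zero, Nat.div_eq_of_lt P4, zero_mul, pow_zero, mul_one] at c1
  have c2 : Cb * (16 ^ (2 * (b * k + 1)) * Real.sqrt (Real.log (b * k + 1 : ℕ))) ≤ ε / 20 * Q := by
    have s1 := sκ (b * k + 1) (by omega) (by gcongr; omega)
    have s3 : (16:ℝ) ^ (2 * (b * k + 1)) ≤ 512 * Real.sqrt N * (2/3) ^ b' := by
      calc (16:ℝ) ^ (2 * (b * k + 1)) = 256 * 16 ^ (2 * (b * (k + 1))) * (16 ^ (2 * b))⁻¹ := by
            rw [eq_mul_inv_iff_mul_eq₀ (by positivity), ← pow_add, (by norm_num : (256:ℝ) = 16 ^ 2), ← pow_add]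
            congr 1; ring
        _ ≤ 256 * (2 * Real.sqrt N) * (2/3) ^ b' := by gcongr
        _ = _ := by ring
    calc _ ≤ Cb * (512 * Real.sqrt N * (2/3) ^ b' * (2 * Real.sqrt Λ)) := by gcongr
      _ = (Cb * 1024 * (2/3) ^ b') * Q := by rw [hQ]; ring
      _ ≤ _ := by gcongr; linarith
  -- chain part
  obtain ⟨d, hd⟩ : ∃ d, 2 * (b * (k + 1) + 1) = m + 1 + d := ⟨2 * (b * (k + 1) + 1) - (m + 1), by have := kle (k + 1); omega⟩
  have d1 : d ≠ 0 := by have := kle (k + 1); omega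
  have c3 := y3 N N4 d hd.ge 1 (by
    have : 1 ≤ 16 ^ (m + 1 + d) := Nat.one_le_pow _ _ (by norm_num)
    omega) (24 * 16 ^ (m + d) - 1) (by
    have : 16 ^ (m + 1 + d) = 16 * 16 ^ (m + d) := by rw [← pow_succ']; congr 1; omega
    have : 1 ≤ 16 ^ (m + d) := Nat.one_le_pow _ _ (by norm_num)
    omega)
  rw [half_div, Nat.div_eq_of_lt (Nat.one_lt_pow d1 (by norm_num)), ← hf] at c3
  have c4 : Cc * (2/3) ^ (m + 1) * (16 ^ (2 * (b * (k + 1) + 1)) * Real.sqrt (Real.log (b * (k + 1) + 1 : ℕ))) ≤ ε / 20 * Q := by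
    have s1 := sκ (b * (k + 1) + 1) (by omega) le_rfl
    have s3 : (16:ℝ) ^ (2 * (b * (k + 1) + 1)) ≤ 512 * Real.sqrt N := by
      calc (16:ℝ) ^ (2 * (b * (k + 1) + 1)) = 256 * 16 ^ (2 * (b * (k + 1))) := by ring
        _ ≤ 256 * (2 * Real.sqrt N) := by gcongr
        _ = _ := by ring
    have s4 : (2/3:ℝ) ^ (m + 1) ≤ (2/3) ^ m := pow_le_pow_of_le_one (by norm_num) (by norm_num) (by omega)
    calc _ ≤ Cc * (2/3) ^ m * (512 * Real.sqrt N * (2 * Real.sqrt Λ)) := by gcongr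
      _ = (Cc * 1024 * (2/3) ^ m) * Q := by rw [hQ]; ring
      _ ≤ _ := by gcongr; linarith
  have hl := half_lo (z := fun n => ξ * x ^ n) (s := Finset.Ioc 0 N) (m + d)
  rw [Nat.card_Ioc, Nat.sub_zero, (by omega : m + d + 1 = m + 1 + d), ← hd] at hl
  rw [← hd] at c3
  have c5 : 3 * (N:ℝ) / 16 ^ (2 * (b * (k + 1) + 1)) ≤ ε / 8 * Q := by
    have s1 : Real.sqrt N ≤ 16 ^ (2 * (b * (k + 1) + 1)) := by
      rw [Real.sqrt_le_left (by positivity), ← pow_mul, mul_right_comm]; exact_mod_cast N4.le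
    have s2 : 24 / ε ≤ Real.sqrt Λ := Real.le_sqrt_of_sq_le lM
    rw [div_le_iff₀ (by positivity)]
    calc 3 * (N:ℝ) = ε / 8 * (Real.sqrt N * (24 / ε)) * Real.sqrt N := by
          have := Real.mul_self_sqrt (Nat.cast_nonneg (α := ℝ) N)
          field_simp; linarith
      _ ≤ ε / 8 * (Real.sqrt N * Real.sqrt Λ) * 16 ^ (2 * (b * (k + 1) + 1)) := by gcongr
  -- main part
  have wN : (1 - ε / 20) * (N:ℝ) ≤ (w:ℕ) := by
    have e1 : (N:ℝ) = 2 * P + w := by rw [hN]; push_cast; ring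
    have e2 : (16:ℝ) ^ (4 * b) * P ≤ 4 * N := by rw [PP] at PN; exact_mod_cast PN
    have e3 : ((16:ℝ) ^ (4 * b))⁻¹ ≤ (2/3) ^ b' := by
      refine le_trans ?_ b16
      gcongr
      · norm_num
      · norm_num
    have e4 : (P:ℝ) ≤ (2/3) ^ b' * (4 * N) := by
      calc (P:ℝ) = (16 ^ (4 * b))⁻¹ * (16 ^ (4 * b) * P) := by field_simp
        _ ≤ _ := by gcongr
    have e5 : 8 * (2/3) ^ b' * (N:ℝ) ≤ ε / 20 * N := by gcongr; linarith
    linarith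
  have c6 := sqrt_lo (by positivity : 0 ≤ ε / 20) (by linarith) (Nat.cast_nonneg N) Λ0 V1 wN lgu
  have sp := Finset.sum_Ioc_consecutive (fun n => f (ξ * x ^ n)) (Nat.zero_le (2 * P)) (Nat.le_add_right (2 * P) w)
  have c1' := (abs_le.1 c1).1
  have c3' := (abs_le.1 c3).1
  rw [← sp] at c3'
  rw [← hQ] at c6
  have ε5 : 5 * (ε / 20) = ε / 4 := by ring
  rw [ε5] at c6
  have εQ : 0 ≤ ε * Q := by positivity
  beta_reduce at hl c3'
  linarith

theorem limsup_of_bds {u : ℕ → ℝ} {c : ℝ} (h1 : ∀ n : ℕ, ∀ᶠ N in atTop, u N ≤ c + 1 / (n + 1))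
    (h2 : ∀ n : ℕ, ∃ᶠ N in atTop, c - 1 / (n + 1) ≤ u N) : limsup u atTop = c := by
  have bd : IsBoundedUnder (· ≤ ·) atTop u := ⟨_, h1 0⟩
  have cb : IsCoboundedUnder (· ≤ ·) atTop u := IsCoboundedUnder.of_frequently_ge (h2 0)
  have key : ∀ δ > (0:ℝ), ∃ n : ℕ, 1 / ((n:ℝ) + 1) < δ := fun δ hδ => exists_nat_one_div_lt hδ
  apply le_antisymm
  · refine le_of_forall_pos_le_add fun δ hδ => ?_
    obtain ⟨n, hn⟩ := key δ hδ
    exact (limsup_le_of_le cb (h1 n)).trans (by linarith)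
  · refine le_of_forall_pos_le_add fun δ hδ => ?_
    obtain ⟨n, hn⟩ := key δ hδ
    have := le_limsup_of_frequently_le (h2 n) bd
    linarith

theorem disc_le {N : ℕ} {z : ℕ → ℝ} {K : ℝ} (hN : 0 < N)
    (h : ∀ a b : ℝ, 0 ≤ a → a ≤ b → b ≤ 1 → |∑ n ∈ Finset.Ioc 0 N, Set.indicator (Set.Ico a b) (fun _ => (1:ℝ)) (z n) - N * (b - a)| ≤ K) :
    discrepancy N z ≤ K / N ∧ starDiscrepancy N z ≤ K / N ∧
    (∑ n ∈ Finset.Ioc 0 N, Set.indicator (Set.Ico 0 (1/2)) (fun _ => (1:ℝ)) (z n) - N * (1/2)) / N ≤ starDiscrepancy N z ∧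
    (∑ n ∈ Finset.Ioc 0 N, Set.indicator (Set.Ico 0 (1/2)) (fun _ => (1:ℝ)) (z n) - N * (1/2)) / N ≤ discrepancy N z := by
  have N0 : (0:ℝ) < N := by exact_mod_cast hN
  have e : Finset.Icc 1 N = Finset.Ioc 0 N := by ext; simp; omega
  have h' : ∀ a b : ℝ, 0 ≤ a → a ≤ b → b ≤ 1 → |(∑ n ∈ Finset.Icc 1 N, Set.indicator (Set.Ico a b) (fun _ => (1:ℝ)) (z n)) / N - (b - a)| ≤ K / N := by
    intro a b h0 h1 h2
    have q : ∀ S : ℝ, S / N - (b - a) = (S - N * (b - a)) / N := fun S => by field_simp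
    rw [e, q, abs_div, abs_of_pos N0]
    gcongr
    exact h a b h0 h1 h2
  have v : (∑ n ∈ Finset.Ioc 0 N, Set.indicator (Set.Ico 0 (1/2)) (fun _ => (1:ℝ)) (z n) - N * (1/2)) / N
      = (∑ n ∈ Finset.Icc 1 N, Set.indicator (Set.Ico 0 (1/2)) (fun _ => (1:ℝ)) (z n)) / N - 1/2 := by
    rw [e]; field_simp
  refine ⟨csSup_le ⟨_, 0, 1, le_rfl, zero_lt_one, le_rfl, rfl⟩ ?_, csSup_le ⟨_, 1, zero_lt_one, le_rfl, rfl⟩ ?_, ?_, ?_⟩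
  · rintro d ⟨a, b, h0, h1, h2, rfl⟩
    exact h' a b h0 h1.le h2
  · rintro d ⟨a, h0, h1, rfl⟩
    have := h' 0 a le_rfl h0.le h1
    rwa [sub_zero] at this
  · rw [v]
    refine (le_abs_self _).trans (le_csSup ⟨K / N, ?_⟩ ⟨1/2, by norm_num, by norm_num, rfl⟩)
    rintro d ⟨a, h0, h1, rfl⟩
    have := h' 0 a le_rfl h0.le h1
    rwa [sub_zero] at this
  · rw [v]
    refine (le_abs_self _).trans (le_csSup ⟨K / N, ?_⟩ ⟨0, 1/2, by norm_num, by norm_num, by norm_num, by rw [sub_zero]⟩)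
    rintro d ⟨a, b, h0, h1, h2, rfl⟩
    exact h' a b h0 h1.le h2

theorem final_ae (ξ : ℝ) (hξ : 0 < ξ) {ε : ℝ} (hε : 0 < ε) (hε1 : ε ≤ 1) : ∀ᵐ x : ℝ, 1 < x →
    (∀ᶠ N : ℕ in atTop, ∀ a b : ℝ, 0 ≤ a → a ≤ b → b ≤ 1 →
      |∑ n ∈ Finset.Ioc 0 N, Set.indicator (Set.Ico a b) (fun _ => (1:ℝ)) (Int.fract (ξ * x ^ n)) - N * (b - a)| ≤
        (1 / Real.sqrt 2 + ε) * (Real.sqrt N * Real.sqrt (Real.log (Real.log N)))) ∧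
    ∃ᶠ N : ℕ in atTop, (1 / Real.sqrt 2 - ε) * (Real.sqrt N * Real.sqrt (Real.log (Real.log N))) ≤
        ∑ n ∈ Finset.Ioc 0 N, Set.indicator (Set.Ico 0 (1/2)) (fun _ => (1:ℝ)) (Int.fract (ξ * x ^ n)) - N * (1/2) := by
  set p : ℝ → Prop := fun x => (∀ᶠ N : ℕ in atTop, ∀ a b : ℝ, 0 ≤ a → a ≤ b → b ≤ 1 →
      |∑ n ∈ Finset.Ioc 0 N, Set.indicator (Set.Ico a b) (fun _ => (1:ℝ)) (Int.fract (ξ * x ^ n)) - N * (b - a)| ≤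
        (1 / Real.sqrt 2 + ε) * (Real.sqrt N * Real.sqrt (Real.log (Real.log N)))) ∧
    ∃ᶠ N : ℕ in atTop, (1 / Real.sqrt 2 - ε) * (Real.sqrt N * Real.sqrt (Real.log (Real.log N))) ≤
        ∑ n ∈ Finset.Ioc 0 N, Set.indicator (Set.Ico 0 (1/2)) (fun _ => (1:ℝ)) (Int.fract (ξ * x ^ n)) - N * (1/2) with hp
  have tr : ∀ᵐ x : ℝ, Transcendental ℤ x := (Algebraic.countable ℤ ℝ).ae_notMem volume
  have loc : volume {x : ℝ | 1 < x ∧ Transcendental ℤ x ∧ ¬ p x} = 0 := by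
    apply measure_null_of_locally_null
    rintro x0 ⟨h1, h2, -⟩
    obtain ⟨r1, hr1, U⟩ := upper (A0 := (1 + x0) / 2) (B0 := x0 + 1) hξ (by linarith) (by linarith) h2 hε hε1
    obtain ⟨r2, hr2, L⟩ := lower (A0 := (1 + x0) / 2) (B0 := x0 + 1) hξ (by linarith) (by linarith) h2 hε hε1
    obtain ⟨r, hr, q1, q2, q3, q4⟩ : ∃ r > (0:ℝ), r ≤ r1 ∧ r ≤ r2 ∧ r ≤ 1 ∧ r ≤ (x0 - 1) / 2 :=
      ⟨min (min r1 r2) (min 1 ((x0 - 1) / 2)), by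
        have : 0 < (x0 - 1) / 2 := by linarith
        positivity,
        (min_le_left _ _).trans (min_le_left _ _), (min_le_left _ _).trans (min_le_right _ _),
        (min_le_right _ _).trans (min_le_left _ _), (min_le_right _ _).trans (min_le_right _ _)⟩
    have a1 := U (x0 - r) (x0 + r) (by linarith) (by linarith) (by linarith) (by linarith) (by linarith)
    have a2 := L (x0 - r) (x0 + r) (by linarith) (by linarith) (by linarith) (by linarith) (by linarith)
    have a3 : ∀ᵐ x ∂(volume.restrict (Set.Ioc (x0 - r) (x0 + r))), p x := by
      filter_upwards [a1, a2] with x b1 b2 using ⟨b1, b2⟩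
    rw [ae_restrict_iff' measurableSet_Ioc] at a3
    refine ⟨_, inter_mem_nhdsWithin _ (Ioc_mem_nhds (by linarith : x0 - r < x0) (by linarith : x0 < x0 + r)), ?_⟩
    refine measure_mono_null ?_ a3
    rintro x ⟨⟨-, -, hx⟩, hx'⟩ h
    exact hx (h hx')
  have loc' : ∀ᵐ x : ℝ, ¬ (1 < x ∧ Transcendental ℤ x ∧ ¬ p x) := by
    rw [ae_iff]; simpa only [not_not] using loc
  filter_upwards [tr, loc'] with x t1 t2 t3
  by_contra t4
  exact t2 ⟨t3, t1, t4⟩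

theorem stmt1 (ξ : ℝ) (hξ : 0 < ξ) :
    ∀ᵐ x : ℝ ∂volume, 1 < x →
      (Filter.atTop.limsup (fun N : ℕ =>
          Real.sqrt N * discrepancy N (fun n => Int.fract (ξ * x ^ n))
            / Real.sqrt (Real.log (Real.log N))) = 1 / Real.sqrt 2
       ∧ Filter.atTop.limsup (fun N : ℕ =>
          Real.sqrt N * starDiscrepancy N (fun n => Int.fract (ξ * x ^ n))
            / Real.sqrt (Real.log (Real.log N))) = 1 / Real.sqrt 2) := by
  have H : ∀ᵐ x : ℝ, ∀ n : ℕ, 1 < x → _ := ae_all_iff.2 fun n : ℕ => final_ae ξ hξ (ε := 1 / ((n:ℝ) + 1)) (by positivity)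
    (by rw [div_le_one (by positivity)]; have := Nat.cast_nonneg (α := ℝ) n; linarith)
  have big : ∀ᶠ N : ℕ in atTop, 0 < N ∧ 0 < Real.log (Real.log N) := by
    have := (Real.tendsto_log_atTop.comp (Real.tendsto_log_atTop.comp tendsto_natCast_atTop_atTop (α := ℕ))).eventually_gt_atTop 0
    filter_upwards [this, eventually_gt_atTop 0] with N h1 h2 using ⟨h2, h1⟩
  filter_upwards [H] with x Hx x1
  have up : ∀ {N : ℕ} {D K : ℝ}, 0 < N → 0 < Real.log (Real.log N) → D ≤ K * (Real.sqrt N * Real.sqrt (Real.log (Real.log N))) / N →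
      Real.sqrt N * D / Real.sqrt (Real.log (Real.log N)) ≤ K := by
    intro N D K hN hl h
    have N0 : (0:ℝ) < N := by exact_mod_cast hN
    have s0 := Real.sqrt_pos.2 hl
    rw [div_le_iff₀ s0]
    calc Real.sqrt N * D ≤ Real.sqrt N * (K * (Real.sqrt N * Real.sqrt (Real.log (Real.log N))) / N) := by gcongr
      _ = K * Real.sqrt (Real.log (Real.log N)) * (Real.sqrt N * Real.sqrt N) / N := by ring
      _ = _ := by rw [Real.mul_self_sqrt N0.le]; field_simp
  have dn : ∀ {N : ℕ} {D K S : ℝ}, 0 < N → 0 < Real.log (Real.log N) → K * (Real.sqrt N * Real.sqrt (Real.log (Real.log N))) ≤ S →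
      S / N ≤ D → K ≤ Real.sqrt N * D / Real.sqrt (Real.log (Real.log N)) := by
    intro N D K S hN hl h h'
    have N0 : (0:ℝ) < N := by exact_mod_cast hN
    have s0 := Real.sqrt_pos.2 hl
    rw [le_div_iff₀ s0]
    have h2 : K * (Real.sqrt N * Real.sqrt (Real.log (Real.log N))) / N ≤ D := le_trans (by gcongr) h'
    calc _ = K * Real.sqrt (Real.log (Real.log N)) * (Real.sqrt N * Real.sqrt N) / N := by rw [Real.mul_self_sqrt N0.le]; field_simp
      _ = Real.sqrt N * (K * (Real.sqrt N * Real.sqrt (Real.log (Real.log N))) / N) := by ring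
      _ ≤ _ := by gcongr
  constructor
  · refine limsup_of_bds (fun n => ?_) (fun n => ?_)
    · filter_upwards [big, (Hx n x1).1] with N b h
      exact up b.1 b.2 (disc_le b.1 h).1
    · refine ((Hx n x1).2.and_eventually (big.and (Hx n x1).1)).mono ?_
      rintro N ⟨h1, b, h⟩
      exact dn b.1 b.2 h1 (disc_le b.1 h).2.2.2
  · refine limsup_of_bds (fun n => ?_) (fun n => ?_)
    · filter_upwards [big, (Hx n x1).1] with N b h
      exact up b.1 b.2 (disc_le b.1 h).2.1
    · refine ((Hx n x1).2.and_eventually (big.and (Hx n x1).1)).mono ?_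
      rintro N ⟨h1, b, h⟩
      exact dn b.1 b.2 h1 (disc_le b.1 h).2.2.1
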